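/- For every sufficiently large constant C₀ > 1 there is a threshold A₀(C₀) such that for every dyadic A ≥ A₀(C₀), every 0 < ε ≤ 1/A, and all integers N₁ ≤ N₂, there exist smooth maps φ_n: H → ℝ^{29} (N₁ ≤ n ≤ N₂) with the following properties, where φ_{≥n} := Σ_{n≤n'≤N₂} A^{−ε(n'−n)} φ_{n'}: (a) ‖φ_n‖_{C^{20}_{A^n}} ≤ C₀·A^n for all N₁ ≤ n ≤ N₂, and ‖∇²φ_{≥N₁}‖_{C^{18,α}_{A^{N₁}}} ≤ C₀·A^{−N₁}; (b) for every N₁ ≤ n ≤ N₂ the sum Σ_{n<n'≤N₂} A^{−ε(n'−n)} B(φ_n, φ_{n'}) vanishes identically on H; (c) for every p ∈ H and N₁ ≤ n ≤ N₂: |Xφ_n(p)|, |Yφ_n(p)| ≥ C₀^{−1}; |Xφ_{≥N₁}(p) ∧ Yφ_{≥N₁}(p)| ≥ C₀^{−4}·|Xφ_{≥N₁}(p)|·|Yφ_{≥N₁}(p)|; and |⋀_{W = X,Y,Z,XX,YY,XY} Wφ_{≥n}(p)| ≥ C₀^{−17}·A^{−4n}·|Xφ_{≥n}(p)|·|Yφ_{≥n}(p)|.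 -/

import Mathlib

open scoped ENNReal NNReal RealInnerProductSpace BigOperators

noncomputable section

/-- The Heisenberg group `H`, identified as a set with `ℝ³`. -/
abbrev H : Type := ℝ × ℝ × ℝ

namespace Heisenberg

/-- The group law `[a,b,c]·[x,y,z] = [x+a, y+b, z+c+a·y]`. -/
def mul (p q : H) : H := (q.1 + p.1, q.2.1 + p.2.1, q.2.2 + p.2.2 + p.1 * q.2.1)

/-- The group inverse `[x,y,z]⁻¹ = [−x,−y,−z+xy]`. -/
def inv (p : H) : H := (-p.1, -p.2.1, -p.2.2 + p.1 * p.2.1)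

/-- Membership in the integer lattice `Γ`. -/
def inGamma (p : H) : Prop :=
  (∃ a : ℤ, p.1 = (a : ℝ)) ∧ (∃ b : ℤ, p.2.1 = (b : ℝ)) ∧ (∃ c : ℤ, p.2.2 = (c : ℝ))

/-- Flow along the vector field `X`: `exp(tX)[x,y,z] = [x+t, y, z+t·y]`. -/
def flowX (t : ℝ) (p : H) : H := (p.1 + t, p.2.1, p.2.2 + t * p.2.1)

/-- Flow along the vector field `Y`: `exp(tY)[x,y,z] = [x, y+t, z]`. -/
def flowY (t : ℝ) (p : H) : H := (p.1, p.2.1 + t, p.2.2)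

def flow : Bool → ℝ → H → H
  | true => flowX
  | false => flowY

/-- `applyFlows [(W₁,t₁),…,(W_k,t_k)] p = exp(t₁W₁)⋯exp(t_kW_k) p`. -/
def applyFlows : List (Bool × ℝ) → H → H
  | [], p => p
  | wt :: l, p => flow wt.1 wt.2 (applyFlows l p)

/-- The Carnot–Carathéodory metric on `H`. -/
def ccDist (p p' : H) : ℝ :=
  sInf { s | ∃ l : List (Bool × ℝ), applyFlows l p = p' ∧ s = (l.map fun wt => |wt.2|).sum }

/-- The parabolic dilation `δ_λ[x,y,z] = [λx, λy, λ²z]`. -/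
def dilate (lam : ℝ) (p : H) : H := (lam * p.1, lam * p.2.1, lam ^ 2 * p.2.2)

variable {E : Type*} [NormedAddCommGroup E] [NormedSpace ℝ E]

/-- The right-invariant vector field `X = ∂/∂x + y ∂/∂z` acting on functions. -/
def XD (φ : H → E) : H → E := fun p => fderiv ℝ φ p (1, 0, p.2.1)

/-- The right-invariant vector field `Y = ∂/∂y` acting on functions. -/
def YD (φ : H → E) : H → E := fun p => fderiv ℝ φ p (0, 1, 0)

/-- The vector field `Z = ∂/∂z` acting on functions. -/
def ZD (φ : H → E) : H → E := fun p => fderiv ℝ φ p (0, 0, 1)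

def WD : Bool → (H → E) → H → E
  | true => XD
  | false => YD

/-- `X`, `Y`, `Z` indexed by `Fin 3`. -/
def WD3 : Fin 3 → (H → E) → H → E := ![XD, YD, ZD]

/-- The pointwise (Euclidean) norm `|∇^j φ(p)|` of the `j`-th iterated horizontal
gradient `∇^jφ`, computed via the words of length `j` in `X, Y`. -/
def gradNorm (j : ℕ) (φ : H → E) (p : H) : ℝ :=
  Real.sqrt (∑ w : Fin j → Bool, ‖(List.ofFn w).foldr WD φ p‖ ^ 2)

/-- `‖∇^m φ‖_{C^k_R}`, valued in `ℝ≥0∞`. -/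
def CkRS (m k : ℕ) (R : ℝ) (φ : H → E) : ℝ≥0∞ :=
  ∑ j ∈ Finset.range (k + 1),
    ENNReal.ofReal (R ^ j) * ⨆ p : H, ENNReal.ofReal (gradNorm (m + j) φ p)

/-- The homogeneous Hölder seminorm `‖∇^m φ‖_{Ċ^{0,α}}`, valued in `ℝ≥0∞`. -/
def gradHolderS (m : ℕ) (α : ℝ) (φ : H → E) : ℝ≥0∞ :=
  ⨆ (p : H) (q : H) (_ : p ≠ q),
    ENNReal.ofReal (Real.sqrt (∑ w : Fin m → Bool,
        ‖(List.ofFn w).foldr WD φ p - (List.ofFn w).foldr WD φ q‖ ^ 2)) /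
      ENNReal.ofReal (ccDist p q ^ α)

/-- `‖∇^m φ‖_{C^{k,α}_R}`, valued in `ℝ≥0∞`. -/
def CkAS (m k : ℕ) (α R : ℝ) (φ : H → E) : ℝ≥0∞ :=
  CkRS m k R φ + ENNReal.ofReal (R ^ ((k : ℝ) + α)) * gradHolderS (m + k) α φ

/-- `‖φ‖_{C^k_R}`. -/
abbrev CkR (k : ℕ) (R : ℝ) (φ : H → E) : ℝ≥0∞ := CkRS 0 k R φ

/-- `‖φ‖_{C^{k,α}_R}`. -/
abbrev CkA (k : ℕ) (α R : ℝ) (φ : H → E) : ℝ≥0∞ := CkAS 0 k α R φ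

/-- A dyadic number is one of the form `2^m`, `m ∈ ℤ`. -/
def IsDyadic (A : ℝ) : Prop := ∃ m : ℤ, A = 2 ^ m

/-- The norm `|v₁ ∧ ⋯ ∧ v_k|` of a wedge product of vectors of `ℝ^D`, via the
Cauchy–Binet (Gram determinant) formula. -/
def wedgeNorm {D k : ℕ} (v : Fin k → EuclideanSpace ℝ (Fin D)) : ℝ :=
  Real.sqrt (Matrix.det (Matrix.of fun i j => ⟪v i, v j⟫))

end Heisenberg

open Heisenberg
open scoped RealInnerProductSpace

/-- `φ_{≥n} = Σ_{n ≤ n' ≤ N₂} A^{-ε(n'-n)} φ_{n'}`. -/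
noncomputable def Heisenberg.phiGe (A ε : ℝ) (N₂ : ℤ) (φ : ℤ → H → EuclideanSpace ℝ (Fin 29))
    (n : ℤ) : H → EuclideanSpace ℝ (Fin 29) :=
  fun p => ∑ n' ∈ Finset.Icc n N₂, A ^ (-(ε * ((n' : ℝ) - (n : ℝ)))) • φ n' p

namespace Heisenberg

section Calculus

variable {E F : Type*} [NormedAddCommGroup E] [NormedSpace ℝ E]
  [NormedAddCommGroup F] [InnerProductSpace ℝ F]

/-- The direction at `p` of the vector field `X` (`true`) or `Y` (`false`). -/
def dir (b : Bool) (p : H) : H := if b then (1, 0, p.2.1) else (0, 1, 0)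

lemma WD_apply (b : Bool) (u : H → E) (p : H) : WD b u p = fderiv ℝ u p (dir b p) := by
  cases b <;> rfl

lemma contDiff_dir (b : Bool) : ContDiff ℝ (⊤ : ℕ∞) (dir b) := by
  cases b
  · exact contDiff_const
  · exact contDiff_const.prodMk (contDiff_const.prodMk (contDiff_fst.comp contDiff_snd))

lemma contDiff_WD (b : Bool) {u : H → E} (hu : ContDiff ℝ (⊤ : ℕ∞) u) :
    ContDiff ℝ (⊤ : ℕ∞) (WD b u) := by
  have h : WD b u = fun p => fderiv ℝ u p (dir b p) := funext (WD_apply b u)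
  rw [h]
  exact (hu.fderiv_right (m := (⊤ : ℕ∞)) (by simp)).clm_apply (contDiff_dir b)

lemma contDiff_differentiableAt {u : H → E} (hu : ContDiff ℝ (⊤ : ℕ∞) u) (p : H) :
    DifferentiableAt ℝ u p := (hu.differentiable (by simp)).differentiableAt

lemma WD_add (b : Bool) {u v : H → E} (hu : ContDiff ℝ (⊤ : ℕ∞) u)
    (hv : ContDiff ℝ (⊤ : ℕ∞) v) :
    WD b (fun p => u p + v p) = fun p => WD b u p + WD b v p := by
  funext p
  simp only [WD_apply]
  rw [fderiv_fun_add (contDiff_differentiableAt hu p) (contDiff_differentiableAt hv p)]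
  rfl

lemma WD_sum {ι : Type*} (s : Finset ι) (b : Bool) {u : ι → H → E}
    (hu : ∀ i ∈ s, ContDiff ℝ (⊤ : ℕ∞) (u i)) :
    WD b (fun p => ∑ i ∈ s, u i p) = fun p => ∑ i ∈ s, WD b (u i) p := by
  funext p
  simp only [WD_apply]
  rw [fderiv_fun_sum (fun i hi => contDiff_differentiableAt (hu i hi) p)]
  simp

lemma WD_const_smul (b : Bool) (c : ℝ) {u : H → E} (hu : ContDiff ℝ (⊤ : ℕ∞) u) :
    WD b (fun p => c • u p) = fun p => c • WD b u p := by
  funext p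
  simp only [WD_apply]
  rw [fderiv_fun_const_smul (contDiff_differentiableAt hu p)]
  rfl

lemma WD_smul (b : Bool) {f : H → ℝ} {u : H → E} (hf : ContDiff ℝ (⊤ : ℕ∞) f)
    (hu : ContDiff ℝ (⊤ : ℕ∞) u) :
    WD b (fun p => f p • u p) = fun p => WD b f p • u p + f p • WD b u p := by
  funext p
  simp only [WD_apply]
  rw [fderiv_fun_smul (contDiff_differentiableAt hf p) (contDiff_differentiableAt hu p)]
  simp [add_comm]

lemma WD_inner (b : Bool) {u v : H → F} (hu : ContDiff ℝ (⊤ : ℕ∞) u)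
    (hv : ContDiff ℝ (⊤ : ℕ∞) v) (p : H) :
    WD b (fun p => ⟪u p, v p⟫) p = ⟪u p, WD b v p⟫ + ⟪WD b u p, v p⟫ := by
  simp only [WD_apply]
  rw [fderiv_inner_apply ℝ (contDiff_differentiableAt hu p) (contDiff_differentiableAt hv p)]

lemma WD_const (b : Bool) (c : E) : WD b (fun _ : H => c) = fun _ => 0 := by
  funext p
  simp [WD_apply]

lemma contDiff_dilate (c : ℝ) : ContDiff ℝ (⊤ : ℕ∞) (dilate c) := by
  unfold dilate
  fun_prop

lemma WD_dilate (b : Bool) (c : ℝ) {u : H → E} (hu : ContDiff ℝ (⊤ : ℕ∞) u) :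
    WD b (fun p => u (dilate c p)) = fun p => c • WD b u (dilate c p) := by
  funext p
  have hd : HasFDerivAt (dilate c)
      ((c • ContinuousLinearMap.fst ℝ ℝ (ℝ × ℝ)).prod
        ((c • (ContinuousLinearMap.fst ℝ ℝ ℝ).comp (ContinuousLinearMap.snd ℝ ℝ (ℝ × ℝ))).prod
          (c ^ 2 • (ContinuousLinearMap.snd ℝ ℝ ℝ).comp
            (ContinuousLinearMap.snd ℝ ℝ (ℝ × ℝ))))) p := by
    refine HasFDerivAt.prodMk ?_ (HasFDerivAt.prodMk ?_ ?_)
    · exact hasFDerivAt_fst.const_mul c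
    · exact ((hasFDerivAt_fst (𝕜 := ℝ) (p := p.2)).comp p hasFDerivAt_snd).const_mul c
    · exact ((hasFDerivAt_snd (𝕜 := ℝ) (p := p.2)).comp p hasFDerivAt_snd).const_mul (c ^ 2)
  have := (contDiff_differentiableAt hu (dilate c p)).hasFDerivAt.comp p hd
  have h2 : HasFDerivAt (fun p => u (dilate c p)) _ p := this
  rw [WD_apply, WD_apply, h2.fderiv, ContinuousLinearMap.comp_apply, ← map_smul]
  congr 1
  cases b <;> simp [dir, dilate, pow_two, mul_assoc]

lemma contDiff_foldr_WD {u : H → E} (hu : ContDiff ℝ (⊤ : ℕ∞) u) (l : List Bool) :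
    ContDiff ℝ (⊤ : ℕ∞) (l.foldr WD u) := by
  induction l with
  | nil => exact hu
  | cons b l ih => exact contDiff_WD b ih

/-- Iterated horizontal derivatives commute with dilations up to scaling. -/
lemma foldr_WD_dilate (c : ℝ) {u : H → E} (hu : ContDiff ℝ (⊤ : ℕ∞) u) (l : List Bool) :
    l.foldr WD (fun p => u (dilate c p)) =
      fun p => c ^ l.length • l.foldr WD u (dilate c p) := by
  induction l with
  | nil => simp
  | cons b l ih =>
    have h := contDiff_foldr_WD hu l
    rw [List.foldr_cons, ih, WD_const_smul (u := fun p => l.foldr WD u (dilate c p)) b _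
      (h.comp (contDiff_dilate c)), WD_dilate b c h]
    funext p
    simp [smul_smul, pow_succ]

lemma foldr_WD_const_smul (c : ℝ) {u : H → E} (hu : ContDiff ℝ (⊤ : ℕ∞) u) (l : List Bool) :
    l.foldr WD (fun p => c • u p) = fun p => c • l.foldr WD u p := by
  induction l with
  | nil => rfl
  | cons b l ih =>
    rw [List.foldr_cons, ih, WD_const_smul b _ (contDiff_foldr_WD hu l)]
    rfl

/-- The commutator identity `Z = YX − XY`. -/
lemma ZD_eq {u : H → E} (hu : ContDiff ℝ (⊤ : ℕ∞) u) (p : H) :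
    ZD u p = WD false (WD true u) p - WD true (WD false u) p := by
  have hd : DifferentiableAt ℝ (fderiv ℝ u) p :=
    ((hu.fderiv_right (m := (⊤ : ℕ∞)) (by simp)).differentiable (by simp)).differentiableAt
  have key : ∀ b b', WD b (WD b' u) p =
      fderiv ℝ (fderiv ℝ u) p (dir b p) (dir b' p) +
        fderiv ℝ u p (fderiv ℝ (dir b') p (dir b p)) := by
    intro b b'
    have h : WD b' u = fun p => fderiv ℝ u p (dir b' p) := funext (WD_apply b' u)
    rw [WD_apply, h, fderiv_clm_apply hd (contDiff_differentiableAt (contDiff_dir b') p)]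
    simp [add_comm]
  have hsymm : IsSymmSndFDerivAt ℝ u p :=
    hu.contDiffAt.isSymmSndFDerivAt (by
      rw [minSmoothness_of_isRCLikeNormedField]
      exact WithTop.coe_le_coe.2 (le_top (a := (2 : ℕ∞))))
  rw [key, key, hsymm.eq (dir false p) (dir true p)]
  have h1 : fderiv ℝ (dir false) p (dir true p) = 0 := by
    have : dir false = fun _ => ((0, 1, 0) : H) := rfl
    rw [this]; simp
  have h2 : fderiv ℝ (dir true) p (dir false p) = (0, 0, 1) := by
    have : HasFDerivAt (dir true) ((0 : H →L[ℝ] ℝ).prod ((0 : H →L[ℝ] ℝ).prod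
      ((ContinuousLinearMap.fst ℝ ℝ ℝ).comp (ContinuousLinearMap.snd ℝ ℝ (ℝ × ℝ))))) p :=
      (hasFDerivAt_const (1 : ℝ) p).prodMk ((hasFDerivAt_const (0 : ℝ) p).prodMk
        ((hasFDerivAt_fst (𝕜 := ℝ) (p := p.2)).comp p hasFDerivAt_snd))
    rw [this.fderiv]
    simp [dir]
  rw [h1, h2]
  simp [ZD]

end Calculus

end Heisenberg

namespace Heisenberg

section Complexification

/-- The parabolic complex neighbourhood of radius `r` of `H` inside `ℂ³`. -/
def tube (r : ℝ) : Set (ℂ × ℂ × ℂ) :=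
  {q | |q.1.im| ≤ r ∧ |q.2.1.im| ≤ r ∧ |q.2.2.im - q.1.im * q.2.1.re| ≤ r ^ 2}

/-- The inclusion of `H` into `ℂ³`. -/
def toC (p : H) : ℂ × ℂ × ℂ := ((p.1 : ℂ), (p.2.1 : ℂ), (p.2.2 : ℂ))

/-- `Bdd r M u` says that `u` has an entire extension bounded by `M` on the tube of radius `r`. -/
def Bdd (r M : ℝ) (u : H → ℝ) : Prop :=
  ∃ U : ℂ × ℂ × ℂ → ℂ, ContDiff ℂ (⊤ : ℕ∞) U ∧ (∀ p, U (toC p) = (u p : ℂ)) ∧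
    ∀ q ∈ tube r, ‖U q‖ ≤ M

lemma toC_mem_tube (p : H) {r : ℝ} (hr : 0 ≤ r) : toC p ∈ tube r := by
  simp [tube, toC, hr]

lemma tube_mono {r s : ℝ} (hr : 0 ≤ r) (h : r ≤ s) : tube r ⊆ tube s := by
  rintro q ⟨h1, h2, h3⟩
  exact ⟨h1.trans h, h2.trans h, h3.trans (pow_le_pow_left₀ hr h 2)⟩

namespace Bdd

variable {r s M N : ℝ} {u v : H → ℝ}

lemma abs_le (hu : Bdd r M u) (hr : 0 ≤ r) (p : H) : |u p| ≤ M := by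
  obtain ⟨U, -, h2, h3⟩ := hu
  simpa [h2] using h3 _ (toC_mem_tube p hr)

lemma nonneg (hu : Bdd r M u) (hr : 0 ≤ r) : 0 ≤ M :=
  (abs_nonneg _).trans (hu.abs_le hr 0)

lemma mono (hu : Bdd r M u) (hs : 0 ≤ s) (hsr : s ≤ r) (hM : M ≤ N) : Bdd s N u := by
  obtain ⟨U, h1, h2, h3⟩ := hu
  exact ⟨U, h1, h2, fun q hq => (h3 q (tube_mono hs hsr hq)).trans hM⟩

lemma const (r : ℝ) {c : ℝ} (h : |c| ≤ M) : Bdd r M (fun _ => c) :=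
  ⟨fun _ => c, contDiff_const, fun _ => rfl, fun _ _ => by simpa using h⟩

lemma add (hu : Bdd r M u) (hv : Bdd r N v) : Bdd r (M + N) (fun p => u p + v p) := by
  obtain ⟨U, h1, h2, h3⟩ := hu
  obtain ⟨V, g1, g2, g3⟩ := hv
  exact ⟨fun q => U q + V q, h1.add g1, fun p => by simp [h2, g2],
    fun q hq => (norm_add_le _ _).trans (add_le_add (h3 q hq) (g3 q hq))⟩

lemma mul (hr : 0 ≤ r) (hu : Bdd r M u) (hv : Bdd r N v) :
    Bdd r (M * N) (fun p => u p * v p) := by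
  have hM := hu.nonneg hr
  obtain ⟨U, h1, h2, h3⟩ := hu
  obtain ⟨V, g1, g2, g3⟩ := hv
  refine ⟨fun q => U q * V q, h1.mul g1, fun p => by simp [h2, g2], fun q hq => ?_⟩
  rw [norm_mul]
  exact mul_le_mul (h3 q hq) (g3 q hq) (norm_nonneg _) hM

lemma const_mul (hr : 0 ≤ r) (c : ℝ) (hu : Bdd r M u) : Bdd r (|c| * M) (fun p => c * u p) :=
  mul hr (const r le_rfl) hu

lemma sum {ι : Type*} (t : Finset ι) {u : ι → H → ℝ} {M : ι → ℝ}
    (hu : ∀ i ∈ t, Bdd r (M i) (u i)) : Bdd r (∑ i ∈ t, M i) (fun p => ∑ i ∈ t, u i p) := by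
  classical
  induction t using Finset.induction_on with
  | empty => simpa using const r (c := 0) (M := 0) (by simp)
  | insert a t ha ih =>
    simp only [Finset.sum_insert ha]
    exact (hu a (by simp)).add (ih fun i hi => hu i (by simp [hi]))

lemma prod (hr : 0 ≤ r) {ι : Type*} (t : Finset ι) {u : ι → H → ℝ} {M : ℝ}
    (hu : ∀ i ∈ t, Bdd r M (u i)) : Bdd r (M ^ t.card) (fun p => ∏ i ∈ t, u i p) := by
  classical
  induction t using Finset.induction_on with
  | empty => simpa using const r (c := 1) (M := 1) (by simp)
  | insert a t ha ih =>
    simp only [Finset.prod_insert ha, Finset.card_insert_of_notMem ha, pow_succ']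
    exact mul hr (hu a (by simp)) (ih fun i hi => hu i (by simp [hi]))

lemma contDiff (hu : Bdd r M u) : ContDiff ℝ (⊤ : ℕ∞) u := by
  obtain ⟨U, h1, h2, -⟩ := hu
  have h : u = fun p => (U (toC p)).re := by funext p; simp [h2]
  have ht : ContDiff ℝ (⊤ : ℕ∞) toC := by
    unfold toC
    exact (Complex.ofRealCLM.contDiff.comp contDiff_fst).prodMk
      ((Complex.ofRealCLM.contDiff.comp (contDiff_fst.comp contDiff_snd)).prodMk
        (Complex.ofRealCLM.contDiff.comp (contDiff_snd.comp contDiff_snd)))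
  rw [h]
  exact Complex.reCLM.contDiff.comp ((h1.restrict_scalars ℝ).comp ht)

/-- The complexification of the direction `dir b`. -/
def dirC (b : Bool) (q : ℂ × ℂ × ℂ) : ℂ × ℂ × ℂ := if b then (1, 0, q.2.1) else (0, 1, 0)

lemma contDiff_dirC (b : Bool) : ContDiff ℂ (⊤ : ℕ∞) (dirC b) := by
  cases b
  · exact contDiff_const
  · exact contDiff_const.prodMk (contDiff_const.prodMk (contDiff_fst.comp contDiff_snd))

lemma add_smul_dirC_mem (b : Bool) (hs : 0 ≤ s) {q : ℂ × ℂ × ℂ} (hq : q ∈ tube s) {t : ℂ}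
    (ht : ‖t‖ ≤ s) : q + t • dirC b q ∈ tube (2 * s) := by
  obtain ⟨h1, h2, h3⟩ := hq
  have hre := (Complex.abs_re_le_norm t).trans ht
  have him := (Complex.abs_im_le_norm t).trans ht
  cases b
  · refine ⟨?_, ?_, ?_⟩
    · simp [dirC]; linarith
    · simp only [dirC]
      simpa using (abs_add_le _ _).trans (by linarith : |q.2.1.im| + |t.im| ≤ 2 * s)
    · have e : (q + t • dirC false q).2.2.im -
          (q + t • dirC false q).1.im * (q + t • dirC false q).2.1.re =
          (q.2.2.im - q.1.im * q.2.1.re) - q.1.im * t.re := by simp [dirC]; ring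
      rw [e]
      refine (abs_sub _ _).trans ?_
      rw [abs_mul]
      nlinarith [mul_le_mul h1 hre (abs_nonneg _) hs]
  · refine ⟨?_, ?_, ?_⟩
    · simp only [dirC]
      simpa using (abs_add_le _ _).trans (by linarith : |q.1.im| + |t.im| ≤ 2 * s)
    · simp [dirC]; linarith
    · have e : (q + t • dirC true q).2.2.im -
          (q + t • dirC true q).1.im * (q + t • dirC true q).2.1.re =
          (q.2.2.im - q.1.im * q.2.1.re) + t.re * q.2.1.im := by simp [dirC]; ring
      rw [e]
      refine (abs_add_le _ _).trans ?_
      rw [abs_mul]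
      nlinarith [mul_le_mul hre h2 (abs_nonneg _) hs]

lemma hasFDerivAt_toC (p : H) : HasFDerivAt toC
    ((Complex.ofRealCLM.comp (ContinuousLinearMap.fst ℝ ℝ (ℝ × ℝ))).prod
      ((Complex.ofRealCLM.comp ((ContinuousLinearMap.fst ℝ ℝ ℝ).comp
        (ContinuousLinearMap.snd ℝ ℝ (ℝ × ℝ)))).prod
        (Complex.ofRealCLM.comp ((ContinuousLinearMap.snd ℝ ℝ ℝ).comp
        (ContinuousLinearMap.snd ℝ ℝ (ℝ × ℝ)))))) p :=
  ContinuousLinearMap.hasFDerivAt (𝕜 := ℝ)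
    ((Complex.ofRealCLM.comp (ContinuousLinearMap.fst ℝ ℝ (ℝ × ℝ))).prod
      ((Complex.ofRealCLM.comp ((ContinuousLinearMap.fst ℝ ℝ ℝ).comp
        (ContinuousLinearMap.snd ℝ ℝ (ℝ × ℝ)))).prod
        (Complex.ofRealCLM.comp ((ContinuousLinearMap.snd ℝ ℝ ℝ).comp
        (ContinuousLinearMap.snd ℝ ℝ (ℝ × ℝ))))))

/-- Cauchy's estimate for the horizontal derivatives. -/
lemma WD (b : Bool) (hs : 1 ≤ s) (hu : Bdd (2 * s) M u) : Bdd s M (WD b u) := by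
  have hM := hu.nonneg (by linarith)
  have hdiff := hu.contDiff
  obtain ⟨U, h1, h2, h3⟩ := hu
  have hd : ∀ q, DifferentiableAt ℂ U q := fun q => (h1.differentiable (by simp)).differentiableAt
  refine ⟨fun q => fderiv ℂ U q (dirC b q), (h1.fderiv_right (m := (⊤ : ℕ∞)) (by simp)).clm_apply
    (contDiff_dirC b), fun p => ?_, fun q hq => ?_⟩
  · have e1 : HasFDerivAt (fun p => U (toC p)) _ p :=
      ((hd (toC p)).hasFDerivAt.restrictScalars ℝ).comp p (hasFDerivAt_toC p)
    have e2 : HasFDerivAt (fun p => ((u p : ℝ) : ℂ)) _ p :=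
      Complex.ofRealCLM.hasFDerivAt.comp p (contDiff_differentiableAt hdiff p).hasFDerivAt
    have e3 : (fun p => U (toC p)) = fun p => ((u p : ℝ) : ℂ) := funext h2
    rw [e3] at e1
    have e4 := DFunLike.congr_fun (e1.unique e2) (dir b p)
    rw [WD_apply]
    show fderiv ℂ U (toC p) (dirC b (toC p)) = _
    have e5 : dirC b (toC p) = toC (dir b p) := by
      cases b <;> simp [dirC, toC, dir]
    rw [e5]
    exact e4
  · have hg : ∀ t : ℂ, HasDerivAt (fun t : ℂ => U (q + t • dirC b q))
        (fderiv ℂ U (q + t • dirC b q) (dirC b q)) t := by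
      intro t
      have : HasDerivAt (fun t : ℂ => q + t • dirC b q) (dirC b q) t := by
        simpa using ((hasDerivAt_id t).smul_const (dirC b q)).const_add q
      exact (hd _).hasFDerivAt.comp_hasDerivAt t this
    have := Complex.norm_deriv_le_of_forall_mem_sphere_norm_le (c := 0) (R := s) (C := M)
      (f := fun t : ℂ => U (q + t • dirC b q)) (by linarith)
      (Differentiable.diffContOnCl fun t => (hg t).differentiableAt)
      (fun t ht => h3 _ (add_smul_dirC_mem b (by linarith) hq (by simpa using ht.le)))
    rw [(hg 0).deriv] at this
    simp only [zero_smul, add_zero] at this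
    exact this.trans (div_le_self hM hs)

lemma dilate (hu : Bdd r M u) {A : ℝ} (hA : 0 < A) :
    Bdd (A * r) M (fun p => u (dilate A⁻¹ p)) := by
  obtain ⟨U, h1, h2, h3⟩ := hu
  refine ⟨fun q => U ((A⁻¹ : ℝ) * q.1, (A⁻¹ : ℝ) * q.2.1, ((A⁻¹ ^ 2 : ℝ) : ℂ) * q.2.2), ?_,
    fun p => ?_, ?_⟩
  · exact h1.comp ((contDiff_const.mul contDiff_fst).prodMk
      ((contDiff_const.mul (contDiff_fst.comp contDiff_snd)).prodMk
        (contDiff_const.mul (contDiff_snd.comp contDiff_snd))))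
  · rw [← h2]
    simp [toC, Heisenberg.dilate]
  · rintro q ⟨g1, g2, g3⟩
    have hA' : 0 < A⁻¹ := inv_pos.2 hA
    have key : ∀ x, |x| ≤ A * r → |A⁻¹ * x| ≤ r := by
      intro x hx
      rw [abs_mul, abs_of_pos hA']
      calc A⁻¹ * |x| ≤ A⁻¹ * (A * r) := mul_le_mul_of_nonneg_left hx hA'.le
        _ = r := by field_simp
    refine h3 _ ⟨?_, ?_, ?_⟩
    · simpa only [Complex.im_ofReal_mul] using key _ g1
    · simpa only [Complex.im_ofReal_mul] using key _ g2
    · simp only [Complex.im_ofReal_mul, Complex.re_ofReal_mul]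
      have e : A⁻¹ ^ 2 * q.2.2.im - A⁻¹ * q.1.im * (A⁻¹ * q.2.1.re) =
        A⁻¹ ^ 2 * (q.2.2.im - q.1.im * q.2.1.re) := by ring
      rw [e, abs_mul, abs_of_pos (by positivity)]
      calc A⁻¹ ^ 2 * _ ≤ A⁻¹ ^ 2 * (A * r) ^ 2 := mul_le_mul_of_nonneg_left g3 (by positivity)
        _ = r ^ 2 := by field_simp

/-- On a much thinner tube, the extension is almost bounded by the real supremum. -/
lemma freeze (hu : Bdd r M u) (hr : 0 ≤ r) {m T : ℝ} (hm : ∀ p, |u p| ≤ m) (hT : 2 ≤ T) :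
    Bdd (r / T) (m + 2 * M / T) u := by
  obtain ⟨U, h1, h2, h3⟩ := hu
  refine ⟨U, h1, h2, ?_⟩
  rintro q ⟨g1, g2, g3⟩
  set x : ℂ × ℂ × ℂ := ((q.1.re : ℂ), (q.2.1.re : ℂ), (q.2.2.re : ℂ)) with hx
  set y : ℂ × ℂ × ℂ := ((q.1.im : ℂ), (q.2.1.im : ℂ), (q.2.2.im : ℂ)) with hy
  have hT0 : 0 < T := by linarith
  have hd : Differentiable ℂ (fun t : ℂ => U (x + t • y)) := by
    have := h1.differentiable (by simp)
    exact this.comp ((differentiable_const x).add (differentiable_id.smul_const y))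
  have hrT : 0 ≤ r / T := div_nonneg hr hT0.le
  have hrT' : r / T * T = r := by field_simp
  have hmem : ∀ t : ℂ, ‖t‖ ≤ T → x + t • y ∈ tube r := by
    intro t ht
    have hre := (Complex.abs_re_le_norm t).trans ht
    have him := (Complex.abs_im_le_norm t).trans ht
    refine ⟨?_, ?_, ?_⟩
    · simp only [hx, hy, Prod.fst_add, Prod.smul_fst, smul_eq_mul, Complex.add_im,
        Complex.ofReal_im, Complex.im_mul_ofReal, zero_add, abs_mul]
      calc |t.im| * |q.1.im| ≤ T * (r / T) := mul_le_mul him g1 (abs_nonneg _) hT0.le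
        _ = r := by field_simp
    · simp only [hx, hy, Prod.fst_add, Prod.snd_add, Prod.smul_snd, Prod.smul_fst, smul_eq_mul,
        Complex.add_im, Complex.ofReal_im, Complex.im_mul_ofReal, zero_add, abs_mul]
      calc |t.im| * |q.2.1.im| ≤ T * (r / T) := mul_le_mul him g2 (abs_nonneg _) hT0.le
        _ = r := by field_simp
    · have e : (x + t • y).2.2.im - (x + t • y).1.im * (x + t • y).2.1.re =
          t.im * (q.2.2.im - q.1.im * q.2.1.re) - (t.im * q.1.im) * (t.re * q.2.1.im) := by
        simp [hx, hy]; ring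
      rw [e]
      refine (abs_sub _ _).trans ?_
      simp only [abs_mul]
      have b1 : |t.im| * |q.2.2.im - q.1.im * q.2.1.re| ≤ T * (r / T) ^ 2 :=
        mul_le_mul him g3 (abs_nonneg _) hT0.le
      have him' : |t.im| * |t.re| ≤ T ^ 2 / 2 := by
        have h5 : |t.im| ^ 2 + |t.re| ^ 2 ≤ T ^ 2 := by
          rw [sq_abs, sq_abs]
          have := Complex.sq_norm t
          rw [Complex.normSq_apply] at this
          nlinarith [norm_nonneg t]
        nlinarith [sq_nonneg (|t.im| - |t.re|)]
      have b2 : |q.1.im| * |q.2.1.im| ≤ (r / T) ^ 2 := by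
        rw [pow_two]; exact mul_le_mul g1 g2 (abs_nonneg _) hrT
      have b3 : |t.im| * |q.1.im| * (|t.re| * |q.2.1.im|) ≤ T ^ 2 / 2 * (r / T) ^ 2 := by
        calc _ = (|t.im| * |t.re|) * (|q.1.im| * |q.2.1.im|) := by ring
          _ ≤ _ := mul_le_mul him' b2 (by positivity) (by positivity)
      have e2 : r ^ 2 = T ^ 2 * (r / T) ^ 2 := by rw [← mul_pow, mul_comm, hrT']
      rw [e2]
      nlinarith [sq_nonneg (r / T), mul_nonneg (sub_nonneg.2 hT) (mul_nonneg hT0.le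
        (sq_nonneg (r / T)))]
  have h0 : ‖U x‖ ≤ m := by
    have : x = toC (q.1.re, q.2.1.re, q.2.2.re) := rfl
    rw [this, h2]
    simpa using hm _
  have hM : ∀ t : ℂ, ‖t‖ ≤ T → ‖U (x + t • y)‖ ≤ M := fun t ht => h3 _ (hmem t ht)
  have hx0 : ‖U x‖ ≤ M := by simpa using hM 0 (by simpa using hT0.le)
  have := Complex.dist_le_div_mul_dist_of_mapsTo_ball (f := fun t : ℂ => U (x + t • y)) (c := 0)
    (R₁ := T) (R₂ := 2 * M) (z := Complex.I) hd.differentiableOn (fun t ht => by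
      rw [Metric.mem_closedBall, dist_eq_norm]
      simp only [zero_smul, add_zero]
      refine (norm_sub_le _ _).trans ?_
      linarith [hM t (by simpa using (Metric.mem_ball.1 ht).le)])
    (by simp; linarith)
  have eq : x + Complex.I • y = q := by
    ext1
    · simp only [hx, hy, Prod.fst_add, Prod.smul_fst, smul_eq_mul, mul_comm Complex.I,
        Complex.re_add_im]
    · ext1 <;> simp only [hx, hy, Prod.fst_add, Prod.smul_fst, Prod.snd_add, Prod.smul_snd,
        smul_eq_mul, mul_comm Complex.I, Complex.re_add_im]
  simp only [eq, zero_smul, add_zero, dist_eq_norm, sub_zero, Complex.norm_I, mul_one] at this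
  calc ‖U q‖ = ‖U x + (U q - U x)‖ := by ring_nf
    _ ≤ ‖U x‖ + ‖U q - U x‖ := norm_add_le _ _
    _ ≤ _ := add_le_add h0 this

/-- A slowed-down function is almost bounded by its real supremum. -/
lemma slow (hu : Bdd r M u) (hr : 0 ≤ r) (hM : 1 ≤ M) {m A : ℝ} (hm : ∀ p, |u p| ≤ m)
    (hA : 8 * M ≤ A) : Bdd (4 * r) (m + 1) (fun p => u (Heisenberg.dilate A⁻¹ p)) := by
  have h := (hu.freeze hr hm (T := 2 * M) (by linarith)).dilate (A := A) (by linarith)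
  have e : 2 * M / (2 * M) = 1 := div_self (by positivity)
  rw [e] at h
  refine h.mono (by positivity) ?_ le_rfl
  rw [← mul_div_assoc, le_div_iff₀ (by positivity)]
  nlinarith

end Bdd

end Complexification

end Heisenberg

namespace Heisenberg

section Theta

open Complex in
/-- The theta function of the Heisenberg group (the Weil–Brezin transform of a Gaussian). -/
def heisTheta (q : ℂ × ℂ × ℂ) : ℂ :=
  cexp (2 * Real.pi * I * q.2.2 - Real.pi * q.2.1 ^ 2) * jacobiTheta₂ (-q.1 - I * q.2.1) I

/-- Right translation by `[0, s, 0]`. -/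
def transC (s : ℝ) (q : ℂ × ℂ × ℂ) : ℂ × ℂ × ℂ := (q.1, q.2.1 + s, q.2.2 + s * q.1)

/-- The automorphism `[x, y, z] ↦ [-x, y, -z]`. -/
def reflC (q : ℂ × ℂ × ℂ) : ℂ × ℂ × ℂ := (-q.1, q.2.1, -q.2.2)

lemma contDiff_heisTheta : ContDiff ℂ (⊤ : ℕ∞) heisTheta := by
  have h : ContDiff ℂ (⊤ : ℕ∞) (fun z => jacobiTheta₂ z Complex.I) :=
    Differentiable.contDiff fun z => differentiableAt_jacobiTheta₂_fst z (by simp)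
  have h1 : ContDiff ℂ (⊤ : ℕ∞) (fun q : ℂ × ℂ × ℂ => q.1) := contDiff_fst
  have h2 : ContDiff ℂ (⊤ : ℕ∞) (fun q : ℂ × ℂ × ℂ => q.2.1) := contDiff_fst.comp contDiff_snd
  have h3 : ContDiff ℂ (⊤ : ℕ∞) (fun q : ℂ × ℂ × ℂ => q.2.2) := contDiff_snd.comp contDiff_snd
  exact (((contDiff_const.mul h3).sub (contDiff_const.mul (h2.pow 2))).cexp).mul
    (h.comp (h1.neg.sub (contDiff_const.mul h2)))

lemma contDiff_transC (s : ℝ) : ContDiff ℂ (⊤ : ℕ∞) (transC s) := by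
  unfold transC
  fun_prop

lemma contDiff_reflC : ContDiff ℂ (⊤ : ℕ∞) reflC := by
  unfold reflC
  fun_prop

lemma transC_mem_tube (s : ℝ) {r : ℝ} {q : ℂ × ℂ × ℂ} (hq : q ∈ tube r) :
    transC s q ∈ tube r := by
  obtain ⟨h1, h2, h3⟩ := hq
  refine ⟨h1, by simpa [transC] using h2, ?_⟩
  have : (transC s q).2.2.im - (transC s q).1.im * (transC s q).2.1.re =
      q.2.2.im - q.1.im * q.2.1.re := by simp [transC]; ring
  rwa [this]

lemma reflC_mem_tube {r : ℝ} {q : ℂ × ℂ × ℂ} (hq : q ∈ tube r) : reflC q ∈ tube r := by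
  obtain ⟨h1, h2, h3⟩ := hq
  refine ⟨by simpa [reflC] using h1, h2, ?_⟩
  have : (reflC q).2.2.im - (reflC q).1.im * (reflC q).2.1.re =
      -(q.2.2.im - q.1.im * q.2.1.re) := by simp [reflC]; ring
  rwa [this, abs_neg]

open Complex in
lemma heisTheta_transC_one (q : ℂ × ℂ × ℂ) : heisTheta (transC 1 q) = heisTheta q := by
  obtain ⟨x, y, z⟩ := q
  simp only [heisTheta, transC, ofReal_one, one_mul]
  have h := jacobiTheta₂_add_left' (-x - I * (y + 1)) I
  have e : -x - I * (y + 1) + I = -x - I * y := by ring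
  rw [e] at h
  rw [h, ← mul_assoc, ← Complex.exp_add]
  congr 2
  ring_nf
  simp only [I_sq]
  ring

lemma heisTheta_transC_int (n : ℤ) (q : ℂ × ℂ × ℂ) : heisTheta (transC n q) = heisTheta q := by
  have hp : Function.Periodic (fun t : ℝ => heisTheta (transC t q)) 1 := by
    intro t
    have : transC (t + 1) q = transC 1 (transC t q) := by
      simp only [transC, Prod.mk.injEq, true_and]
      constructor <;> push_cast <;> ring
    simp only [this, heisTheta_transC_one]
  have := (hp.int_mul n) 0
  simp only [mul_one, zero_add] at this
  rw [this]
  simp [transC]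

open Complex in
lemma heisTheta_reflC (p : H) : heisTheta (reflC (toC p)) = starRingEnd ℂ (heisTheta (toC p)) := by
  obtain ⟨x, y, z⟩ := p
  simp only [heisTheta, reflC, toC, map_mul, jacobiTheta₂_conj, ← Complex.exp_conj]
  rw [← jacobiTheta₂_neg_left]
  simp only [map_sub, map_mul, map_pow, map_neg, conj_I, conj_ofReal, map_ofNat]
  congr 2
  · ring
  · ring
  · ring

lemma exists_int_abs_sub_le (y : ℝ) : ∃ n : ℤ, |y + n| ≤ 1 / 2 :=
  ⟨-round y, by simpa [sub_eq_add_neg] using abs_sub_round y⟩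

open Complex in
lemma norm_heisTheta_le {r : ℝ} (hr : 0 ≤ r) : ∃ K, ∀ q ∈ tube r, ‖heisTheta q‖ ≤ K := by
  set b : ℤ → ℝ := fun n => Real.exp (-Real.pi * (1 * n ^ 2 - 2 * (r + 1 / 2) * |n|)) with hb
  have hsum : Summable b := by
    have := summable_pow_mul_jacobiTheta₂_term_bound (r + 1 / 2) one_pos 0
    simp only [pow_zero, one_mul] at this
    simpa only [hb, one_mul, Int.cast_abs] using this
  refine ⟨Real.exp (2 * Real.pi * (r ^ 2 + r / 2) + Real.pi * r ^ 2) * ∑' n, b n,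
    fun q hq => ?_⟩
  obtain ⟨n, hn⟩ := exists_int_abs_sub_le q.2.1.re
  rw [← heisTheta_transC_int n q]
  have hmem := transC_mem_tube (n : ℝ) hq
  have hy : |(transC n q).2.1.re| ≤ 1 / 2 := by simpa [transC] using hn
  generalize transC n q = w at hmem hy
  obtain ⟨h1, h2, h3⟩ := hmem
  rw [heisTheta, norm_mul]
  have hpi := Real.pi_pos
  refine mul_le_mul ?_ ?_ (norm_nonneg _) (Real.exp_nonneg _)
  · rw [Complex.norm_exp, Real.exp_le_exp]
    have e : (2 * Real.pi * I * w.2.2 - Real.pi * w.2.1 ^ 2 : ℂ).re =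
        -(2 * Real.pi * ((w.2.2.im - w.1.im * w.2.1.re) + w.1.im * w.2.1.re))
          - Real.pi * w.2.1.re ^ 2 + Real.pi * w.2.1.im ^ 2 := by
      simp [pow_two]; ring
    rw [e]
    have a1 : -r ^ 2 ≤ w.2.2.im - w.1.im * w.2.1.re := (abs_le.1 h3).1
    have a2 : -(r * (1 / 2)) ≤ w.1.im * w.2.1.re := by
      have : |w.1.im * w.2.1.re| ≤ r * (1 / 2) := by
        rw [abs_mul]; exact mul_le_mul h1 hy (abs_nonneg _) hr
      exact (abs_le.1 this).1
    have a3 : w.2.1.im ^ 2 ≤ r ^ 2 := by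
      rw [← sq_abs]; exact pow_le_pow_left₀ (abs_nonneg _) h2 2
    nlinarith [mul_nonneg hpi.le (sq_nonneg w.2.1.re), mul_le_mul_of_nonneg_left a3 hpi.le]
  · have him : |(-w.1 - I * w.2.1).im| ≤ r + 1 / 2 := by
      have : (-w.1 - I * w.2.1).im = -w.1.im - w.2.1.re := by simp
      rw [this]
      refine (abs_sub _ _).trans ?_
      rw [abs_neg]
      exact add_le_add h1 hy
    have hle := norm_jacobiTheta₂_term_le one_pos him (τ := I) (by simp)
    exact tsum_of_norm_bounded hsum.hasSum hle

open Complex in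
lemma quarter_le_norm_jacobiTheta₂ {w : ℂ} (hw : |w.im| ≤ 1 / 4) :
    1 / 4 ≤ ‖jacobiTheta₂ w I‖ := by
  set q : ℝ := Real.exp (-(Real.pi / 2)) with hq
  have hq0 : 0 < q := Real.exp_pos _
  have hq1 : q ≤ 1 / 4 := by
    rw [hq, Real.exp_neg]
    have h1 : Real.exp 1 * Real.exp (Real.pi / 2 - 1) = Real.exp (Real.pi / 2) := by
      rw [← Real.exp_add]; ring_nf
    have h2 := Real.pi_gt_d2
    have h3 := Real.exp_one_gt_d9
    have h4 := Real.add_one_le_exp (Real.pi / 2 - 1)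
    rw [one_div]
    gcongr
    nlinarith
  have hterm : ∀ n : ℕ, ∀ m : ℤ, |m| = n + 1 → ‖jacobiTheta₂_term m w I‖ ≤ q * q ^ n := by
    intro n m hm
    refine (norm_jacobiTheta₂_term_le one_pos hw (τ := I) (by simp) m).trans ?_
    have hm' : |(m : ℝ)| = n + 1 := by exact_mod_cast congrArg (Int.cast : ℤ → ℝ) hm
    rw [← pow_succ', hq, ← Real.exp_nat_mul, Real.exp_le_exp]
    have : (m : ℝ) ^ 2 = (n + 1) ^ 2 := by rw [← sq_abs, hm']
    push_cast
    rw [this, hm']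
    have hn : (0 : ℝ) ≤ n := Nat.cast_nonneg n
    nlinarith [Real.pi_pos, mul_nonneg Real.pi_pos.le hn,
      mul_nonneg Real.pi_pos.le (mul_nonneg hn hn)]
  have hs := (hasSum_jacobiTheta₂_term w (τ := I) (by simp)).nat_add_neg
  have hs1 := (hasSum_nat_add_iff' (f := fun n : ℕ => jacobiTheta₂_term n w I +
    jacobiTheta₂_term (-n) w I) 1).2 hs
  have h0 : jacobiTheta₂_term 0 w I = 1 := by simp [jacobiTheta₂_term]
  simp only [Finset.range_one, Finset.sum_singleton, Nat.cast_zero, neg_zero, h0] at hs1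
  have hg : HasSum (fun n : ℕ => 2 * (q * q ^ n)) (2 * (q * (1 - q)⁻¹)) :=
    ((hasSum_geometric_of_lt_one hq0.le (by linarith)).mul_left q).mul_left 2
  have hle : ‖jacobiTheta₂ w I + 1 - (1 + 1)‖ ≤ 2 * (q * (1 - q)⁻¹) := by
    rw [← hs1.tsum_eq]
    refine tsum_of_norm_bounded hg fun n => ?_
    refine (norm_add_le _ _).trans ?_
    have a1 := hterm n ((n + 1 : ℕ) : ℤ) (by rw [Nat.abs_cast]; push_cast; ring)
    have a2 := hterm n (-((n + 1 : ℕ) : ℤ)) (by rw [abs_neg, Nat.abs_cast]; push_cast; ring)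
    linarith
  have h34 : 2 * (q * (1 - q)⁻¹) ≤ 3 / 4 := by
    have : (1 - q)⁻¹ ≤ (3 / 4)⁻¹ := inv_anti₀ (by norm_num) (by linarith)
    have : q * (1 - q)⁻¹ ≤ 1 / 4 * (3 / 4)⁻¹ :=
      mul_le_mul hq1 this (inv_nonneg.2 (by linarith)) (by norm_num)
    linarith
  have h1 : ‖jacobiTheta₂ w I - 1‖ ≤ 3 / 4 := by
    have e : jacobiTheta₂ w I - 1 = jacobiTheta₂ w I + 1 - (1 + 1) := by ring
    rw [e]
    exact hle.trans h34
  have h2 := norm_sub_norm_le (1 : ℂ) (1 - jacobiTheta₂ w I)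
  rw [norm_sub_rev 1, norm_one, show (1 : ℂ) - (1 - jacobiTheta₂ w I) = jacobiTheta₂ w I by ring]
    at h2
  linarith

end Theta

end Heisenberg

namespace Heisenberg

section Oscillation

/-- `cos (a x + b y)`. -/
def planeCos (a b : ℝ) (p : H) : ℝ := Real.cos (a * p.1 + b * p.2.1)

/-- `sin (a x + b y)`. -/
def planeSin (a b : ℝ) (p : H) : ℝ := Real.sin (a * p.1 + b * p.2.1)

/-- The frequency seen by the vector field with index `c`. -/
def freq (a b : ℝ) (c : Bool) : ℝ := if c then a else b

lemma hasFDerivAt_plane (a b : ℝ) (p : H) : HasFDerivAt (fun p : H => a * p.1 + b * p.2.1)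
    (a • ContinuousLinearMap.fst ℝ ℝ (ℝ × ℝ) + b • (ContinuousLinearMap.fst ℝ ℝ ℝ).comp
      (ContinuousLinearMap.snd ℝ ℝ (ℝ × ℝ))) p :=
  ContinuousLinearMap.hasFDerivAt (𝕜 := ℝ) (a • ContinuousLinearMap.fst ℝ ℝ (ℝ × ℝ) +
    b • (ContinuousLinearMap.fst ℝ ℝ ℝ).comp (ContinuousLinearMap.snd ℝ ℝ (ℝ × ℝ)))

lemma WD_planeCos (a b : ℝ) (c : Bool) :
    WD c (planeCos a b) = fun p => -freq a b c * planeSin a b p := by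
  funext p
  rw [WD_apply, HasFDerivAt.fderiv (f := planeCos a b) (hasFDerivAt_plane a b p).cos]
  cases c <;> simp [dir, freq, planeSin] <;> ring

lemma WD_planeSin (a b : ℝ) (c : Bool) :
    WD c (planeSin a b) = fun p => freq a b c * planeCos a b p := by
  funext p
  rw [WD_apply, HasFDerivAt.fderiv (f := planeSin a b) (hasFDerivAt_plane a b p).sin]
  cases c <;> simp [dir, freq, planeCos] <;> ring

lemma ZD_planeCos (a b : ℝ) (p : H) : ZD (planeCos a b) p = 0 := by
  rw [ZD, HasFDerivAt.fderiv (f := planeCos a b) (hasFDerivAt_plane a b p).cos]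
  simp

lemma ZD_planeSin (a b : ℝ) (p : H) : ZD (planeSin a b) p = 0 := by
  rw [ZD, HasFDerivAt.fderiv (f := planeSin a b) (hasFDerivAt_plane a b p).sin]
  simp

lemma norm_cexp_plane_le (a b : ℝ) {r : ℝ} {q : ℂ × ℂ × ℂ} (hq : q ∈ tube r) {s : ℂ}
    (hs : s = Complex.I ∨ s = -Complex.I) :
    ‖Complex.exp (s * (a * q.1 + b * q.2.1))‖ ≤ Real.exp ((|a| + |b|) * r) := by
  rw [Complex.norm_exp, Real.exp_le_exp]
  have h : |a * q.1.im + b * q.2.1.im| ≤ (|a| + |b|) * r := by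
    refine (abs_add_le _ _).trans ?_
    rw [abs_mul, abs_mul, add_mul]
    exact add_le_add (mul_le_mul_of_nonneg_left hq.1 (abs_nonneg _))
      (mul_le_mul_of_nonneg_left hq.2.1 (abs_nonneg _))
  have h' := abs_le.1 h
  rcases hs with rfl | rfl
  · have : (Complex.I * (a * q.1 + b * q.2.1)).re = -(a * q.1.im + b * q.2.1.im) := by
      simp
    rw [this]; linarith
  · have : (-Complex.I * (a * q.1 + b * q.2.1)).re = a * q.1.im + b * q.2.1.im := by
      simp
    rw [this]; linarith

lemma exists_bdd_planeCos (a b r : ℝ) : ∃ K, Bdd r K (planeCos a b) := by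
  refine ⟨Real.exp ((|a| + |b|) * r), fun q => Complex.cos (a * q.1 + b * q.2.1), ?_, fun p => ?_,
    fun q hq => ?_⟩
  · exact Complex.contDiff_cos.comp ((contDiff_const.mul contDiff_fst).add
      (contDiff_const.mul (contDiff_fst.comp contDiff_snd)))
  · simp [toC, planeCos]
  · simp only [Complex.cos.eq_1]
    rw [norm_div, Complex.norm_two, div_le_iff₀ two_pos]
    refine (norm_add_le _ _).trans ?_
    have h1 := norm_cexp_plane_le a b hq (Or.inl rfl)
    have h2 := norm_cexp_plane_le a b hq (Or.inr rfl)
    rw [mul_comm] at h1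
    rw [neg_mul, mul_comm Complex.I, ← neg_mul] at h2
    linarith

lemma exists_bdd_planeSin (a b r : ℝ) : ∃ K, Bdd r K (planeSin a b) := by
  refine ⟨Real.exp ((|a| + |b|) * r), fun q => Complex.sin (a * q.1 + b * q.2.1), ?_, fun p => ?_,
    fun q hq => ?_⟩
  · exact Complex.contDiff_sin.comp ((contDiff_const.mul contDiff_fst).add
      (contDiff_const.mul (contDiff_fst.comp contDiff_snd)))
  · simp [toC, planeSin]
  · simp only [Complex.sin.eq_1]
    rw [norm_div, Complex.norm_two, div_le_iff₀ two_pos, norm_mul, Complex.norm_I,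
      mul_one]
    refine (norm_sub_le _ _).trans ?_
    have h1 := norm_cexp_plane_le a b hq (Or.inl rfl)
    have h2 := norm_cexp_plane_le a b hq (Or.inr rfl)
    rw [mul_comm] at h1
    rw [neg_mul, mul_comm Complex.I, ← neg_mul] at h2
    linarith

/-- The theta function translated by `s`. -/
def theta (s : ℝ) (p : H) : ℂ := heisTheta (transC s (toC p))

/-- Real part of the translated theta function. -/
def thetaRe (s : ℝ) (p : H) : ℝ := (theta s p).re

/-- Imaginary part of the translated theta function. -/
def thetaIm (s : ℝ) (p : H) : ℝ := (theta s p).im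

lemma heisTheta_reflC_transC (s : ℝ) (p : H) :
    heisTheta (reflC (transC s (toC p))) = starRingEnd ℂ (theta s p) := by
  have : transC s (toC p) = toC (p.1, p.2.1 + s, p.2.2 + s * p.1) := by
    simp [transC, toC]
  rw [theta, this, heisTheta_reflC]

lemma exists_bdd_thetaRe (s : ℝ) {r : ℝ} (hr : 0 ≤ r) : ∃ K, Bdd r K (thetaRe s) := by
  obtain ⟨K, hK⟩ := norm_heisTheta_le hr
  refine ⟨K, fun q => 2⁻¹ * (heisTheta (transC s q) + heisTheta (reflC (transC s q))), ?_,
    fun p => ?_, fun q hq => ?_⟩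
  · exact contDiff_const.mul ((contDiff_heisTheta.comp (contDiff_transC s)).add
      (contDiff_heisTheta.comp (contDiff_reflC.comp (contDiff_transC s))))
  · simp only [heisTheta_reflC_transC]
    rw [thetaRe, Complex.re_eq_add_conj, theta]
    ring
  · have hq' := transC_mem_tube s hq
    rw [norm_mul, norm_inv, Complex.norm_two]
    linarith [norm_add_le (heisTheta (transC s q)) (heisTheta (reflC (transC s q))),
      hK _ hq', hK _ (reflC_mem_tube hq')]

lemma exists_bdd_thetaIm (s : ℝ) {r : ℝ} (hr : 0 ≤ r) : ∃ K, Bdd r K (thetaIm s) := by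
  obtain ⟨K, hK⟩ := norm_heisTheta_le hr
  refine ⟨K, fun q => (2 * Complex.I)⁻¹ *
    (heisTheta (transC s q) - heisTheta (reflC (transC s q))), ?_, fun p => ?_, fun q hq => ?_⟩
  · exact contDiff_const.mul ((contDiff_heisTheta.comp (contDiff_transC s)).sub
      (contDiff_heisTheta.comp (contDiff_reflC.comp (contDiff_transC s))))
  · simp only [heisTheta_reflC_transC]
    rw [thetaIm, Complex.im_eq_sub_conj, theta, div_eq_inv_mul]
  · have hq' := transC_mem_tube s hq
    rw [norm_mul, norm_inv, norm_mul, Complex.norm_two, Complex.norm_I, mul_one]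
    linarith [norm_sub_le (heisTheta (transC s q)) (heisTheta (reflC (transC s q))),
      hK _ hq', hK _ (reflC_mem_tube hq')]

lemma theta_add_smul (s : ℝ) (p : H) (t : ℝ) :
    theta s (p + t • (0, 0, 1)) = Complex.exp (2 * Real.pi * Complex.I * t) * theta s p := by
  simp only [theta, heisTheta, transC, toC, ← mul_assoc, ← Complex.exp_add]
  simp
  left
  ring_nf

lemma hasDerivAt_theta (s : ℝ) (p : H) :
    HasDerivAt (fun t : ℝ => theta s (p + t • (0, 0, 1)))
      (2 * Real.pi * Complex.I * theta s p) 0 := by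
  simp only [theta_add_smul]
  have h : HasDerivAt (fun t : ℂ => Complex.exp (2 * Real.pi * Complex.I * t) * theta s p)
      (2 * Real.pi * Complex.I * theta s p) ((0 : ℝ) : ℂ) := by
    have h0 : HasDerivAt (fun t : ℂ => 2 * Real.pi * Complex.I * t) (2 * Real.pi * Complex.I)
        ((0 : ℝ) : ℂ) := by
      simpa using (hasDerivAt_id ((0 : ℝ) : ℂ)).const_mul (2 * Real.pi * Complex.I)
    simpa using h0.cexp.mul_const (theta s p)
  exact h.comp_ofReal

lemma ZD_eq_of_hasDerivAt {u : H → ℝ} (hu : ContDiff ℝ (⊤ : ℕ∞) u) {p : H} {c : ℝ}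
    (h : HasDerivAt (fun t : ℝ => u (p + t • (0, 0, 1))) c 0) : ZD u p = c := by
  have h1 : HasFDerivAt u (fderiv ℝ u p) (p + (0 : ℝ) • (0, 0, 1)) := by
    simpa using (contDiff_differentiableAt hu p).hasFDerivAt
  have h2 : HasDerivAt (fun t : ℝ => p + t • ((0, 0, 1) : H)) (0, 0, 1) 0 := by
    simpa using ((hasDerivAt_id (0 : ℝ)).smul_const ((0, 0, 1) : H)).const_add p
  exact (h1.comp_hasDerivAt 0 h2).unique h

lemma ZD_thetaRe (s : ℝ) (p : H) : ZD (thetaRe s) p = -(2 * Real.pi) * thetaIm s p := by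
  obtain ⟨K, hK⟩ := exists_bdd_thetaRe s zero_le_one
  have h := Complex.reCLM.hasFDerivAt.comp_hasDerivAt (0 : ℝ) (hasDerivAt_theta s p)
  have e := ZD_eq_of_hasDerivAt (u := thetaRe s) hK.contDiff h
  rw [e]
  simp [thetaIm]

lemma ZD_thetaIm (s : ℝ) (p : H) : ZD (thetaIm s) p = 2 * Real.pi * thetaRe s p := by
  obtain ⟨K, hK⟩ := exists_bdd_thetaIm s zero_le_one
  have h := Complex.imCLM.hasFDerivAt.comp_hasDerivAt (0 : ℝ) (hasDerivAt_theta s p)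
  have e := ZD_eq_of_hasDerivAt (u := thetaIm s) hK.contDiff h
  rw [e]
  simp [thetaRe]

lemma le_norm_theta {s : ℝ} {p : H} {n : ℤ} (h : |p.2.1 + s + n| ≤ 1 / 4) :
    Real.exp (-Real.pi) / 4 ≤ ‖theta s p‖ := by
  rw [theta, ← heisTheta_transC_int n, heisTheta, norm_mul, Complex.norm_exp]
  have e1 : (2 * Real.pi * Complex.I * (transC n (transC s (toC p))).2.2 -
      Real.pi * (transC n (transC s (toC p))).2.1 ^ 2 : ℂ).re =
      -(Real.pi * (p.2.1 + s + n) ^ 2) := by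
    simp [transC, toC, pow_two]
  have e2 : (-(transC n (transC s (toC p))).1 -
      Complex.I * (transC n (transC s (toC p))).2.1).im = -(p.2.1 + s + n) := by
    simp [transC, toC]
  have h1 := quarter_le_norm_jacobiTheta₂ (w := -(transC n (transC s (toC p))).1 -
      Complex.I * (transC n (transC s (toC p))).2.1) (by rw [e2, abs_neg]; exact h)
  rw [e1, div_eq_mul_one_div]
  refine mul_le_mul ?_ h1 (by norm_num) (Real.exp_nonneg _)
  rw [Real.exp_le_exp]
  have : (p.2.1 + s + n) ^ 2 ≤ 1 := by rw [← sq_abs]; nlinarith [abs_nonneg (p.2.1 + s + n)]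
  nlinarith [Real.pi_pos]

lemma le_sq_add_sq_theta (p : H) : (Real.exp (-Real.pi) / 4) ^ 2 ≤
    (thetaRe 0 p ^ 2 + thetaIm 0 p ^ 2) + (thetaRe (1 / 2) p ^ 2 + thetaIm (1 / 2) p ^ 2) := by
  have e : ∀ s, thetaRe s p ^ 2 + thetaIm s p ^ 2 = ‖theta s p‖ ^ 2 := fun s => by
    rw [Complex.sq_norm, Complex.normSq_apply, thetaRe, thetaIm]; ring
  rw [e, e]
  have key : ∀ s, Real.exp (-Real.pi) / 4 ≤ ‖theta s p‖ →
      (Real.exp (-Real.pi) / 4) ^ 2 ≤ ‖theta s p‖ ^ 2 := fun s hs =>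
    pow_le_pow_left₀ (by positivity) hs 2
  obtain ⟨n, hn⟩ := exists_int_abs_sub_le p.2.1
  obtain ⟨h1, h2⟩ := abs_le.1 hn
  by_cases h : |p.2.1 + n| ≤ 1 / 4
  · have := key 0 (le_norm_theta (n := n) (by simpa using h))
    linarith [sq_nonneg ‖theta (1 / 2) p‖]
  · have : Real.exp (-Real.pi) / 4 ≤ ‖theta (1 / 2) p‖ := by
      rcases lt_abs.1 (not_le.1 h) with h | h
      · refine le_norm_theta (n := n - 1) (abs_le.2 ⟨?_, ?_⟩) <;> push_cast <;> linarith
      · refine le_norm_theta (n := n) (abs_le.2 ⟨?_, ?_⟩) <;> linarith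
    linarith [key _ this, sq_nonneg ‖theta 0 p‖]

/-- Six functions with bounded entire extensions detecting `Z` and `XY` at every point. -/
def osc : Fin 6 → H → ℝ :=
  ![planeCos 1 1, planeSin 1 1, thetaRe 0, thetaIm 0, thetaRe (1 / 2), thetaIm (1 / 2)]

lemma exists_bdd_osc (i : Fin 6) {r : ℝ} (hr : 0 ≤ r) : ∃ K, Bdd r K (osc i) := by
  fin_cases i
  · exact exists_bdd_planeCos 1 1 r
  · exact exists_bdd_planeSin 1 1 r
  · exact exists_bdd_thetaRe 0 hr
  · exact exists_bdd_thetaIm 0 hr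
  · exact exists_bdd_thetaRe (1 / 2) hr
  · exact exists_bdd_thetaIm (1 / 2) hr

lemma sq_div_two_sub_le (a b : ℝ) : a ^ 2 / 2 - b ^ 2 ≤ (a + b) ^ 2 := by
  nlinarith [sq_nonneg (a + 2 * b)]

lemma mul_le_add_of_two_mul_sub_le {m K R c d : ℝ} (hm0 : 0 < m) (hm1 : m ≤ 1) (hK1 : 1 ≤ K)
    (hR0 : 0 ≤ R) (hR1 : 2 * (c ^ 2 * m) - 4 * (d ^ 2 * K ^ 2) ≤ R) :
    m / (8 * K ^ 2) * (c ^ 2 + d ^ 2) ≤ d ^ 2 + R := by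
  rw [div_mul_eq_mul_div, div_le_iff₀ (by positivity)]
  have hK2 : 1 ≤ K ^ 2 := one_le_pow₀ hK1
  have t1 : R ≤ R * K ^ 2 := le_mul_of_one_le_right hR0 hK2
  have t2 : m * d ^ 2 ≤ d ^ 2 := mul_le_of_le_one_left (sq_nonneg d) hm1
  have t3 : d ^ 2 ≤ d ^ 2 * K ^ 2 := le_mul_of_one_le_right (sq_nonneg d) hK2
  have t4 : 0 ≤ c ^ 2 * m := mul_nonneg (sq_nonneg c) hm0.le
  have e1 : (d ^ 2 + R) * (8 * K ^ 2) = 8 * (d ^ 2 * K ^ 2) + 8 * (R * K ^ 2) := by ring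
  have e2 : m * (c ^ 2 + d ^ 2) = c ^ 2 * m + m * d ^ 2 := by ring
  rw [e1, e2]
  linarith

lemma osc_nondegenerate : ∃ κ : ℝ, 0 < κ ∧ ∀ (p : H) (c d : ℝ), κ * (c ^ 2 + d ^ 2) ≤
    ∑ i, (c * ZD (osc i) p + d * WD true (WD false (osc i)) p) ^ 2 := by
  have hK : ∃ K : ℝ, 1 ≤ K ∧ ∀ i p, |WD true (WD false (osc i)) p| ≤ K := by
    have : ∀ i, ∃ K, ∀ p, |WD true (WD false (osc i)) p| ≤ K := fun i => by
      obtain ⟨K, hK⟩ := exists_bdd_osc i (r := 2 * (2 * 1)) (by norm_num)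
      exact ⟨K, fun p => ((hK.WD false (by norm_num)).WD true le_rfl).abs_le (by norm_num) p⟩
    choose K hK using this
    refine ⟨1 + ∑ i, |K i|, ?_, fun i p => (hK i p).trans ?_⟩
    · have : 0 ≤ ∑ i, |K i| := Finset.sum_nonneg fun i _ => abs_nonneg (K i)
      linarith
    · have := Finset.single_le_sum (f := fun i => |K i|) (fun i _ => abs_nonneg (K i))
        (Finset.mem_univ i)
      linarith [le_abs_self (K i)]
  obtain ⟨K, hK1, hK⟩ := hK
  set m := (Real.exp (-Real.pi) / 4) ^ 2 with hm
  have hm0 : 0 < m := by positivity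
  have hm1 : m ≤ 1 := by
    have : Real.exp (-Real.pi) ≤ 1 := Real.exp_le_one_iff.2 (by linarith [Real.pi_pos])
    have h0 := Real.exp_pos (-Real.pi)
    rw [hm]; nlinarith
  refine ⟨m / (8 * K ^ 2), by positivity, fun p c d => ?_⟩
  have hW : WD true (WD false (planeCos 1 1)) p = -planeCos 1 1 p := by
    rw [WD_planeCos, show (fun p => -freq 1 1 false * planeSin 1 1 p) =
      fun p => (-freq 1 1 false) • planeSin 1 1 p from rfl, WD_const_smul]
    · simp [WD_planeSin, freq]
    · exact (exists_bdd_planeSin 1 1 1).choose_spec.contDiff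
  have hW' : WD true (WD false (planeSin 1 1)) p = -planeSin 1 1 p := by
    rw [WD_planeSin, show (fun p => freq 1 1 false * planeCos 1 1 p) =
      fun p => (freq 1 1 false) • planeCos 1 1 p from rfl, WD_const_smul]
    · simp [WD_planeCos, freq]
    · exact (exists_bdd_planeCos 1 1 1).choose_spec.contDiff
  have hb : ∀ i, (d * WD true (WD false (osc i)) p) ^ 2 ≤ d ^ 2 * K ^ 2 := fun i => by
    rw [mul_pow]
    exact mul_le_mul_of_nonneg_left (sq_le_sq' (abs_le.1 (hK i p)).1 (abs_le.1 (hK i p)).2)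
      (sq_nonneg d)
  have hcs : planeCos 1 1 p ^ 2 + planeSin 1 1 p ^ 2 = 1 := Real.cos_sq_add_sin_sq _
  have hth := le_sq_add_sq_theta p
  rw [← hm] at hth
  simp only [Fin.sum_univ_six]
  have h2 := sq_div_two_sub_le (c * ZD (osc 2) p) (d * WD true (WD false (osc 2)) p)
  have h3 := sq_div_two_sub_le (c * ZD (osc 3) p) (d * WD true (WD false (osc 3)) p)
  have h4 := sq_div_two_sub_le (c * ZD (osc 4) p) (d * WD true (WD false (osc 4)) p)
  have h5 := sq_div_two_sub_le (c * ZD (osc 5) p) (d * WD true (WD false (osc 5)) p)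
  have b2 := hb 2
  have b3 := hb 3
  have b4 := hb 4
  have b5 := hb 5
  have z2 : ZD (osc 2) p = _ := ZD_thetaRe 0 p
  have z3 : ZD (osc 3) p = _ := ZD_thetaIm 0 p
  have z4 : ZD (osc 4) p = _ := ZD_thetaRe (1 / 2) p
  have z5 : ZD (osc 5) p = _ := ZD_thetaIm (1 / 2) p
  have y0 : (c * ZD (osc 0) p + d * WD true (WD false (osc 0)) p) ^ 2 +
      (c * ZD (osc 1) p + d * WD true (WD false (osc 1)) p) ^ 2 = d ^ 2 := by
    have e0 : osc 0 = planeCos 1 1 := rfl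
    have e1 : osc 1 = planeSin 1 1 := rfl
    rw [e0, e1, ZD_planeCos, ZD_planeSin, hW, hW']
    linear_combination d ^ 2 * hcs
  have hz : 2 * (c ^ 2 * m) ≤ ((c * ZD (osc 2) p) ^ 2 + (c * ZD (osc 3) p) ^ 2 +
      (c * ZD (osc 4) p) ^ 2 + (c * ZD (osc 5) p) ^ 2) / 2 := by
    have hpi : 4 ≤ (2 * Real.pi) ^ 2 := by nlinarith [Real.pi_gt_three]
    have e : ((c * ZD (osc 2) p) ^ 2 + (c * ZD (osc 3) p) ^ 2 +
      (c * ZD (osc 4) p) ^ 2 + (c * ZD (osc 5) p) ^ 2) = (2 * Real.pi) ^ 2 * (c ^ 2 *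
        ((thetaRe 0 p ^ 2 + thetaIm 0 p ^ 2) +
          (thetaRe (1 / 2) p ^ 2 + thetaIm (1 / 2) p ^ 2))) := by
      rw [z2, z3, z4, z5]; ring
    rw [e]
    have t := mul_le_mul hpi (mul_le_mul_of_nonneg_left hth (sq_nonneg c))
      (mul_nonneg (sq_nonneg c) hm0.le) (sq_nonneg _)
    rw [le_div_iff₀ two_pos]
    exact le_trans (by ring_nf; rfl) t
  set R := (c * ZD (osc 2) p + d * WD true (WD false (osc 2)) p) ^ 2 +
    (c * ZD (osc 3) p + d * WD true (WD false (osc 3)) p) ^ 2 +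
    (c * ZD (osc 4) p + d * WD true (WD false (osc 4)) p) ^ 2 +
    (c * ZD (osc 5) p + d * WD true (WD false (osc 5)) p) ^ 2 with hR
  have hR0 : 0 ≤ R := by positivity
  have hR1 : 2 * (c ^ 2 * m) - 4 * (d ^ 2 * K ^ 2) ≤ R := by rw [hR]; linarith
  linarith [mul_le_add_of_two_mul_sub_le hm0 hm1 hK1 hR0 hR1]

end Oscillation

end Heisenberg

namespace Heisenberg

section LinearAlgebra

variable {F : Type*} [NormedAddCommGroup F] [InnerProductSpace ℝ F]
variable {ι κ : Type*} [Fintype ι] [Fintype κ] [DecidableEq ι] [DecidableEq κ]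

set_option linter.unusedSectionVars false

/-- `NearON δ Q` says that the Gram matrix of the family `Q` is entrywise `δ`-close to `1`. -/
def NearON (δ : ℝ) (Q : ι → F) : Prop :=
  ∀ i j, |⟪Q i, Q j⟫ - (1 : Matrix ι ι ℝ) i j| ≤ δ

lemma NearON.mono {δ δ' : ℝ} {Q : ι → F} (h : NearON δ Q) (hδ : δ ≤ δ') : NearON δ' Q :=
  fun i j => (h i j).trans hδ

lemma NearON.sumElim {δ : ℝ} {P : ι → F} {Q : κ → F} (hδ : 0 ≤ δ) (hP : NearON δ P)
    (hQ : NearON δ Q) (h : ∀ i j, ⟪P i, Q j⟫ = 0) : NearON δ (Sum.elim P Q) := by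
  rintro (i | i) (j | j)
  · simpa [Matrix.one_apply] using hP i j
  · simp [h, hδ]
  · rw [real_inner_comm]; simp [h, hδ]
  · simpa [Matrix.one_apply] using hQ i j

lemma NearON.norm_le {δ : ℝ} {Q : ι → F} (h : NearON δ Q) (hδ : δ ≤ 1) (i : ι) : ‖Q i‖ ≤ 2 := by
  have := (abs_le.1 (h i i)).2
  rw [Matrix.one_apply_eq, real_inner_self_eq_norm_sq] at this
  nlinarith [norm_nonneg (Q i)]

lemma NearON.abs_inner_sum_le {δ : ℝ} {Q : ι → F} (h : NearON δ Q) (x y : ι → ℝ) :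
    |⟪∑ i, x i • Q i, ∑ i, y i • Q i⟫ - ∑ i, x i * y i| ≤
      δ * ((∑ i, |x i|) * ∑ i, |y i|) := by
  have e : ⟪∑ i, x i • Q i, ∑ i, y i • Q i⟫ - ∑ i, x i * y i =
      ∑ i, ∑ j, x i * y j * (⟪Q i, Q j⟫ - (1 : Matrix ι ι ℝ) i j) := by
    simp only [sum_inner, inner_sum, real_inner_smul_left, real_inner_smul_right, mul_sub,
      Finset.sum_sub_distrib, Matrix.one_apply, mul_ite, mul_one, mul_zero, Finset.sum_ite_eq,
      Finset.mem_univ, if_true, mul_assoc]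
    rw [Finset.sum_comm]
    exact congrArg₂ _ (Finset.sum_congr rfl fun i _ => Finset.sum_congr rfl fun j _ => by ring) rfl
  rw [e, Finset.sum_mul_sum, Finset.mul_sum]
  refine (Finset.abs_sum_le_sum_abs _ _).trans (Finset.sum_le_sum fun i _ => ?_)
  rw [Finset.mul_sum]
  refine (Finset.abs_sum_le_sum_abs _ _).trans (Finset.sum_le_sum fun j _ => ?_)
  rw [abs_mul, abs_mul, mul_comm δ]
  exact mul_le_mul_of_nonneg_left (h i j) (by positivity)

lemma NearON.le_norm_sum_sq {δ : ℝ} {Q : ι → F} (h : NearON δ Q) (hδ0 : 0 ≤ δ)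
    (hδ : δ * Fintype.card ι ≤ 1 / 2) (x : ι → ℝ) :
    (∑ i, x i ^ 2) / 2 ≤ ‖∑ i, x i • Q i‖ ^ 2 := by
  have h1 := (abs_le.1 (h.abs_inner_sum_le x x)).1
  rw [real_inner_self_eq_norm_sq] at h1
  have h2 : (∑ i, |x i|) * ∑ i, |x i| ≤ Fintype.card ι * ∑ i, x i ^ 2 := by
    have := sq_sum_le_card_mul_sum_sq (s := Finset.univ) (f := fun i => |x i|)
    simpa [pow_two] using this
  have h3 := mul_le_mul_of_nonneg_left h2 hδ0
  have h4 : 0 ≤ ∑ i, x i ^ 2 := Finset.sum_nonneg fun i _ => sq_nonneg _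
  have h5 : δ * (Fintype.card ι * ∑ i, x i ^ 2) ≤ 1 / 2 * ∑ i, x i ^ 2 := by
    rw [← mul_assoc]; exact mul_le_mul_of_nonneg_right hδ h4
  have h6 : ∑ i, x i * x i = ∑ i, x i ^ 2 := by simp [pow_two]
  linarith

/-- A near-isometry applied to a nearly orthonormal family. -/
lemma NearON.combine {δ L : ℝ} {Q : ι → F} (h : NearON δ Q) (hδ : 0 ≤ δ) {R : κ → ι → ℝ}
    (hR : ∀ k l, ∑ i, R k i * R l i = (1 : Matrix κ κ ℝ) k l) (hL : ∀ k, ∑ i, |R k i| ≤ L) :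
    NearON (δ * L ^ 2) (fun k => ∑ i, R k i • Q i) := by
  intro k l
  rw [← hR]
  refine (h.abs_inner_sum_le _ _).trans (mul_le_mul_of_nonneg_left ?_ hδ)
  rw [pow_two]
  have h0 : ∀ k, 0 ≤ ∑ i, |R k i| := fun k => Finset.sum_nonneg fun i _ => abs_nonneg _
  exact mul_le_mul (hL k) (hL l) (h0 l) ((h0 k).trans (hL k))

lemma NearON.perturb {δ e : ℝ} {P Q : ι → F} (h : NearON δ P) (hδ : δ ≤ 1) (he : e ≤ 1)
    (hPQ : ∀ i, ‖Q i - P i‖ ≤ e) : NearON (δ + 5 * e) Q := by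
  intro i j
  have e0 : 0 ≤ e := (norm_nonneg _).trans (hPQ i)
  have e1 : ⟪Q i, Q j⟫ - (1 : Matrix ι ι ℝ) i j = (⟪P i, P j⟫ - (1 : Matrix ι ι ℝ) i j) +
      ⟪P i, Q j - P j⟫ + ⟪Q i - P i, P j⟫ + ⟪Q i - P i, Q j - P j⟫ := by
    simp only [inner_sub_left, inner_sub_right]; ring
  have b : ∀ x y : F, ∀ c d : ℝ, ‖x‖ ≤ c → ‖y‖ ≤ d → |⟪x, y⟫| ≤ c * d := fun x y c d hx hy =>
    (abs_real_inner_le_norm x y).trans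
      (mul_le_mul hx hy (norm_nonneg _) ((norm_nonneg _).trans hx))
  rw [e1]
  have a1 := abs_le.1 (h i j)
  have a2 := abs_le.1 (b _ _ _ _ (h.norm_le hδ i) (hPQ j))
  have a3 := abs_le.1 (b _ _ _ _ (hPQ i) (h.norm_le hδ j))
  have a4 := abs_le.1 (b _ _ _ _ (hPQ i) (hPQ j))
  rw [abs_le]
  constructor <;> nlinarith

/-- The Gram matrix of a family. -/
def gram (B : κ → F) : Matrix κ κ ℝ := Matrix.of fun i j => ⟪B i, B j⟫

/-- A denominator-free version of the projection of `v` to the orthogonal complement of `B`. -/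
def adjProj (B : κ → F) (v : F) : F :=
  (gram B).det • v - ∑ j, (∑ k, (gram B).adjugate j k * ⟪B k, v⟫) • B j

lemma inner_adjProj (B : κ → F) (v : F) (l : κ) : ⟪adjProj B v, B l⟫ = 0 := by
  have h := congrFun (congrArg (fun M : Matrix κ κ ℝ => M.mulVec fun k => ⟪B k, v⟫)
    (Matrix.mul_adjugate (gram B))) l
  simp only [← Matrix.mulVec_mulVec, Matrix.smul_mulVec, Matrix.one_mulVec, Pi.smul_apply,
    smul_eq_mul] at h
  rw [adjProj, inner_sub_left, real_inner_smul_left, sum_inner, real_inner_comm, ← h, sub_eq_zero]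
  simp only [Matrix.mulVec, dotProduct, real_inner_smul_left, gram, Matrix.of_apply]
  exact Finset.sum_congr rfl fun j _ => by rw [mul_comm, real_inner_comm]

/-- The Gram matrix of the projected family as a polynomial in the full Gram matrix. -/
def adjProjGram (G : Matrix (ι ⊕ κ) (ι ⊕ κ) ℝ) (i j : ι) : ℝ :=
  G.toBlocks₂₂.det * (G.toBlocks₂₂.det * G (Sum.inl i) (Sum.inl j) -
    ∑ l, (∑ k, G.toBlocks₂₂.adjugate l k * G (Sum.inr k) (Sum.inl i)) *
      G (Sum.inr l) (Sum.inl j))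

lemma inner_adjProj_adjProj (P : ι → F) (B : κ → F) (i j : ι) :
    ⟪adjProj B (P i), adjProj B (P j)⟫ = adjProjGram (gram (Sum.elim P B)) i j := by
  have h : ⟪adjProj B (P i), adjProj B (P j)⟫ = (gram B).det * ⟪adjProj B (P i), P j⟫ := by
    conv_lhs => rw [adjProj.eq_1 B (P j)]
    rw [inner_sub_right, inner_sum, real_inner_smul_right]
    simp [real_inner_smul_right, inner_adjProj]
  have hb : (gram (Sum.elim P B)).toBlocks₂₂ = gram B := by
    ext; rfl
  rw [h, adjProjGram, hb, adjProj, inner_sub_left, real_inner_smul_left, sum_inner]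
  simp [gram, real_inner_smul_left]

lemma continuous_adjProjGram (i j : ι) :
    Continuous fun G : Matrix (ι ⊕ κ) (ι ⊕ κ) ℝ => adjProjGram G i j := by
  have hb : Continuous fun G : Matrix (ι ⊕ κ) (ι ⊕ κ) ℝ => G.toBlocks₂₂ :=
    continuous_matrix fun i j => continuous_apply_apply _ _
  have hd := hb.matrix_det
  have ha := hb.matrix_adjugate
  unfold adjProjGram
  refine hd.mul ((hd.mul (continuous_apply_apply _ _)).sub (continuous_finsetSum _ fun l _ => ?_))
  refine (continuous_finsetSum _ fun k _ => ?_).mul (continuous_apply_apply _ _)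
  exact (ha.matrix_elem l k).mul (continuous_apply_apply _ _)

lemma adjProjGram_one (i j : ι) :
    adjProjGram (1 : Matrix (ι ⊕ κ) (ι ⊕ κ) ℝ) i j = (1 : Matrix ι ι ℝ) i j := by
  have hb : (1 : Matrix (ι ⊕ κ) (ι ⊕ κ) ℝ).toBlocks₂₂ = 1 := by
    rw [← Matrix.fromBlocks_one, Matrix.toBlocks_fromBlocks₂₂]
  simp [adjProjGram, hb, Matrix.one_apply]

lemma exists_nearON_adjProj (ι κ : Type*) [Fintype ι] [Fintype κ] [DecidableEq ι] [DecidableEq κ]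
    {t : ℝ} (ht : 0 < t) : ∃ δ > 0, ∀ {F : Type} [NormedAddCommGroup F] [InnerProductSpace ℝ F]
      (P : ι → F) (B : κ → F), NearON δ (Sum.elim P B) → NearON t fun i => adjProj B (P i) := by
  have hc : Continuous fun G : ι ⊕ κ → ι ⊕ κ → ℝ => fun i j : ι => adjProjGram (Matrix.of G) i j :=
    continuous_pi fun i => continuous_pi fun j => continuous_adjProjGram i j
  obtain ⟨δ, hδ, h⟩ := Metric.continuousAt_iff.1
    (hc.continuousAt (x := fun a b => (1 : Matrix (ι ⊕ κ) (ι ⊕ κ) ℝ) a b)) t ht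
  refine ⟨δ / 2, by positivity, fun P B hPB i j => ?_⟩
  have h1 := h (x := fun i j => gram (Sum.elim P B) i j) (by
    refine lt_of_le_of_lt ?_ (half_lt_self hδ)
    refine (dist_pi_le_iff (by positivity)).2 fun a => (dist_pi_le_iff (by positivity)).2 fun b => ?_
    exact hPB a b)
  have h2 := (dist_pi_lt_iff ht).1 ((dist_pi_lt_iff ht).1 h1 i) j
  rw [inner_adjProj_adjProj, ← adjProjGram_one (κ := κ) i j]
  exact h2.le

/-- One step of Newton's iteration for orthonormalising a family. -/
def newton (Q : ι → F) (i : ι) : F := (3 / 2 : ℝ) • Q i - (1 / 2 : ℝ) • ∑ j, ⟪Q i, Q j⟫ • Q j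

lemma gram_newton (Q : ι → F) : gram (newton Q) - 1 =
    (1 / 4 : ℝ) • ((gram Q - 1) * (gram Q - 1) * (gram Q - 1)) -
      (3 / 4 : ℝ) • ((gram Q - 1) * (gram Q - 1)) := by
  have h : gram (newton Q) = (9 / 4 : ℝ) • gram Q - (3 / 2 : ℝ) • (gram Q * gram Q) +
      (1 / 4 : ℝ) • (gram Q * gram Q * gram Q) := by
    ext i j
    have e1 : ⟪Q i, ∑ k, ⟪Q j, Q k⟫ • Q k⟫ = (gram Q * gram Q) i j := by
      rw [inner_sum, Matrix.mul_apply]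
      refine Finset.sum_congr rfl fun k _ => ?_
      rw [real_inner_smul_right, mul_comm, real_inner_comm (Q k) (Q j)]; rfl
    have e2 : ⟪∑ k, ⟪Q i, Q k⟫ • Q k, Q j⟫ = (gram Q * gram Q) i j := by
      rw [sum_inner, Matrix.mul_apply]
      exact Finset.sum_congr rfl fun k _ => real_inner_smul_left _ _ _
    have e3 : ⟪∑ k, ⟪Q i, Q k⟫ • Q k, ∑ l, ⟪Q j, Q l⟫ • Q l⟫ =
        (gram Q * gram Q * gram Q) i j := by
      rw [inner_sum, Matrix.mul_apply]
      refine Finset.sum_congr rfl fun l _ => ?_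
      rw [real_inner_smul_right, sum_inner, Matrix.mul_apply, mul_comm, real_inner_comm (Q l) (Q j)]
      refine congrArg₂ _ ?_ rfl
      exact Finset.sum_congr rfl fun k _ => real_inner_smul_left _ _ _
    have e0 : gram (newton Q) i j = ⟪newton Q i, newton Q j⟫ := rfl
    have e4 : ⟪Q i, Q j⟫ = gram Q i j := rfl
    rw [e0, newton, newton, inner_sub_left, inner_sub_right, inner_sub_right]
    simp only [real_inner_smul_left, real_inner_smul_right, e1, e2, e3, e4, Matrix.add_apply,
      Matrix.sub_apply, Matrix.smul_apply, smul_eq_mul]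
    ring
  rw [h]
  simp only [sub_mul, mul_sub, one_mul, mul_one, smul_sub]
  module

lemma abs_mul_apply_le {S T : Matrix ι ι ℝ} {s t : ℝ} (hS : ∀ i j, |S i j| ≤ s)
    (hT : ∀ i j, |T i j| ≤ t) (i j : ι) : |(S * T) i j| ≤ Fintype.card ι * (s * t) := by
  rw [Matrix.mul_apply]
  refine (Finset.abs_sum_le_sum_abs _ _).trans ?_
  refine (Finset.sum_le_card_nsmul _ _ (s * t) fun k _ => ?_).trans (by simp)
  rw [abs_mul]
  exact mul_le_mul (hS i k) (hT k j) (abs_nonneg _) ((abs_nonneg _).trans (hS i k))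

lemma NearON.newton {t : ℝ} {Q : ι → F} (h : NearON t Q) (ht0 : 0 ≤ t)
    (ht : Fintype.card ι * t ≤ 1 / 2) : NearON (t / 2) (newton Q) := by
  have h0 : ∀ i j, |(gram Q - 1) i j| ≤ t := h
  intro i j
  have e : ⟪Heisenberg.newton Q i, Heisenberg.newton Q j⟫ - (1 : Matrix ι ι ℝ) i j =
      (gram (Heisenberg.newton Q) - 1) i j := rfl
  rw [e, gram_newton]
  have h2 := abs_mul_apply_le h0 h0
  have h3 := abs_le.1 (abs_mul_apply_le h2 h0 i j)
  have h2' := abs_le.1 (h2 i j)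
  simp only [Matrix.sub_apply, Matrix.smul_apply, smul_eq_mul] at h3 h2' ⊢
  set c : ℝ := (Fintype.card ι : ℝ)
  have hc : 0 ≤ c := Nat.cast_nonneg _
  have b2 : c * (t * t) ≤ t / 2 := by nlinarith
  have b3 : c * (c * (t * t) * t) ≤ t / 4 := by
    have : c * (c * (t * t) * t) = (c * (t * t)) * (c * t) := by ring
    rw [this]
    calc _ ≤ t / 2 * (1 / 2) := mul_le_mul b2 ht (by positivity) (by positivity)
      _ = t / 4 := by ring
  rw [abs_le]
  constructor <;> linarith

lemma NearON.newton_iterate {t : ℝ} {Q : ι → F} (h : NearON t Q) (ht0 : 0 ≤ t)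
    (ht : Fintype.card ι * t ≤ 1 / 2) (m : ℕ) :
    NearON (t / 2 ^ m) (Heisenberg.newton^[m] Q) := by
  induction m with
  | zero => simpa using h
  | succ m ih =>
    rw [Function.iterate_succ_apply', pow_succ, ← div_div]
    have h1 : t / 2 ^ m ≤ t := div_le_self ht0 (one_le_pow₀ one_le_two)
    refine ih.newton (by positivity) (le_trans ?_ ht)
    exact mul_le_mul_of_nonneg_left h1 (Nat.cast_nonneg _)

lemma inner_newton_eq_zero {Q : ι → F} {v : F} (h : ∀ i, ⟪Q i, v⟫ = 0) (i : ι) :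
    ⟪newton Q i, v⟫ = 0 := by
  simp [newton, inner_sub_left, real_inner_smul_left, sum_inner, h]

lemma inner_newton_iterate_eq_zero {Q : ι → F} {v : F} (h : ∀ i, ⟪Q i, v⟫ = 0) (m : ℕ) (i : ι) :
    ⟪newton^[m] Q i, v⟫ = 0 := by
  induction m generalizing i with
  | zero => exact h i
  | succ m ih =>
    rw [Function.iterate_succ_apply']
    exact inner_newton_eq_zero ih i

end LinearAlgebra

section Wedge

variable {D k : ℕ}

lemma wedgeNorm_smul (s : Fin k → ℝ) (v : Fin k → EuclideanSpace ℝ (Fin D)) :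
    wedgeNorm (fun i => s i • v i) = |∏ i, s i| * wedgeNorm v := by
  have h : (Matrix.of fun i j => ⟪s i • v i, s j • v j⟫) =
      Matrix.of fun i j => s i * (Matrix.of fun i j => s j * (Matrix.of fun i j =>
        ⟪v i, v j⟫) i j) i j := by
    ext i j
    simp [real_inner_smul_left, real_inner_smul_right]
    ring
  rw [wedgeNorm, h, Matrix.det_mul_column, Matrix.det_mul_row, ← mul_assoc,
    Real.sqrt_mul (mul_self_nonneg _), Real.sqrt_mul_self_eq_abs]
  rfl

lemma pow_le_wedgeNorm {μ : ℝ} (v : Fin k → EuclideanSpace ℝ (Fin D))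
    (h : ∀ c : Fin k → ℝ, μ ^ 2 * ∑ i, c i ^ 2 ≤ ‖∑ i, c i • v i‖ ^ 2) :
    μ ^ k ≤ wedgeNorm v := by
  set G : Matrix (Fin k) (Fin k) ℝ := Matrix.of fun i j => ⟪v i, v j⟫ with hG
  have hH : G.IsHermitian := by
    ext i j
    simp [hG, Matrix.conjTranspose_apply, real_inner_comm]
  have hquad : ∀ c : Fin k → ℝ, dotProduct c (G.mulVec c) = ‖∑ i, c i • v i‖ ^ 2 := by
    intro c
    rw [← real_inner_self_eq_norm_sq, sum_inner]
    simp only [inner_sum, real_inner_smul_left, real_inner_smul_right, dotProduct, Matrix.mulVec,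
      hG, Matrix.of_apply, Finset.mul_sum]
    exact Finset.sum_congr rfl fun i _ => Finset.sum_congr rfl fun j _ => by ring
  have hev : ∀ i, μ ^ 2 ≤ hH.eigenvalues i := by
    intro i
    have h1 := h (hH.eigenvectorBasis i)
    have h2 : ∑ j, (hH.eigenvectorBasis i) j ^ 2 = 1 := by
      have := hH.eigenvectorBasis.orthonormal.1 i
      rw [EuclideanSpace.norm_eq, Real.sqrt_eq_one] at this
      simpa using this
    rw [h2, mul_one, ← hquad] at h1
    rw [hH.eigenvalues_eq]
    simpa using h1
  have hdet : (μ ^ k) ^ 2 ≤ G.det := by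
    rw [hH.det_eq_prod_eigenvalues, ← pow_mul, mul_comm, pow_mul]
    calc (μ ^ 2) ^ k = ∏ _i : Fin k, μ ^ 2 := by simp
      _ ≤ _ := Finset.prod_le_prod (fun _ _ => sq_nonneg _) fun i _ => hev i
  exact Real.le_sqrt_of_sq_le hdet

end Wedge

end Heisenberg

namespace Heisenberg

/-- The target space. -/
abbrev V : Type := EuclideanSpace ℝ (Fin 29)

/-- Coordinatewise version of `Bdd`. -/
def VBdd (r M : ℝ) (u : H → V) : Prop := ∀ i, Bdd r M (fun p => u p i)

namespace VBdd

variable {r s M N : ℝ} {u v : H → V}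

lemma contDiff (hu : VBdd r M u) : ContDiff ℝ (⊤ : ℕ∞) u :=
  contDiff_euclidean.2 fun i => (hu i).contDiff

lemma nonneg (hu : VBdd r M u) (hr : 0 ≤ r) : 0 ≤ M := (hu 0).nonneg hr

lemma norm_le (hu : VBdd r M u) (hr : 0 ≤ r) (p : H) : ‖u p‖ ≤ 29 * M := by
  have hM := hu.nonneg hr
  rw [EuclideanSpace.norm_eq]
  refine Real.sqrt_le_iff.2 ⟨by positivity, ?_⟩
  calc ∑ i, ‖u p i‖ ^ 2 ≤ ∑ _i : Fin 29, M ^ 2 :=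
        Finset.sum_le_sum fun i _ => pow_le_pow_left₀ (norm_nonneg _) ((hu i).abs_le hr p) 2
    _ = 29 * M ^ 2 := by simp
    _ ≤ (29 * M) ^ 2 := by nlinarith [sq_nonneg M]

lemma mono (hu : VBdd r M u) (hs : 0 ≤ s) (hsr : s ≤ r) (hM : M ≤ N) : VBdd s N u :=
  fun i => (hu i).mono hs hsr hM

lemma le (hu : VBdd r M u) (hr : 0 ≤ r) (hM : M ≤ N) : VBdd r N u := hu.mono hr le_rfl hM

lemma const (r : ℝ) {c : V} (h : ‖c‖ ≤ M) : VBdd r M (fun _ => c) :=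
  fun i => Bdd.const r ((PiLp.norm_apply_le c i).trans h)

lemma add (hu : VBdd r M u) (hv : VBdd r N v) : VBdd r (M + N) (fun p => u p + v p) :=
  fun i => (hu i).add (hv i)

lemma smul {f : H → ℝ} (hr : 0 ≤ r) (hf : Bdd r M f) (hu : VBdd r N u) :
    VBdd r (M * N) (fun p => f p • u p) :=
  fun i => hf.mul hr (hu i)

lemma const_smul (hr : 0 ≤ r) {c : ℝ} (hc : |c| ≤ N) (hu : VBdd r M u) :
    VBdd r (N * M) (fun p => c • u p) :=
  smul hr (Bdd.const r hc) hu

lemma neg (hr : 0 ≤ r) (hu : VBdd r M u) : VBdd r M (fun p => -u p) := by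
  simpa using hu.const_smul hr (c := -1) (N := 1) (by simp)

lemma sum {ι : Type*} (t : Finset ι) {u : ι → H → V} {M : ι → ℝ}
    (hu : ∀ i ∈ t, VBdd r (M i) (u i)) : VBdd r (∑ i ∈ t, M i) (fun p => ∑ i ∈ t, u i p) := by
  intro k
  have := Bdd.sum t (u := fun i p => u i p k) fun i hi => hu i hi k
  simpa using this

lemma inner (hr : 0 ≤ r) (hu : VBdd r M u) (hv : VBdd r N v) :
    Bdd r (29 * (M * N)) (fun p => ⟪u p, v p⟫) := by
  have := Bdd.sum Finset.univ fun (i : Fin 29) _ => (hu i).mul hr (hv i)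
  convert this using 1
  · simp
  · funext p
    simp [PiLp.inner_apply, mul_comm]

lemma WD (b : Bool) (hs : 1 ≤ s) (hu : VBdd (2 * s) M u) : VBdd s M (WD b u) := by
  intro i
  have h := (hu i).WD b hs
  convert h using 2 with p
  have hd := contDiff_differentiableAt hu.contDiff p
  rw [WD_apply, WD_apply]
  have h1 : HasFDerivAt (fun p => u p i) ((EuclideanSpace.proj (𝕜 := ℝ) i).comp (fderiv ℝ u p)) p :=
    (EuclideanSpace.proj (𝕜 := ℝ) i).hasFDerivAt.comp p hd.hasFDerivAt
  rw [h1.fderiv]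
  rfl

lemma dilate (hu : VBdd r M u) {A : ℝ} (hA : 0 < A) :
    VBdd (A * r) M (fun p => u (dilate A⁻¹ p)) :=
  fun i => (hu i).dilate hA

lemma slow (hu : VBdd r M u) (hr : 0 ≤ r) (hM : 1 ≤ M) {m A : ℝ} (hm : ∀ p, ‖u p‖ ≤ m)
    (hA : 8 * M ≤ A) : VBdd (4 * r) (m + 1) (fun p => u (Heisenberg.dilate A⁻¹ p)) :=
  fun i => (hu i).slow hr hM (fun p => (PiLp.norm_apply_le (u p) i).trans (hm p)) hA

end VBdd

section Closure

variable {κ : Type*} [Fintype κ] [DecidableEq κ]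

lemma Bdd.det {r M : ℝ} (hr : 0 ≤ r) {G : κ → κ → H → ℝ} (hG : ∀ i j, Bdd r M (G i j)) :
    Bdd r ((Fintype.card κ).factorial * M ^ Fintype.card κ)
      (fun p => (Matrix.of fun i j => G i j p).det) := by
  have h : ∀ σ ∈ (Finset.univ : Finset (Equiv.Perm κ)), Bdd r (1 * M ^ Fintype.card κ)
      (fun p => ((Equiv.Perm.sign σ : ℤ) : ℝ) * ∏ i, G (σ i) i p) := fun σ _ =>
    Bdd.mul hr (Bdd.const r (by
      rcases Int.units_eq_one_or (Equiv.Perm.sign σ) with h | h <;> simp [h]))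
      (Bdd.prod hr Finset.univ fun i _ => hG (σ i) i)
  have := Bdd.sum _ h
  convert this using 1
  · simp [Fintype.card_perm]
  · funext p
    simp [Matrix.det_apply']

lemma Bdd.adjugate {r M : ℝ} (hr : 0 ≤ r) (hM : 1 ≤ M) {G : κ → κ → H → ℝ}
    (hG : ∀ i j, Bdd r M (G i j)) (i j : κ) :
    Bdd r ((Fintype.card κ).factorial * M ^ Fintype.card κ)
      (fun p => (Matrix.of fun i j => G i j p).adjugate i j) := by
  have h : ∀ k l, Bdd r M (fun p => (Matrix.of fun i j => G i j p).updateRow j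
      (Pi.single i 1) k l) := by
    intro k l
    by_cases hk : k = j
    · subst hk
      simp only [Matrix.updateRow_self]
      refine Bdd.const r ?_
      rw [Pi.single_apply]
      split_ifs <;> simp <;> linarith
    · simpa [Matrix.updateRow_ne hk] using hG k l
  convert Bdd.det hr h using 2 with p
  rw [Matrix.adjugate_apply]
  rfl

lemma VBdd.exists_adjProj (κ : Type*) [Fintype κ] [DecidableEq κ] (M : ℝ) : ∃ N, ∀ (r : ℝ)
    (B : κ → H → V) (v : H → V), 0 ≤ r → (∀ k, VBdd r M (B k)) → VBdd r M v →
      VBdd r N (fun p => adjProj (fun k => B k p) (v p)) := by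
  set G : ℝ := max 1 (29 * (M * M))
  set D : ℝ := (Fintype.card κ).factorial * G ^ Fintype.card κ
  refine ⟨D * M + 1 * ∑ _j : κ, (∑ _k : κ, D * G) * M, fun r B v hr hB hv => ?_⟩
  have hG : ∀ i j, Bdd r G (fun p => ⟪B i p, B j p⟫) := fun i j =>
    ((hB i).inner hr (hB j)).mono hr le_rfl (le_max_right _ _)
  have h1 := VBdd.smul hr (Bdd.det hr hG) hv
  have h2 : ∀ j ∈ Finset.univ, VBdd r ((∑ _k : κ, D * G) * M) (fun p =>
      (∑ k, (Matrix.of fun i j => ⟪B i p, B j p⟫).adjugate j k * ⟪B k p, v p⟫) • B j p) :=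
    fun j _ => VBdd.smul hr (Bdd.sum _ fun k _ => (Bdd.adjugate hr (le_max_left _ _) hG j k).mul hr
      (((hB k).inner hr hv).mono hr le_rfl (le_max_right _ _))) (hB j)
  have h3 := h1.add ((VBdd.sum _ h2).const_smul hr (c := -1) (N := 1) (by simp))
  convert h3 using 2 with p
  rw [adjProj, neg_one_smul, sub_eq_add_neg]
  rfl

lemma VBdd.exists_newton_iterate (κ : Type*) [Fintype κ] [DecidableEq κ] (M : ℝ) (m : ℕ) :
    ∃ N, ∀ (r : ℝ) (Q : κ → H → V), 0 ≤ r → (∀ k, VBdd r M (Q k)) →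
      ∀ k, VBdd r N (fun p => newton^[m] (fun j => Q j p) k) := by
  induction m with
  | zero => exact ⟨M, fun r Q _ hQ k => hQ k⟩
  | succ m ih =>
    obtain ⟨N, hN⟩ := ih
    refine ⟨3 / 2 * N + 1 / 2 * ∑ _j : κ, 29 * (N * N) * N, fun r Q hr hQ k => ?_⟩
    have h := hN r Q hr hQ
    have h3 := ((h k).const_smul hr (c := 3 / 2) (N := 3 / 2) (by norm_num)).add
      ((VBdd.sum Finset.univ fun j _ => VBdd.smul hr ((h k).inner hr (h j)) (h j)).const_smul hr
        (c := -(1 / 2)) (N := 1 / 2) (by norm_num [abs_of_pos]))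
    convert h3 using 2 with p
    rw [Function.iterate_succ_apply', newton, neg_smul, sub_eq_add_neg]

end Closure

end Heisenberg

namespace Heisenberg

/-- Indices of the tangential frame: a horizontal direction and a derivative order. -/
abbrev J : Type := Bool × Fin 2

/-- Indices of the normal frame. -/
abbrev I : Type := Fin 6 ⊕ J

section Frames

set_option linter.unusedSimpArgs false

variable {F : Type} [NormedAddCommGroup F] [InnerProductSpace ℝ F]

/-- The unit vector in the direction of the first derivative of the new oscillation. -/
def perpVec {F : Type} [AddCommGroup F] [Module ℝ F] (c s : Bool → ℝ) (P : I → F) (b : Bool) : F :=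
  c b • P (Sum.inr (b, 1)) - s b • P (Sum.inr (b, 0))

/-- The unit vector opposite to the second derivative of the new oscillation. -/
def radVec {F : Type} [AddCommGroup F] [Module ℝ F] (c s : Bool → ℝ) (P : I → F) (b : Bool) : F :=
  c b • P (Sum.inr (b, 0)) + s b • P (Sum.inr (b, 1))

/-- The idealised new normal and tangential frames, in terms of the old ones. -/
def idealFrame {F : Type} [AddCommGroup F] [Module ℝ F] (σ τ : ℝ) (c s : Bool → ℝ) (P : I → F)
    (T : J → F) : I ⊕ J → F
  | Sum.inl (Sum.inl i) => P (Sum.inl i)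
  | Sum.inl (Sum.inr (b, 0)) => T (b, 0)
  | Sum.inl (Sum.inr (b, 1)) => σ • perpVec c s P b - τ • T (b, 1)
  | Sum.inr (b, 0) => radVec c s P b
  | Sum.inr (b, 1) => τ • perpVec c s P b + σ • T (b, 1)

/-- The coefficients of `idealFrame`. -/
def idealRow (σ τ : ℝ) (c s : Bool → ℝ) : I ⊕ J → I ⊕ J → ℝ :=
  idealFrame σ τ c s (fun i => Pi.single (Sum.inl i) 1) (fun j => Pi.single (Sum.inr j) 1)

lemma sum_idealRow_smul (σ τ : ℝ) (c s : Bool → ℝ) (P : I → F) (T : J → F) (k : I ⊕ J) :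
    ∑ i, idealRow σ τ c s k i • Sum.elim P T i = idealFrame σ τ c s P T k := by
  have h : ∀ l, ∑ i, (Pi.single l (1 : ℝ) : I ⊕ J → ℝ) i • Sum.elim P T i = Sum.elim P T l := by
    intro l
    simp [Pi.single_apply, ite_smul]
  rcases k with (i | ⟨b, k⟩) | ⟨b, k⟩
  · exact h _
  all_goals
    fin_cases k
    all_goals
      simp only [idealRow, idealFrame, perpVec, radVec, Pi.add_apply, Pi.sub_apply, Pi.smul_apply,
        Fin.zero_eta, Fin.mk_one, smul_assoc,
        add_smul, sub_smul, Finset.sum_add_distrib, Finset.sum_sub_distrib, ← Finset.smul_sum, h,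
        Sum.elim_inl, Sum.elim_inr]

lemma idealRow_orthonormal {σ τ : ℝ} {c s : Bool → ℝ} (hcs : ∀ b, c b ^ 2 + s b ^ 2 = 1)
    (hστ : σ ^ 2 + τ ^ 2 = 1) (k l : I ⊕ J) :
    ∑ i, idealRow σ τ c s k i * idealRow σ τ c s l i = (1 : Matrix (I ⊕ J) (I ⊕ J) ℝ) k l := by
  have h : ∀ (l : I ⊕ J) (g : I ⊕ J → ℝ), ∑ i, (Pi.single l (1 : ℝ) : I ⊕ J → ℝ) i * g i = g l := by
    intro l g
    simp [Pi.single_apply, ite_mul]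
  rcases k with (i | ⟨b, k⟩) | ⟨b, k⟩
  · rcases l with (j | ⟨b', l⟩) | ⟨b', l⟩
    · refine (h _ _).trans ?_
      simp [idealRow, idealFrame, Pi.single_apply, Matrix.one_apply]
    all_goals
      fin_cases l
      all_goals
        refine (h _ _).trans ?_
        simp [idealRow, idealFrame, perpVec, radVec, Matrix.one_apply]
  all_goals
    fin_cases k
    all_goals
      simp only [idealRow, idealFrame, perpVec, radVec, Pi.add_apply, Pi.sub_apply, Pi.smul_apply,
        Fin.zero_eta, Fin.mk_one, smul_eq_mul, mul_assoc,
        add_mul, sub_mul, Finset.sum_add_distrib, Finset.sum_sub_distrib, ← Finset.mul_sum, h]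
      rcases l with (j | ⟨b', l⟩) | ⟨b', l⟩
      · simp [idealFrame, Matrix.one_apply]
      all_goals
        have hb := hcs b
        fin_cases l
        all_goals
          rcases eq_or_ne b b' with rfl | hbb
          · simp [idealFrame, perpVec, radVec, Matrix.one_apply]
            try first
              | ring1
              | exact Or.inr (by ring1)
              | linear_combination hb
              | linear_combination σ ^ 2 * hb + hστ
              | linear_combination τ ^ 2 * hb + hστ
              | linear_combination τ * σ * hb
          · simp [idealFrame, perpVec, radVec, Matrix.one_apply, hbb, hbb.symm]

lemma abs_le_one_of_sq_add_sq {x y : ℝ} (h : x ^ 2 + y ^ 2 = 1) : |x| ≤ 1 ∧ |y| ≤ 1 :=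
  ⟨abs_le_one_iff_mul_self_le_one.2 (by nlinarith [sq_nonneg y]),
    abs_le_one_iff_mul_self_le_one.2 (by nlinarith [sq_nonneg x])⟩

lemma sum_abs_idealRow_le {σ τ : ℝ} {c s : Bool → ℝ} (hcs : ∀ b, c b ^ 2 + s b ^ 2 = 1)
    (hστ : σ ^ 2 + τ ^ 2 = 1) (k : I ⊕ J) : ∑ i, |idealRow σ τ c s k i| ≤ 3 := by
  have h : ∀ l, ∑ i, |(Pi.single l (1 : ℝ) : I ⊕ J → ℝ) i| = 1 := by
    intro l
    simp [Pi.single_apply, apply_ite abs]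
  have hσ := abs_le_one_of_sq_add_sq hστ
  have key : ∀ (x y z : ℝ) (l m n : I ⊕ J), |x| ≤ 1 → |y| ≤ 1 → |z| ≤ 1 →
      ∀ g : I ⊕ J → ℝ, (∀ i, g i = x * (Pi.single l (1 : ℝ) : I ⊕ J → ℝ) i +
        y * (Pi.single m (1 : ℝ) : I ⊕ J → ℝ) i + z * (Pi.single n (1 : ℝ) : I ⊕ J → ℝ) i) →
      ∑ i, |g i| ≤ 3 := by
    intro x y z l m n hx hy hz g hg
    have h3 : ∀ i, |g i| ≤ |(Pi.single l (1 : ℝ) : I ⊕ J → ℝ) i| +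
        |(Pi.single m (1 : ℝ) : I ⊕ J → ℝ) i| + |(Pi.single n (1 : ℝ) : I ⊕ J → ℝ) i| := by
      intro i
      rw [hg]
      refine (abs_add_three _ _ _).trans ?_
      simp only [abs_mul]
      gcongr <;> exact mul_le_of_le_one_left (abs_nonneg _) (by assumption)
    refine (Finset.sum_le_sum fun i _ => h3 i).trans (le_of_eq ?_)
    rw [Finset.sum_add_distrib, Finset.sum_add_distrib, h, h, h]
    norm_num
  have m1 : ∀ x y : ℝ, |x| ≤ 1 → |y| ≤ 1 → |x * y| ≤ 1 := fun x y hx hy => by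
    rw [abs_mul]; exact mul_le_one₀ hx (abs_nonneg _) hy
  have hc := fun b => (abs_le_one_of_sq_add_sq (hcs b)).1
  have hs := fun b => (abs_le_one_of_sq_add_sq (hcs b)).2
  rcases k with (i | ⟨b, k⟩) | ⟨b, k⟩
  · exact (h _).trans_le (by norm_num)
  · fin_cases k
    · exact (h _).trans_le (by norm_num)
    · refine key (σ * c b) (-(σ * s b)) (-τ) (Sum.inl (Sum.inr (b, 1))) (Sum.inl (Sum.inr (b, 0)))
        (Sum.inr (b, 1)) (m1 _ _ hσ.1 (hc b)) ?_ ?_ _ fun i => ?_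
      · rw [abs_neg]; exact m1 _ _ hσ.1 (hs b)
      · rw [abs_neg]; exact hσ.2
      · simp [idealRow, idealFrame, perpVec]; ring
  · fin_cases k
    · refine key (c b) (s b) 0 (Sum.inl (Sum.inr (b, 0))) (Sum.inl (Sum.inr (b, 1)))
        (Sum.inr (b, 1)) (hc b) (hs b) (by simp) _ fun i => ?_
      simp [idealRow, idealFrame, radVec]
    · refine key (τ * c b) (-(τ * s b)) σ (Sum.inl (Sum.inr (b, 1))) (Sum.inl (Sum.inr (b, 0)))
        (Sum.inr (b, 1)) (m1 _ _ hσ.2 (hc b)) ?_ hσ.1 _ fun i => ?_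
      · rw [abs_neg]; exact m1 _ _ hσ.2 (hs b)
      · simp [idealRow, idealFrame, perpVec]; ring

lemma nearON_idealFrame {δ σ τ : ℝ} {c s : Bool → ℝ} {P : I → F} {T : J → F}
    (h : NearON δ (Sum.elim P T)) (hδ : 0 ≤ δ) (hcs : ∀ b, c b ^ 2 + s b ^ 2 = 1)
    (hστ : σ ^ 2 + τ ^ 2 = 1) : NearON (9 * δ) (idealFrame σ τ c s P T) := by
  have := h.combine hδ (idealRow_orthonormal hcs hστ) (sum_abs_idealRow_le hcs hστ)
  simp only [sum_idealRow_smul] at this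
  convert this using 1
  ring

end Frames

end Heisenberg

namespace Heisenberg

section NewFrame

variable {F : Type} [NormedAddCommGroup F] [InnerProductSpace ℝ F]

/-- The new tangential frame, given the first derivatives `d₁` of the new oscillation and the
second derivatives `d₂` of the new map. -/
def newFrame (σ τ : ℝ) (T : J → F) (d₁ d₂ : Bool → F) : J → F
  | (b, 0) => -d₂ b
  | (b, 1) => τ • d₁ b + σ • T (b, 1)

/-- The family of the vectors `radVec` and `perpVec`. -/
def polarFrame (c s : Bool → ℝ) (P : I → F) : J → F
  | (b, 0) => radVec c s P b
  | (b, 1) => perpVec c s P b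

variable {δ δE e σ τ : ℝ} {c s : Bool → ℝ} {P : I → F} {T : J → F} {d₁ d₂ : Bool → F}

lemma nearON_polarFrame (h : NearON δE P) (hδ : 0 ≤ δE) (hcs : ∀ b, c b ^ 2 + s b ^ 2 = 1) :
    NearON (9 * δE) (polarFrame c s P) := by
  have hz : ∀ k j, idealRow 0 1 c s (Sum.inr k) (Sum.inr j) = 0 := by
    rintro ⟨b, k⟩ j
    fin_cases k <;> simp [idealRow, idealFrame, perpVec, radVec]
  have h1 := h.combine hδ (R := fun k i => idealRow 0 1 c s (Sum.inr k) (Sum.inl i)) (L := 3)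
    (fun k l => by
      have := idealRow_orthonormal (σ := 0) (τ := 1) hcs (by norm_num) (Sum.inr k) (Sum.inr l)
      rw [Fintype.sum_sum_type] at this
      simpa [hz, Matrix.one_apply] using this)
    (fun k => by
      have := sum_abs_idealRow_le (σ := 0) (τ := 1) hcs (by norm_num) (Sum.inr k)
      rw [Fintype.sum_sum_type] at this
      simpa [hz] using this)
  convert h1 using 1
  · ring
  · funext k
    have := sum_idealRow_smul 0 1 c s P (0 : J → F) (Sum.inr k)
    rw [Fintype.sum_sum_type] at this
    simp only [Sum.elim_inl, Sum.elim_inr, Pi.zero_apply, smul_zero, Finset.sum_const_zero,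
      add_zero] at this
    rw [this]
    rcases k with ⟨b, k⟩
    fin_cases k <;> simp [polarFrame, idealFrame]

lemma nearON_idealFrame_newFrame (h : NearON δ (Sum.elim P T)) (hδ : 0 ≤ δ) (hδ1 : 9 * δ ≤ 1)
    (he : e ≤ 1) (hcs : ∀ b, c b ^ 2 + s b ^ 2 = 1) (hστ : σ ^ 2 + τ ^ 2 = 1)
    (h₁ : ∀ b, ‖d₁ b - perpVec c s P b‖ ≤ e) (h₂ : ∀ b, ‖-d₂ b - radVec c s P b‖ ≤ e) :
    NearON (9 * δ + 5 * e) (Sum.elim (fun i => idealFrame σ τ c s P T (Sum.inl i))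
      (newFrame σ τ T d₁ d₂)) := by
  have he0 : 0 ≤ e := (norm_nonneg _).trans (h₁ true)
  refine (nearON_idealFrame h hδ hcs hστ).perturb hδ1 he ?_
  rintro (i | ⟨b, k⟩)
  · simpa using he0
  · fin_cases k
    · exact h₂ b
    · have : newFrame σ τ T d₁ d₂ (b, 1) - idealFrame σ τ c s P T (Sum.inr (b, 1)) =
          τ • (d₁ b - perpVec c s P b) := by
        simp only [newFrame, idealFrame]; module
      refine (congrArg norm this).trans_le ?_
      rw [norm_smul]
      exact (mul_le_of_le_one_left (norm_nonneg _) (abs_le_one_of_sq_add_sq hστ).2).trans (h₁ b)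

lemma nearON_polar_perturb (h : NearON δE P) (hδE : 0 ≤ δE) (hδ1 : 9 * δE ≤ 1)
    (he : e ≤ 1) (hcs : ∀ b, c b ^ 2 + s b ^ 2 = 1)
    (h₁ : ∀ b, ‖d₁ b - perpVec c s P b‖ ≤ e) (h₂ : ∀ b, ‖-d₂ b - radVec c s P b‖ ≤ e) :
    NearON (9 * δE + 5 * e) (newFrame 0 1 0 d₁ d₂) := by
  refine (nearON_polarFrame h hδE hcs).perturb hδ1 he ?_
  rintro ⟨b, k⟩
  fin_cases k
  · exact h₂ b
  · simpa [newFrame, polarFrame] using h₁ b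

lemma inner_radVec_eq_zero {v : F} (h : ∀ i, ⟪P i, v⟫ = 0) (b : Bool) :
    ⟪radVec c s P b, v⟫ = 0 := by
  simp [radVec, inner_add_left, real_inner_smul_left, h]

lemma nearON_newFrame {a S : ℝ} (hE : NearON δE P) (hT : NearON δ T) (hPT : ∀ i j, ⟪P i, T j⟫ = 0)
    (hδE : 0 ≤ δE) (hδ1 : δ ≤ 1)
    (hδ : 9 * δE + 7 * e ≤ δ) (hcs : ∀ b, c b ^ 2 + s b ^ 2 = 1) (hστ : σ ^ 2 + τ ^ 2 = 1)
    (hσ0 : 0 ≤ σ) (hτ0 : 0 ≤ τ) (hσ : σ = a * S * τ) (ha0 : 0 ≤ a) (ha1 : a ≤ 1)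
    (h₁ : ∀ b, ‖d₁ b - perpVec c s P b‖ ≤ e) (h₂ : ∀ b, ‖-d₂ b - radVec c s P b‖ ≤ e)
    (hx : ∀ b b', |⟪d₁ b, S • T (b', 1)⟫| ≤ e) : NearON δ (newFrame σ τ T d₁ d₂) := by
  have he0 : 0 ≤ e := (norm_nonneg _).trans (h₁ true)
  have hU := nearON_polar_perturb hE hδE (by linarith) (by linarith) hcs h₁ h₂
  have hσ1 := (abs_le.1 (abs_le_one_of_sq_add_sq hστ).1).2
  have hτ1 := (abs_le.1 (abs_le_one_of_sq_add_sq hστ).2).2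
  have h01 : ∀ b b', |⟪newFrame σ τ T d₁ d₂ (b, 0), newFrame σ τ T d₁ d₂ (b', 1)⟫| ≤ δ := by
    intro b b'
    have e1 : ⟪newFrame σ τ T d₁ d₂ (b, 0), newFrame σ τ T d₁ d₂ (b', 1)⟫ =
        τ * ⟪-d₂ b, d₁ b'⟫ + σ * ⟪-d₂ b - radVec c s P b, T (b', 1)⟫ := by
      rw [inner_sub_left, inner_radVec_eq_zero (fun i => hPT i _), sub_zero]
      simp only [newFrame, inner_add_right, real_inner_smul_right]
    have e2 : |⟪-d₂ b, d₁ b'⟫| ≤ 9 * δE + 5 * e := by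
      have := hU (b, 0) (b', 1)
      simpa [newFrame, Matrix.one_apply] using this
    have e3 : |⟪-d₂ b - radVec c s P b, T (b', 1)⟫| ≤ e * 2 :=
      (abs_real_inner_le_norm _ _).trans
        (mul_le_mul (h₂ b) (hT.norm_le hδ1 _) (norm_nonneg _) he0)
    rw [e1]
    refine (abs_add_le _ _).trans ?_
    rw [abs_mul, abs_mul, abs_of_nonneg hσ0, abs_of_nonneg hτ0]
    have f1 := mul_le_of_le_one_left (abs_nonneg ⟪-d₂ b, d₁ b'⟫) hτ1
    have f2 := mul_le_of_le_one_left (abs_nonneg ⟪-d₂ b - radVec c s P b, T (b', 1)⟫) hσ1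
    linarith
  rintro ⟨b, k⟩ ⟨b', l⟩
  fin_cases k <;> fin_cases l
  · refine (hU (b, 0) (b', 0)).trans ?_
    linarith
  · simpa [Matrix.one_apply] using h01 b b'
  · rw [real_inner_comm]
    simpa [Matrix.one_apply] using h01 b' b
  · have e1 := hU (b, 1) (b', 1)
    have e2 := hT (b, 1) (b', 1)
    set m : ℝ := (1 : Matrix J J ℝ) (b, 1) (b', 1) with hm
    have x1 := hx b b'
    have x2 := hx b' b
    rw [real_inner_smul_right] at x1 x2
    have e0 : ⟪newFrame 0 1 0 d₁ d₂ (b, 1), newFrame 0 1 0 d₁ d₂ (b', 1)⟫ = ⟪d₁ b, d₁ b'⟫ := by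
      simp [newFrame]
    rw [e0] at e1
    have e3 : ⟪newFrame σ τ T d₁ d₂ (b, 1), newFrame σ τ T d₁ d₂ (b', 1)⟫ - m =
        τ ^ 2 * (⟪d₁ b, d₁ b'⟫ - m) + σ ^ 2 * (⟪T (b, 1), T (b', 1)⟫ - m) +
        τ ^ 2 * (a * (S * ⟪d₁ b, T (b', 1)⟫)) + τ ^ 2 * (a * (S * ⟪d₁ b', T (b, 1)⟫)) := by
      simp only [newFrame, inner_add_left, inner_add_right, real_inner_smul_right,
        real_inner_smul_left]
      rw [real_inner_comm (d₁ b') (T (b, 1))]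
      have e4 : τ * σ = τ ^ 2 * a * S := by rw [hσ]; ring
      linear_combination m * hστ + (⟪d₁ b, T (b', 1)⟫ + ⟪d₁ b', T (b, 1)⟫) * e4
    have y : ∀ x : ℝ, |x| ≤ e → |a * x| ≤ e := fun x hx => by
      rw [abs_mul, abs_of_nonneg ha0]
      exact (mul_le_of_le_one_left (abs_nonneg _) ha1).trans hx
    have y1 := abs_le.1 (y _ x1)
    have y2 := abs_le.1 (y _ x2)
    have z1 := abs_le.1 e1
    have z2 := abs_le.1 e2
    have q1 := sq_nonneg τ
    have q2 := sq_nonneg σ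
    refine (congrArg abs e3).trans_le ?_
    rw [abs_le]
    constructor <;> nlinarith

lemma half_le_norm_of_nearON_polar (h : NearON δE P) (hδE : 0 ≤ δE)
    (hδ : 9 * δE + 7 * e ≤ 1 / 2) (hcs : ∀ b, c b ^ 2 + s b ^ 2 = 1)
    (h₁ : ∀ b, ‖d₁ b - perpVec c s P b‖ ≤ e) (b : Bool) : 1 / 2 ≤ ‖d₁ b‖ := by
  have he0 : 0 ≤ e := (norm_nonneg _).trans (h₁ true)
  have hU := nearON_polar_perturb (d₂ := fun b => -radVec c s P b) h hδE (by linarith)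
    (by linarith) hcs h₁ (by simpa using he0) (b, 1) (b, 1)
  have e0 : ⟪newFrame 0 1 0 d₁ (fun b => -radVec c s P b) (b, 1),
      newFrame 0 1 0 d₁ (fun b => -radVec c s P b) (b, 1)⟫ = ‖d₁ b‖ ^ 2 := by
    simp [newFrame]
  rw [e0, Matrix.one_apply_eq] at hU
  have := (abs_le.1 hU).1
  nlinarith [norm_nonneg (d₁ b)]

end NewFrame

end Heisenberg

namespace Heisenberg

section Wedges

lemma le_wedgeNorm_pair {δ S : ℝ} {T : J → V} (hT : NearON δ T) (hδ0 : 0 ≤ δ) (hδ : δ * 4 ≤ 1 / 2) :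
    1 / 16 * (‖S • T (true, 1)‖ * ‖S • T (false, 1)‖) ≤
      wedgeNorm ![S • T (true, 1), S • T (false, 1)] := by
  have h : (1 / 2 : ℝ) ^ 2 ≤ wedgeNorm ![T (true, 1), T (false, 1)] := by
    refine pow_le_wedgeNorm _ fun c => ?_
    have h1 := hT.le_norm_sum_sq hδ0 (by simpa using hδ)
      (fun j => if j.2 = 1 then (if j.1 then c 0 else c 1) else 0)
    simp [Fintype.sum_prod_type] at h1
    simp [Fin.sum_univ_two]
    nlinarith [sq_nonneg (c 0), sq_nonneg (c 1)]
  have e : ![S • T (true, 1), S • T (false, 1)] =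
      fun i => (fun _ => S : Fin 2 → ℝ) i • ![T (true, 1), T (false, 1)] i := by
    funext i
    fin_cases i <;> rfl
  have n1 := hT.norm_le (by linarith) (true, 1)
  have n2 := hT.norm_le (by linarith) (false, 1)
  have n3 : ‖T (true, 1)‖ * ‖T (false, 1)‖ ≤ 2 * 2 :=
    mul_le_mul n1 n2 (norm_nonneg _) (by norm_num)
  rw [e, wedgeNorm_smul, norm_smul, norm_smul]
  simp only [Finset.prod_const, Finset.card_univ, Fintype.card_fin, abs_pow, Real.norm_eq_abs]
  calc _ = |S| ^ 2 * (1 / 16 * (‖T (true, 1)‖ * ‖T (false, 1)‖)) := by ring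
    _ ≤ _ := mul_le_mul_of_nonneg_left (by linarith) (by positivity)

lemma pow_le_wedgeNorm_of_approx {δ ν e : ℝ} {Q : I ⊕ J → V} (hQ : NearON δ Q) (hδ0 : 0 ≤ δ)
    (hδ : δ * 14 ≤ 1 / 2) (hν : 0 ≤ ν) (he : 12 * e ≤ ν) {ξ : Fin 6 → I ⊕ J → ℝ}
    (hξ : ∀ c : Fin 6 → ℝ, ν ^ 2 * ∑ k, c k ^ 2 ≤ ∑ q, (∑ k, c k * ξ k q) ^ 2)
    {v : Fin 6 → V} (hv : ∀ k, ‖v k - ∑ q, ξ k q • Q q‖ ≤ e) : (ν / 4) ^ 6 ≤ wedgeNorm v := by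
  refine pow_le_wedgeNorm _ fun c => ?_
  set n : ℝ := Real.sqrt (∑ k, c k ^ 2) with hn
  have hs0 : 0 ≤ ∑ k, c k ^ 2 := Finset.sum_nonneg fun k _ => sq_nonneg _
  have hn2 : n ^ 2 = ∑ k, c k ^ 2 := Real.sq_sqrt hs0
  have hn0 : 0 ≤ n := Real.sqrt_nonneg _
  have e1 : ∑ k, c k • v k = ∑ q, (∑ k, c k * ξ k q) • Q q +
      ∑ k, c k • (v k - ∑ q, ξ k q • Q q) := by
    have : ∑ q, (∑ k, c k * ξ k q) • Q q = ∑ k, c k • ∑ q, ξ k q • Q q := by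
      simp only [Finset.sum_smul, Finset.smul_sum, smul_smul]
      exact Finset.sum_comm
    rw [this, ← Finset.sum_add_distrib]
    exact Finset.sum_congr rfl fun k _ => by rw [← smul_add]; congr 1; abel
  have h1 := hQ.le_norm_sum_sq hδ0 (by simpa using hδ) (fun q => ∑ k, c k * ξ k q)
  have h2 : ν / 2 * n ≤ ‖∑ q, (∑ k, c k * ξ k q) • Q q‖ := by
    refine abs_le_of_sq_le_sq' ?_ (norm_nonneg _) |>.2
    have := hξ c
    rw [← hn2] at this
    nlinarith [mul_nonneg (sq_nonneg ν) (sq_nonneg n)]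
  have h3 : ‖∑ k, c k • (v k - ∑ q, ξ k q • Q q)‖ ≤ e * (3 * n) := by
    have g1 : ∑ k, |c k| ≤ 3 * n := by
      refine abs_le_of_sq_le_sq' ?_ (by positivity) |>.2
      have := sq_sum_le_card_mul_sum_sq (s := Finset.univ) (f := fun k => |c k|)
      simp only [sq_abs, Finset.card_univ, Fintype.card_fin, ← hn2] at this
      push_cast at this
      nlinarith [sq_nonneg n]
    have he0 : 0 ≤ e := (norm_nonneg _).trans (hv 0)
    refine (norm_sum_le _ _).trans (le_trans ?_ (mul_le_mul_of_nonneg_left g1 he0))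
    rw [Finset.mul_sum]
    refine Finset.sum_le_sum fun k _ => ?_
    rw [norm_smul, mul_comm e]
    exact mul_le_mul_of_nonneg_left (hv k) (abs_nonneg _)
  have h4 : ν / 4 * n ≤ ‖∑ k, c k • v k‖ := by
    rw [e1]
    have h5 := norm_sub_le_norm_add (∑ q, (∑ k, c k * ξ k q) • Q q)
      (∑ k, c k • (v k - ∑ q, ξ k q • Q q))
    nlinarith
  calc (ν / 4) ^ 2 * ∑ k, c k ^ 2 = (ν / 4 * n) ^ 2 := by rw [← hn2]; ring
    _ ≤ _ := pow_le_pow_left₀ (by positivity) h4 2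

lemma le_wedgeNorm_sextuple {μ S a₁ b₁ : ℝ} {x y z xx yy xy : V}
    (h : μ ≤ wedgeNorm ![x, y, z, xx, yy, xy]) (hμ : 0 ≤ μ) (hx : ‖x‖ ≤ 2) (hy : ‖y‖ ≤ 2)
    (ha : ‖S • x‖ = a₁) (hb : ‖S • y‖ = b₁) :
    μ / 4 * (a₁ * b₁) ≤ wedgeNorm ![S • x, S • y, z, xx, yy, xy] := by
  have e : ![S • x, S • y, z, xx, yy, xy] =
      fun i => (![S, S, 1, 1, 1, 1] : Fin 6 → ℝ) i • ![x, y, z, xx, yy, xy] i := by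
    funext i
    fin_cases i <;> simp
  rw [e, wedgeNorm_smul, ← ha, ← hb, norm_smul, norm_smul]
  have e2 : ∏ i, (![S, S, 1, 1, 1, 1] : Fin 6 → ℝ) i = S ^ 2 := by
    simp [Fin.prod_univ_succ, pow_two]
  have n3 : ‖x‖ * ‖y‖ ≤ 2 * 2 := mul_le_mul hx hy (norm_nonneg _) (by norm_num)
  rw [e2, Real.norm_eq_abs, abs_pow]
  calc _ = |S| ^ 2 * (μ / 4 * (‖x‖ * ‖y‖)) := by ring
    _ ≤ _ := mul_le_mul_of_nonneg_left (by nlinarith) (by positivity)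

end Wedges

section Amplitudes

/-- The cosine of the coordinate in the direction `b`. -/
def waveCos (b : Bool) : H → ℝ := planeCos (if b then 1 else 0) (if b then 0 else 1)

/-- The sine of the coordinate in the direction `b`. -/
def waveSin (b : Bool) : H → ℝ := planeSin (if b then 1 else 0) (if b then 0 else 1)

lemma waveCos_sq_add_waveSin_sq (b : Bool) (p : H) : waveCos b p ^ 2 + waveSin b p ^ 2 = 1 := by
  simp [waveCos, waveSin, planeCos, planeSin]

lemma WD_waveCos (b c : Bool) :
    WD c (waveCos b) = fun p => (if c = b then -1 else 0) * waveSin b p := by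
  rw [waveCos, WD_planeCos]
  funext p
  cases b <;> cases c <;> simp [freq, waveSin]

lemma WD_waveSin (b c : Bool) :
    WD c (waveSin b) = fun p => (if c = b then 1 else 0) * waveCos b p := by
  rw [waveSin, WD_planeSin]
  funext p
  cases b <;> cases c <;> simp [freq, waveCos]

/-- The amplitudes with which the frame vectors enter the new oscillation. -/
def amp (η : ℝ) : I → H → ℝ
  | Sum.inl i => fun p => η * osc i p
  | Sum.inr (b, 0) => waveCos b
  | Sum.inr (b, 1) => waveSin b

lemma exists_bdd_amp {r : ℝ} (hr : 0 ≤ r) : ∃ K, 1 ≤ K ∧ ∀ η, 0 ≤ η → η ≤ 1 →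
    ∀ i, Bdd r K (amp η i) := by
  choose K₁ h₁ using fun i => exists_bdd_osc i hr
  choose K₂ h₂ using fun b : Bool => exists_bdd_planeCos (if b then 1 else 0) (if b then 0 else 1) r
  choose K₃ h₃ using fun b : Bool => exists_bdd_planeSin (if b then 1 else 0) (if b then 0 else 1) r
  have p₁ := fun i => (h₁ i).nonneg hr
  have p₂ := fun i => (h₂ i).nonneg hr
  have p₃ := fun i => (h₃ i).nonneg hr
  have s₁ := fun i => Finset.single_le_sum (fun i _ => p₁ i) (Finset.mem_univ i)
  have s₂ := fun i => Finset.single_le_sum (fun i _ => p₂ i) (Finset.mem_univ i)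
  have s₃ := fun i => Finset.single_le_sum (fun i _ => p₃ i) (Finset.mem_univ i)
  have q₁ := Finset.sum_nonneg fun i (_ : i ∈ Finset.univ) => p₁ i
  have q₂ := Finset.sum_nonneg fun i (_ : i ∈ Finset.univ) => p₂ i
  have q₃ := Finset.sum_nonneg fun i (_ : i ∈ Finset.univ) => p₃ i
  refine ⟨1 + ∑ i, K₁ i + ∑ i, K₂ i + ∑ i, K₃ i, by linarith, fun η h0 h1 i => ?_⟩
  rcases i with i | ⟨b, k⟩
  · refine ((h₁ i).const_mul hr η).mono hr le_rfl ?_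
    have := s₁ i
    have := mul_le_of_le_one_left (p₁ i) h1
    rw [abs_of_nonneg h0]
    linarith
  · fin_cases k
    · exact (h₂ b).mono hr le_rfl (by have := s₂ b; linarith)
    · exact (h₃ b).mono hr le_rfl (by have := s₃ b; linarith)

lemma contDiff_osc (i : Fin 6) : ContDiff ℝ (⊤ : ℕ∞) (osc i) := by
  obtain ⟨K, h⟩ := exists_bdd_osc i zero_le_one
  exact h.contDiff

lemma WD_const_mul_real (c : Bool) (t : ℝ) {u : H → ℝ} (hu : ContDiff ℝ (⊤ : ℕ∞) u) :
    WD c (fun p => t * u p) = fun p => t * WD c u p := WD_const_smul c t hu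

lemma WD_amp_inl (η : ℝ) (c : Bool) (i : Fin 6) (p : H) :
    WD c (amp η (Sum.inl i)) p = η * WD c (osc i) p := by
  simp only [amp, WD_const_mul_real c η (contDiff_osc i)]

lemma WD_WD_amp_inl (η : ℝ) (b c : Bool) (i : Fin 6) (p : H) :
    WD c (WD b (amp η (Sum.inl i))) p = η * WD c (WD b (osc i)) p := by
  simp only [amp, WD_const_mul_real _ η (contDiff_osc i),
    WD_const_mul_real _ η (contDiff_WD b (contDiff_osc i))]

lemma contDiff_waveCos (b : Bool) : ContDiff ℝ (⊤ : ℕ∞) (waveCos b) :=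
  (exists_bdd_planeCos _ _ 0).choose_spec.contDiff

lemma contDiff_waveSin (b : Bool) : ContDiff ℝ (⊤ : ℕ∞) (waveSin b) :=
  (exists_bdd_planeSin _ _ 0).choose_spec.contDiff

lemma WD_WD_waveCos (b c d : Bool) (p : H) :
    WD d (WD c (waveCos b)) p = (if c = b ∧ d = b then -1 else 0) * waveCos b p := by
  rw [WD_waveCos, WD_const_mul_real _ _ (contDiff_waveSin b), WD_waveSin]
  cases b <;> cases c <;> cases d <;> simp

lemma WD_WD_waveSin (b c d : Bool) (p : H) :
    WD d (WD c (waveSin b)) p = (if c = b ∧ d = b then -1 else 0) * waveSin b p := by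
  rw [WD_waveSin, WD_const_mul_real _ _ (contDiff_waveCos b), WD_waveCos]
  cases b <;> cases c <;> cases d <;> simp

end Amplitudes

end Heisenberg

namespace Heisenberg

section Coefficients

/-- The coefficients of the normalised derivatives `X/S`, `Y/S`, `Z`, `XX`, `YY`, `XY` of the new
map with respect to the old frames. -/
def coeff (η σ τ : ℝ) (p : H) : Fin 6 → I ⊕ J → ℝ :=
  ![Sum.elim (fun i => τ * WD true (amp η i) p) (fun j => if j = (true, 1) then σ else 0),
    Sum.elim (fun i => τ * WD false (amp η i) p) (fun j => if j = (false, 1) then σ else 0),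
    Sum.elim (fun i => WD false (WD true (amp η i)) p - WD true (WD false (amp η i)) p) 0,
    Sum.elim (fun i => WD true (WD true (amp η i)) p) 0,
    Sum.elim (fun i => WD false (WD false (amp η i)) p) 0,
    Sum.elim (fun i => WD true (WD false (amp η i)) p) 0]

lemma sq_sum_four_le {K c₀ c₁ c₂ c₃ x₀ x₁ x₂ x₃ : ℝ} (h₀ : |x₀| ≤ K) (h₁ : |x₁| ≤ K)
    (h₂ : |x₂| ≤ K) (h₃ : |x₃| ≤ K) :
    (c₀ * x₀ + c₁ * x₁ + c₂ * x₂ + c₃ * x₃) ^ 2 ≤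
      4 * K ^ 2 * (c₀ ^ 2 + c₁ ^ 2 + c₂ ^ 2 + c₃ ^ 2) := by
  have q : ∀ c x : ℝ, |x| ≤ K → (c * x) ^ 2 ≤ K ^ 2 * c ^ 2 := fun c x hx => by
    rw [mul_pow, mul_comm]
    exact mul_le_mul_of_nonneg_right (sq_le_sq' (abs_le.1 hx).1 (abs_le.1 hx).2) (sq_nonneg _)
  have := q c₀ x₀ h₀
  have := q c₁ x₁ h₁
  have := q c₂ x₂ h₂
  have := q c₃ x₃ h₃
  set a := c₀ * x₀
  set b := c₁ * x₁
  set c := c₂ * x₂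
  set d := c₃ * x₃
  have : (a + b + c + d) ^ 2 ≤ 4 * (a ^ 2 + b ^ 2 + c ^ 2 + d ^ 2) := by
    nlinarith [sq_nonneg (a - b), sq_nonneg (a - c), sq_nonneg (a - d), sq_nonneg (b - c),
      sq_nonneg (b - d), sq_nonneg (c - d)]
  linarith

lemma exists_coeff_nondegenerate {η : ℝ} (hη : 0 < η) (hη1 : η ≤ 1) : ∃ ν > 0, ∀ (p : H) (σ τ : ℝ),
    σ ^ 2 + τ ^ 2 = 1 → ∀ c : Fin 6 → ℝ,
      ν ^ 2 * ∑ k, c k ^ 2 ≤ ∑ q, (∑ k, c k * coeff η σ τ p k q) ^ 2 := by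
  obtain ⟨κ, hκ, hosc⟩ := osc_nondegenerate
  obtain ⟨K, hK, hb⟩ := exists_bdd_amp (r := 4) (by norm_num)
  have hb1 : ∀ i b p, |WD b (osc i) p| ≤ K := fun i b p => by
    have h := ((hb 1 zero_le_one le_rfl (Sum.inl i)).mono (s := 2 * 1) (by norm_num) (by norm_num)
      le_rfl).WD b le_rfl |>.abs_le zero_le_one p
    rwa [WD_amp_inl, one_mul] at h
  have hb2 : ∀ i b c p, |WD c (WD b (osc i)) p| ≤ K := fun i b c p => by
    have h1 := ((hb 1 zero_le_one le_rfl (Sum.inl i)).mono (s := 2 * (2 * 1)) (by norm_num)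
      (by norm_num) le_rfl).WD b (by norm_num)
    have h := (h1.WD c le_rfl).abs_le zero_le_one p
    rwa [WD_WD_amp_inl, one_mul] at h
  set θ : ℝ := (1 + 48 * K ^ 2)⁻¹ with hθ
  have hθ0 : 0 < θ := by positivity
  have hθK : θ * (24 * K ^ 2) ≤ 1 / 2 := by
    rw [hθ, inv_mul_le_iff₀ (by positivity)]
    nlinarith
  have hθ1 : θ ≤ 1 := inv_le_one_of_one_le₀ (by nlinarith [sq_nonneg K])
  set ν := Real.sqrt (min (1 / 2) (θ * η ^ 2 * κ / 2)) with hν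
  have hm : 0 < min (1 / 2) (θ * η ^ 2 * κ / 2) := lt_min (by norm_num) (by positivity)
  refine ⟨ν, Real.sqrt_pos.2 hm, fun p σ τ hστ c => ?_⟩
  rw [hν, Real.sq_sqrt hm.le]
  have hτ := (abs_le_one_of_sq_add_sq hστ).2
  set S := c 0 ^ 2 + c 1 ^ 2 + c 3 ^ 2 + c 4 ^ 2 with hS
  set R := c 2 ^ 2 + c 5 ^ 2 with hR
  have hSR : ∑ k, c k ^ 2 = S + R := by
    simp only [Fin.sum_univ_six, hS, hR]; ring
  have hS0 : 0 ≤ S := by positivity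
  have hR0 : 0 ≤ R := by positivity
  set z : Fin 6 → ℝ := fun i => c 2 * ZD (osc i) p + c 5 * WD true (WD false (osc i)) p with hz
  set r : Fin 6 → ℝ := fun i => c 0 * (τ * WD true (osc i) p) + c 1 * (τ * WD false (osc i) p) +
    c 3 * WD true (WD true (osc i)) p + c 4 * WD false (WD false (osc i)) p with hr
  have hr2 : ∀ i, r i ^ 2 ≤ 4 * K ^ 2 * S := fun i => by
    have hm : ∀ x : ℝ, |x| ≤ K → |τ * x| ≤ K := fun x hx => by
      rw [abs_mul]; exact (mul_le_of_le_one_left (abs_nonneg _) hτ).trans hx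
    exact sq_sum_four_le (hm _ (hb1 _ _ _)) (hm _ (hb1 _ _ _)) (hb2 _ _ _ _) (hb2 _ _ _ _)
  have hz2 := hosc p (c 2) (c 5)
  have hsum : κ / 2 * R - 24 * K ^ 2 * S ≤ ∑ i, (z i + r i) ^ 2 := by
    have h1 : ∀ i, z i ^ 2 / 2 - 4 * K ^ 2 * S ≤ (z i + r i) ^ 2 := fun i => by
      nlinarith [hr2 i, sq_nonneg (z i + 2 * r i)]
    have h2 := Finset.sum_le_sum fun i (_ : i ∈ Finset.univ) => h1 i
    rw [Finset.sum_sub_distrib, ← Finset.sum_div] at h2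
    simp only [Finset.sum_const, Finset.card_univ, Fintype.card_fin, nsmul_eq_mul] at h2
    push_cast at h2
    linarith
  have e : ∑ q, (∑ k, c k * coeff η σ τ p k q) ^ 2 = S + η ^ 2 * ∑ i, (z i + r i) ^ 2 := by
    have e1 : ∀ i, ∑ k, c k * coeff η σ τ p k (Sum.inl (Sum.inl i)) = η * (z i + r i) := by
      intro i
      simp only [Fin.sum_univ_six, coeff, hz, hr, ZD_eq (contDiff_osc i)]
      simp [WD_amp_inl, WD_WD_amp_inl]
      ring
    have f1 := waveCos_sq_add_waveSin_sq true p
    have f2 := waveCos_sq_add_waveSin_sq false p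
    have e2 : ∀ b k, amp η (Sum.inr (b, k)) = if k = 0 then waveCos b else waveSin b := by
      intro b k
      fin_cases k <;> rfl
    simp only [Fintype.sum_sum_type, e1, mul_pow, ← Finset.mul_sum]
    simp only [Fintype.sum_prod_type, Fintype.sum_bool, Fin.sum_univ_two, Fin.sum_univ_six, coeff]
    simp [e2, WD_WD_waveCos, WD_WD_waveSin]
    simp [WD_waveCos, WD_waveSin]
    linear_combination (τ ^ 2 * c 0 ^ 2 + c 3 ^ 2) * f1 + (τ ^ 2 * c 1 ^ 2 + c 4 ^ 2) * f2 + (c 0 ^ 2 + c 1 ^ 2) * hστ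
  rw [e, hSR]
  have g1 : min (1 / 2) (θ * η ^ 2 * κ / 2) * (S + R) ≤ S / 2 + θ * η ^ 2 * κ / 2 * R := by
    have := mul_le_mul_of_nonneg_right (min_le_left (1 / 2) (θ * η ^ 2 * κ / 2)) hS0
    have := mul_le_mul_of_nonneg_right (min_le_right (1 / 2) (θ * η ^ 2 * κ / 2)) hR0
    linarith
  have g2 : 0 ≤ ∑ i, (z i + r i) ^ 2 := Finset.sum_nonneg fun i _ => sq_nonneg _
  have g3 : θ * η ^ 2 * ∑ i, (z i + r i) ^ 2 ≤ η ^ 2 * ∑ i, (z i + r i) ^ 2 :=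
    mul_le_mul_of_nonneg_right (mul_le_of_le_one_left (sq_nonneg _) hθ1) g2
  have g4 := mul_le_mul_of_nonneg_left hsum (by positivity : 0 ≤ θ * η ^ 2)
  have g5 : η ^ 2 * (θ * (24 * K ^ 2)) * S ≤ 1 * (1 / 2) * S := by
    refine mul_le_mul_of_nonneg_right (mul_le_mul ?_ hθK (by positivity) zero_le_one) hS0
    exact pow_le_one₀ hη.le hη1
  linarith

end Coefficients

end Heisenberg

namespace Heisenberg

section SlowModulation

variable {A K M : ℝ}

lemma contDiff_slow {u : H → V} (hu : ContDiff ℝ (⊤ : ℕ∞) u) (c : ℝ) :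
    ContDiff ℝ (⊤ : ℕ∞) fun p => u (dilate c p) := hu.comp (contDiff_dilate c)

lemma WD_modulated (b : Bool) {f : H → ℝ} {u : H → V} (hf : ContDiff ℝ (⊤ : ℕ∞) f)
    (hu : ContDiff ℝ (⊤ : ℕ∞) u) (c : ℝ) :
    WD b (fun p => f p • u (dilate c p)) =
      fun p => WD b f p • u (dilate c p) + f p • c • WD b u (dilate c p) := by
  rw [WD_smul b hf (contDiff_slow hu c), WD_dilate b c hu]

lemma WD_WD_modulated (b b' : Bool) {f : H → ℝ} {u : H → V} (hf : ContDiff ℝ (⊤ : ℕ∞) f)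
    (hu : ContDiff ℝ (⊤ : ℕ∞) u) (c : ℝ) :
    WD b' (WD b fun p => f p • u (dilate c p)) =
      fun p => WD b' (WD b f) p • u (dilate c p) + (WD b f p • c • WD b' u (dilate c p) +
        (WD b' f p • c • WD b u (dilate c p) + f p • c • c • WD b' (WD b u) (dilate c p))) := by
  have h1 := contDiff_WD b hf
  have h2 := contDiff_WD b hu
  have e : (fun p => f p • c • WD b u (dilate c p)) = fun p => c • (f p • WD b u (dilate c p)) := by
    funext p; rw [smul_comm]
  have hs1 : ContDiff ℝ (⊤ : ℕ∞) fun p => WD b f p • u (dilate c p) := h1.smul (contDiff_slow hu c)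
  have hs2 : ContDiff ℝ (⊤ : ℕ∞) fun p => f p • c • WD b u (dilate c p) :=
    hf.smul ((contDiff_slow h2 c).const_smul c)
  have hs3 : ContDiff ℝ (⊤ : ℕ∞) fun p => f p • WD b u (dilate c p) :=
    hf.smul (contDiff_slow h2 c)
  rw [WD_modulated b hf hu, WD_add b' hs1 hs2, WD_modulated b' h1 hu, e,
    WD_const_smul b' c hs3, WD_modulated b' hf h2]
  funext p
  beta_reduce
  rw [smul_add, smul_comm c (WD b' f p), smul_comm c (f p), add_assoc]

variable {ι : Type*} [Fintype ι]

lemma norm_WD_modulated_sub_le (b : Bool) {f : ι → H → ℝ} {u : ι → H → V} (hA : 1 ≤ A)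
    (hf : ∀ i, Bdd 4 K (f i)) (hu : ∀ i, VBdd 4 M (u i)) (p : H) :
    ‖WD b (fun p => ∑ i, f i p • u i (dilate A⁻¹ p)) p - ∑ i, WD b (f i) p • u i (dilate A⁻¹ p)‖ ≤
      Fintype.card ι * (29 * (K * M) / A) := by
  have hA0 : 0 < A := by linarith
  have hs : ∀ i, ContDiff ℝ (⊤ : ℕ∞) fun p => f i p • u i (dilate A⁻¹ p) := fun i =>
    (hf i).contDiff.smul (contDiff_slow (hu i).contDiff _)
  rw [WD_sum _ _ fun i _ => hs i]
  simp only [WD_modulated b (hf _).contDiff (hu _).contDiff, ← Finset.sum_sub_distrib]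
  refine (norm_sum_le _ _).trans
    ((Finset.sum_le_card_nsmul _ _ (29 * (K * M) / A) fun i _ => ?_).trans_eq ?_)
  · rw [add_sub_cancel_left, norm_smul, norm_smul, Real.norm_eq_abs, norm_inv, Real.norm_eq_abs,
      abs_of_pos hA0]
    have h1 := (hf i).abs_le (by norm_num) p
    have h2 := (((hu i).mono (s := 2 * 1) (by norm_num) (by norm_num) le_rfl).WD b le_rfl).norm_le
      zero_le_one (dilate A⁻¹ p)
    calc |f i p| * (A⁻¹ * ‖WD b (u i) (dilate A⁻¹ p)‖) ≤ K * (A⁻¹ * (29 * M)) := by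
          have := (abs_nonneg _).trans h1
          gcongr
      _ = 29 * (K * M) / A := by ring
  · simp

lemma norm_WD_WD_modulated_sub_le (b b' : Bool) {f : ι → H → ℝ} {u : ι → H → V} (hA : 1 ≤ A)
    (hf : ∀ i, Bdd 4 K (f i)) (hu : ∀ i, VBdd 4 M (u i)) (p : H) :
    ‖WD b' (WD b (fun p => ∑ i, f i p • u i (dilate A⁻¹ p))) p -
        ∑ i, WD b' (WD b (f i)) p • u i (dilate A⁻¹ p)‖ ≤
      Fintype.card ι * (87 * (K * M) / A) := by
  have hA0 : 0 < A := by linarith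
  have hs : ∀ i, ContDiff ℝ (⊤ : ℕ∞) fun p => f i p • u i (dilate A⁻¹ p) := fun i =>
    (hf i).contDiff.smul (contDiff_slow (hu i).contDiff _)
  rw [WD_sum _ _ fun i _ => hs i, WD_sum _ _ fun i _ => contDiff_WD b (hs i)]
  simp only [WD_WD_modulated b b' (hf _).contDiff (hu _).contDiff, ← Finset.sum_sub_distrib]
  refine (norm_sum_le _ _).trans
    ((Finset.sum_le_card_nsmul _ _ (87 * (K * M) / A) fun i _ => ?_).trans_eq ?_)
  · rw [add_sub_cancel_left]
    have hK := (hf i).nonneg (by norm_num)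
    have hM := (hu i).nonneg (by norm_num)
    have g : ∀ c, Bdd 2 K (WD c (f i)) := fun c =>
      ((hf i).mono (s := 2 * 2) (by norm_num) (by norm_num) le_rfl).WD c (by norm_num)
    have w : ∀ c, VBdd 2 M (WD c (u i)) := fun c =>
      ((hu i).mono (s := 2 * 2) (by norm_num) (by norm_num) le_rfl).WD c (by norm_num)
    have w2 : VBdd 1 M (WD b' (WD b (u i))) :=
      ((w b).mono (s := 2 * 1) (by norm_num) (by norm_num) le_rfl).WD b' le_rfl
    have k : ∀ x y : ℝ, |x| ≤ K → ∀ z : V, ‖z‖ ≤ 29 * M → |y| ≤ A⁻¹ →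
        ‖x • y • z‖ ≤ 29 * (K * M) / A := fun x y hx z hz hy => by
      rw [norm_smul, norm_smul, Real.norm_eq_abs, Real.norm_eq_abs]
      calc |x| * (|y| * ‖z‖) ≤ K * (A⁻¹ * (29 * M)) := by gcongr
        _ = 29 * (K * M) / A := by ring
    have a1 : |A⁻¹| ≤ A⁻¹ := by rw [abs_of_pos (inv_pos.2 hA0)]
    have a2 : |A⁻¹ * A⁻¹| ≤ A⁻¹ := by
      rw [abs_of_pos (by positivity)]
      exact mul_le_of_le_one_left (by positivity) (inv_le_one_of_one_le₀ hA)
    have k1 := k _ _ ((g b).abs_le (by norm_num) p) _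
      ((w b').norm_le (by norm_num) (dilate A⁻¹ p)) a1
    have k2 := k _ _ ((g b').abs_le (by norm_num) p) _
      ((w b).norm_le (by norm_num) (dilate A⁻¹ p)) a1
    have k3 := k _ _ ((hf i).abs_le (by norm_num) p) _
      (w2.norm_le (by norm_num) (dilate A⁻¹ p)) a2
    rw [mul_smul] at k3
    refine (norm_add_le _ _).trans ((add_le_add_right (norm_add_le _ _) _).trans ?_)
    calc _ ≤ 29 * (K * M) / A + (29 * (K * M) / A + 29 * (K * M) / A) :=
          add_le_add k1 (add_le_add k2 k3)
      _ = _ := by ring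
  · simp

/-- The rescaled copy of `ψ` at the next larger scale. -/
def slowMap (A : ℝ) (ψ : H → V) (p : H) : V := A • ψ (dilate A⁻¹ p)

lemma contDiff_slowMap {ψ : H → V} (hψ : ContDiff ℝ (⊤ : ℕ∞) ψ) (A : ℝ) :
    ContDiff ℝ (⊤ : ℕ∞) (slowMap A ψ) := (contDiff_slow hψ _).const_smul A

lemma WD_slowMap {ψ : H → V} (hψ : ContDiff ℝ (⊤ : ℕ∞) ψ) (hA : A ≠ 0) (b : Bool) :
    WD b (slowMap A ψ) = fun p => WD b ψ (dilate A⁻¹ p) := by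
  have := WD_const_smul b A (contDiff_slow hψ A⁻¹)
  rw [WD_dilate b A⁻¹ hψ] at this
  have e : slowMap A ψ = fun p => A • ψ (dilate A⁻¹ p) := rfl
  rw [e, this]
  simp [smul_smul, hA]

lemma WD_WD_slowMap {ψ : H → V} (hψ : ContDiff ℝ (⊤ : ℕ∞) ψ) (hA : A ≠ 0) (b c : Bool) :
    WD c (WD b (slowMap A ψ)) = fun p => A⁻¹ • WD c (WD b ψ) (dilate A⁻¹ p) := by
  rw [WD_slowMap hψ hA, WD_dilate c A⁻¹ (contDiff_WD b hψ)]

end SlowModulation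

section AmplitudeSums

variable {F : Type} [NormedAddCommGroup F] [NormedSpace ℝ F] {η K : ℝ} {P : I → F}

lemma sum_WD_amp_smul (η : ℝ) (P : I → F) (b : Bool) (p : H) :
    ∑ i, WD b (amp η i) p • P i = perpVec (fun b => waveCos b p) (fun b => waveSin b p) P b +
      η • ∑ i, WD b (osc i) p • P (Sum.inl i) := by
  have e : ∀ b k, amp η (Sum.inr (b, k)) = if k = 0 then waveCos b else waveSin b := by
    intro b k
    fin_cases k <;> rfl
  rw [Fintype.sum_sum_type, add_comm]
  simp only [WD_amp_inl, mul_smul, ← Finset.smul_sum]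
  congr 1
  simp only [Fintype.sum_prod_type, Fintype.sum_bool, Fin.sum_univ_two, e, perpVec]
  cases b <;> simp [WD_waveCos, WD_waveSin] <;> abel

lemma sum_WD_WD_amp_smul (η : ℝ) (P : I → F) (b : Bool) (p : H) :
    ∑ i, WD b (WD b (amp η i)) p • P i =
      -radVec (fun b => waveCos b p) (fun b => waveSin b p) P b +
      η • ∑ i, WD b (WD b (osc i)) p • P (Sum.inl i) := by
  have e : ∀ b k, amp η (Sum.inr (b, k)) = if k = 0 then waveCos b else waveSin b := by
    intro b k
    fin_cases k <;> rfl
  rw [Fintype.sum_sum_type, add_comm]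
  simp only [WD_WD_amp_inl, mul_smul, ← Finset.smul_sum]
  congr 1
  simp only [Fintype.sum_prod_type, Fintype.sum_bool, Fin.sum_univ_two, e, radVec]
  cases b <;> simp [WD_WD_waveCos, WD_WD_waveSin] <;> abel

lemma norm_smul_sum_six_le {x : Fin 6 → ℝ} {Q : Fin 6 → F} (hη : 0 ≤ η) (hx : ∀ i, |x i| ≤ K)
    (hQ : ∀ i, ‖Q i‖ ≤ 2) : ‖η • ∑ i, x i • Q i‖ ≤ 12 * K * η := by
  have hK := (abs_nonneg _).trans (hx 0)
  rw [norm_smul, Real.norm_of_nonneg hη]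
  have : ‖∑ i, x i • Q i‖ ≤ ∑ _i : Fin 6, K * 2 := by
    refine (norm_sum_le _ _).trans (Finset.sum_le_sum fun i _ => ?_)
    rw [norm_smul, Real.norm_eq_abs]
    exact mul_le_mul (hx i) (hQ i) (norm_nonneg _) hK
  calc _ ≤ η * ∑ _i : Fin 6, K * 2 := mul_le_mul_of_nonneg_left this hη
    _ = 12 * K * η := by simp; ring

end AmplitudeSums

end Heisenberg

namespace Heisenberg

section State

/-- The normalised second and first derivatives of a map `ψ` with `|Xψ|, |Yψ| ≈ s`. -/
def frameT (ψ : H → V) (s : ℝ) : J → H → V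
  | (b, 0) => fun p => -WD b (WD b ψ) p
  | (b, 1) => fun p => s⁻¹ • WD b ψ p

/-- A map `ψ` at unit scale together with an approximately orthonormal normal frame `E`. -/
structure Good (δE δ r M : ℝ) (E : I → H → V) (ψ : H → V) (s : ℝ) : Prop where
  one_le : 1 ≤ s
  contDiff : ContDiff ℝ (⊤ : ℕ∞) ψ
  bddE : ∀ i, VBdd r M (E i)
  bddT : ∀ j, VBdd r M (frameT ψ s j)
  bddWW : ∀ b c, VBdd r M (WD c (WD b ψ))
  orth : ∀ i j p, ⟪E i p, frameT ψ s j p⟫ = 0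
  nearE : ∀ p, NearON δE fun i => E i p
  nearT : ∀ p, NearON δ fun j => frameT ψ s j p

/-- The new oscillation. -/
def newOsc (η A : ℝ) (E : I → H → V) (p : H) : V := ∑ i, amp η i p • E i (dilate A⁻¹ p)

/-- The new map. -/
def newMap (a η A : ℝ) (E : I → H → V) (ψ : H → V) (p : H) : V :=
  newOsc η A E p + a • slowMap A ψ p

/-- The new size of the first derivatives. -/
def newSize (a s : ℝ) : ℝ := Real.sqrt (1 + (a * s) ^ 2)

lemma one_le_newSize (a s : ℝ) : 1 ≤ newSize a s :=
  Real.one_le_sqrt.2 (by nlinarith [sq_nonneg (a * s)])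

lemma newSize_sq (a s : ℝ) : newSize a s ^ 2 = 1 + (a * s) ^ 2 := Real.sq_sqrt (by positivity)

lemma newSize_weights (a s : ℝ) : (a * s / newSize a s) ^ 2 + (1 / newSize a s) ^ 2 = 1 := by
  have := one_le_newSize a s
  rw [div_pow, div_pow, newSize_sq]
  field_simp
  ring

variable {δE δ r M A K η a s : ℝ} {E : I → H → V} {ψ : H → V}

namespace Good

lemma WD_slowMap_eq (hg : Good δE δ r M E ψ s) (hA : 1 ≤ A) (b : Bool) (p : H) :
    WD b (slowMap A ψ) p = s • frameT ψ s (b, 1) (dilate A⁻¹ p) := by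
  have hs := hg.one_le
  rw [WD_slowMap hg.contDiff (by linarith)]
  simp [frameT, smul_smul, show s * s⁻¹ = 1 from mul_inv_cancel₀ (by linarith)]

lemma contDiff_newOsc (hg : Good δE δ r M E ψ s) (hK : ∀ i, Bdd 4 K (amp η i)) :
    ContDiff ℝ (⊤ : ℕ∞) (newOsc η A E) := by
  have h : ∀ i, ContDiff ℝ (⊤ : ℕ∞) fun p => amp η i p • E i (dilate A⁻¹ p) := fun i =>
    (hK i).contDiff.smul (contDiff_slow (hg.bddE i).contDiff _)
  exact ContDiff.sum fun i _ => h i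

lemma contDiff_newMap (hg : Good δE δ r M E ψ s) (hK : ∀ i, Bdd 4 K (amp η i)) :
    ContDiff ℝ (⊤ : ℕ∞) (newMap a η A E ψ) :=
  (hg.contDiff_newOsc hK).add ((contDiff_slowMap hg.contDiff A).const_smul a)

lemma WD_newMap (hg : Good δE δ r M E ψ s) (hK : ∀ i, Bdd 4 K (amp η i)) (b : Bool) :
    WD b (newMap a η A E ψ) = fun p => WD b (newOsc η A E) p + a • WD b (slowMap A ψ) p := by
  have h := contDiff_slowMap hg.contDiff A
  have h2 : ContDiff ℝ (⊤ : ℕ∞) fun p => a • slowMap A ψ p := h.const_smul a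
  have e : newMap a η A E ψ = fun p => newOsc η A E p + a • slowMap A ψ p := rfl
  rw [e, WD_add b (hg.contDiff_newOsc hK) h2, WD_const_smul b a h]

lemma WD_WD_newMap (hg : Good δE δ r M E ψ s) (hK : ∀ i, Bdd 4 K (amp η i)) (hA : 1 ≤ A)
    (b c : Bool) : WD c (WD b (newMap a η A E ψ)) = fun p => WD c (WD b (newOsc η A E)) p +
      (a * A⁻¹) • WD c (WD b ψ) (dilate A⁻¹ p) := by
  have h := contDiff_WD b (contDiff_slowMap hg.contDiff A)
  have h2 : ContDiff ℝ (⊤ : ℕ∞) fun p => a • WD b (slowMap A ψ) p := h.const_smul a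
  rw [hg.WD_newMap hK, WD_add c (contDiff_WD b (hg.contDiff_newOsc hK)) h2, WD_const_smul c a h,
    WD_WD_slowMap hg.contDiff (by linarith)]
  simp only [smul_smul]

lemma inner_newOsc_frameT (hg : Good δE δ r M E ψ s) (j : J) (p : H) :
    ⟪newOsc η A E p, frameT ψ s j (dilate A⁻¹ p)⟫ = 0 := by
  simp only [newOsc, sum_inner, real_inner_smul_left, hg.orth, mul_zero, Finset.sum_const_zero]

lemma inner_WD_newOsc (hg : Good δE δ r M E ψ s) (hK : ∀ i, Bdd 4 K (amp η i)) (hA : 1 ≤ A)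
    (b b' : Bool) (p : H) : ⟪WD b (newOsc η A E) p, WD b' (slowMap A ψ) p⟫ =
      -(A⁻¹ * ⟪newOsc η A E p, WD b (WD b' ψ) (dilate A⁻¹ p)⟫) := by
  have h := WD_inner b (hg.contDiff_newOsc hK (A := A))
    (contDiff_WD b' (contDiff_slowMap hg.contDiff A)) p
  have h0 : (fun p => ⟪newOsc η A E p, WD b' (slowMap A ψ) p⟫) = fun _ => 0 := by
    funext p
    rw [hg.WD_slowMap_eq hA, real_inner_smul_right, hg.inner_newOsc_frameT, mul_zero]
  rw [h0, WD_const, WD_WD_slowMap hg.contDiff (by linarith), real_inner_smul_right] at h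
  linarith

lemma inner_WD_newOsc_self (hg : Good δE δ r M E ψ s) (hK : ∀ i, Bdd 4 K (amp η i)) (hA : 1 ≤ A)
    (b : Bool) (p : H) : ⟪WD b (newOsc η A E) p, WD b (slowMap A ψ) p⟫ = 0 := by
  have h := hg.inner_newOsc_frameT (η := η) (A := A) (b, 0) p
  simp only [frameT, inner_neg_right, neg_eq_zero] at h
  rw [hg.inner_WD_newOsc hK hA, h, mul_zero, neg_zero]

lemma norm_WW_le (hg : Good δE δ r M E ψ s) (hr : 4 ≤ r) (b c : Bool) (p : H) :
    ‖WD c (WD b ψ) p‖ ≤ 29 * M := (hg.bddWW b c).norm_le (by linarith) p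

lemma norm_newOsc_le (hg : Good δE δ r M E ψ s) (hδE : δE ≤ 1) (hK : ∀ i, Bdd 4 K (amp η i))
    (p : H) : ‖newOsc η A E p‖ ≤ 20 * K := by
  have : ‖newOsc η A E p‖ ≤ ∑ _i : I, K * 2 := by
    refine (norm_sum_le _ _).trans (Finset.sum_le_sum fun i _ => ?_)
    rw [norm_smul, Real.norm_eq_abs]
    exact mul_le_mul ((hK i).abs_le (by norm_num) p) ((hg.nearE _).norm_le hδE i) (norm_nonneg _)
      ((hK i).nonneg (by norm_num))
  refine this.trans_eq ?_
  simp
  ring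

lemma abs_inner_WD_newOsc_le (hg : Good δE δ r M E ψ s) (hδE : δE ≤ 1)
    (hK : ∀ i, Bdd 4 K (amp η i)) (hA : 1 ≤ A) (hr : 4 ≤ r) (b b' : Bool) (p : H) :
    |⟪WD b (newOsc η A E) p, WD b' (slowMap A ψ) p⟫| ≤ 900 * (K * M) / A := by
  have hA0 : 0 < A := by linarith
  have h1 := hg.norm_newOsc_le hδE hK (A := A) p
  have h2 := hg.norm_WW_le hr b' b (dilate A⁻¹ p)
  have hK0 := (hK default).nonneg (by norm_num)
  have hM0 : 0 ≤ M := by linarith [(norm_nonneg _).trans h2]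
  rw [hg.inner_WD_newOsc hK hA, abs_neg, abs_mul, abs_of_pos (inv_pos.2 hA0)]
  calc _ ≤ A⁻¹ * ((20 * K) * (29 * M)) := by
        refine mul_le_mul_of_nonneg_left ((abs_real_inner_le_norm _ _).trans ?_) (by positivity)
        exact mul_le_mul h1 h2 (norm_nonneg _) (by positivity)
    _ ≤ 900 * (K * M) / A := by
        rw [div_eq_inv_mul]
        refine mul_le_mul_of_nonneg_left ?_ (by positivity)
        nlinarith [mul_nonneg hK0 hM0]

lemma bddE_four (hg : Good δE δ r M E ψ s) (hr : 4 ≤ r) (i : I) : VBdd 4 M (E i) :=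
  (hg.bddE i).mono (by norm_num) hr le_rfl

lemma norm_WD_newOsc_sub_le (hg : Good δE δ r M E ψ s) (hK : ∀ i, Bdd 4 K (amp η i))
    (hA : 1 ≤ A) (hr : 4 ≤ r) (b : Bool) (p : H) :
    ‖WD b (newOsc η A E) p - ∑ i, WD b (amp η i) p • E i (dilate A⁻¹ p)‖ ≤
      900 * (K * M) / A := by
  have h := norm_WD_modulated_sub_le b hA hK (hg.bddE_four hr) p
  have h0 := mul_nonneg ((hK default).nonneg (by norm_num))
    ((hg.bddE_four hr default).nonneg (by norm_num))
  refine h.trans ?_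
  rw [mul_div_assoc', div_le_div_iff_of_pos_right (by linarith)]
  simp
  linarith

lemma norm_WD_WD_newOsc_sub_le (hg : Good δE δ r M E ψ s) (hK : ∀ i, Bdd 4 K (amp η i))
    (hA : 1 ≤ A) (hr : 4 ≤ r) (b c : Bool) (p : H) :
    ‖WD c (WD b (newOsc η A E)) p - ∑ i, WD c (WD b (amp η i)) p • E i (dilate A⁻¹ p)‖ ≤
      870 * (K * M) / A := by
  have h := norm_WD_WD_modulated_sub_le b c hA hK (hg.bddE_four hr) p
  refine h.trans_eq ?_
  simp
  ring

lemma norm_WD_WD_newMap_sub_le (hg : Good δE δ r M E ψ s) (hK : ∀ i, Bdd 4 K (amp η i))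
    (hK1 : 1 ≤ K) (ha0 : 0 ≤ a) (ha1 : a ≤ 1)
    (hA : 1 ≤ A) (hr : 4 ≤ r) (b c : Bool) (p : H) :
    ‖WD c (WD b (newMap a η A E ψ)) p - ∑ i, WD c (WD b (amp η i)) p • E i (dilate A⁻¹ p)‖ ≤
      900 * (K * M) / A := by
  have hA0 : 0 < A := by linarith
  have h := hg.norm_WD_WD_newOsc_sub_le hK hA hr b c p
  have h2 := hg.norm_WW_le hr b c (dilate A⁻¹ p)
  have hM0 : 0 ≤ M := by linarith [(norm_nonneg _).trans h2]
  rw [hg.WD_WD_newMap hK hA, add_sub_right_comm]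
  have h3 : ‖(a * A⁻¹) • WD c (WD b ψ) (dilate A⁻¹ p)‖ ≤ 29 * (K * M) / A := by
    rw [norm_smul, Real.norm_of_nonneg (by positivity), div_eq_inv_mul]
    calc a * A⁻¹ * ‖WD c (WD b ψ) (dilate A⁻¹ p)‖ ≤ 1 * A⁻¹ * (29 * M) := by gcongr
      _ = A⁻¹ * (29 * (1 * M)) := by ring
      _ ≤ A⁻¹ * (29 * (K * M)) := by gcongr
  refine (norm_add_le _ _).trans ((add_le_add h h3).trans ?_)
  rw [← add_div, div_le_div_iff_of_pos_right hA0]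
  nlinarith [mul_nonneg (by linarith : 0 ≤ K) hM0]

lemma abs_WD_amp_le (hK : ∀ i, Bdd 4 K (amp 1 i)) (b : Bool) (i : Fin 6) (p : H) :
    |WD b (osc i) p| ≤ K := by
  have h := (((hK (Sum.inl i)).mono (s := 2 * 1) (by norm_num) (by norm_num) le_rfl).WD b
    le_rfl).abs_le zero_le_one p
  rwa [WD_amp_inl, one_mul] at h

lemma abs_WD_WD_amp_le (hK : ∀ i, Bdd 4 K (amp 1 i)) (b c : Bool) (i : Fin 6) (p : H) :
    |WD c (WD b (osc i)) p| ≤ K := by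
  have h1 := ((hK (Sum.inl i)).mono (s := 2 * (2 * 1)) (by norm_num) (by norm_num) le_rfl).WD b
    (by norm_num)
  have h := (h1.WD c le_rfl).abs_le zero_le_one p
  rwa [WD_WD_amp_inl, one_mul] at h

lemma norm_WD_newOsc_sub_perpVec_le (hg : Good δE δ r M E ψ s) (hδE : δE ≤ 1)
    (hK : ∀ i, Bdd 4 K (amp η i)) (hK1 : ∀ i, Bdd 4 K (amp 1 i)) (hη : 0 ≤ η)
    (hA : 1 ≤ A) (hr : 4 ≤ r) (b : Bool) (p : H) :
    ‖WD b (newOsc η A E) p - perpVec (fun b => waveCos b p) (fun b => waveSin b p)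
      (fun i => E i (dilate A⁻¹ p)) b‖ ≤ 12 * K * η + 900 * (K * M) / A := by
  have h := hg.norm_WD_newOsc_sub_le hK hA hr b p
  rw [sum_WD_amp_smul η (fun i => E i (dilate A⁻¹ p)), ← sub_sub] at h
  have h2 := norm_smul_sum_six_le hη (fun i => abs_WD_amp_le hK1 b i p)
    (fun i => (hg.nearE (dilate A⁻¹ p)).norm_le hδE (Sum.inl i))
  have := norm_add_le_of_le h2 h
  rwa [add_sub_cancel] at this

lemma norm_neg_WD_WD_newMap_sub_radVec_le (hg : Good δE δ r M E ψ s) (hδE : δE ≤ 1)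
    (hK : ∀ i, Bdd 4 K (amp η i)) (hK1 : ∀ i, Bdd 4 K (amp 1 i)) (h1K : 1 ≤ K) (hη : 0 ≤ η)
    (ha0 : 0 ≤ a) (ha1 : a ≤ 1) (hA : 1 ≤ A) (hr : 4 ≤ r) (b : Bool) (p : H) :
    ‖-WD b (WD b (newMap a η A E ψ)) p - radVec (fun b => waveCos b p) (fun b => waveSin b p)
      (fun i => E i (dilate A⁻¹ p)) b‖ ≤ 12 * K * η + 900 * (K * M) / A := by
  have h := hg.norm_WD_WD_newMap_sub_le hK h1K ha0 ha1 hA hr b b p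
  rw [sum_WD_WD_amp_smul η (fun i => E i (dilate A⁻¹ p)), add_comm, ← sub_sub] at h
  have h2 := norm_smul_sum_six_le hη (fun i => abs_WD_WD_amp_le hK1 b b i p)
    (fun i => (hg.nearE (dilate A⁻¹ p)).norm_le hδE (Sum.inl i))
  have := norm_add_le_of_le h2 h
  rw [← norm_neg] at this
  refine (congrArg norm ?_).trans_le this
  abel

lemma frameT_newMap (hg : Good δE δ r M E ψ s) (hK : ∀ i, Bdd 4 K (amp η i)) (hA : 1 ≤ A)
    (p : H) : (fun j => frameT (newMap a η A E ψ) (newSize a s) j p) =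
      newFrame (a * s / newSize a s) (1 / newSize a s) (fun j => frameT ψ s j (dilate A⁻¹ p))
        (fun b => WD b (newOsc η A E) p) (fun b => WD b (WD b (newMap a η A E ψ)) p) := by
  funext ⟨b, k⟩
  fin_cases k
  · rfl
  · have e : WD b (newMap a η A E ψ) p = WD b (newOsc η A E) p +
        (a * s) • frameT ψ s (b, 1) (dilate A⁻¹ p) := by
      rw [hg.WD_newMap hK]
      beta_reduce
      rw [hg.WD_slowMap_eq hA, smul_smul]
    simp only [Fin.mk_one, newFrame]
    rw [frameT]
    beta_reduce
    rw [e, smul_add, smul_smul]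
    simp [div_eq_inv_mul]

end Good

end State

end Heisenberg

namespace Heisenberg

section CoefficientSums

variable {F : Type} [AddCommGroup F] [Module ℝ F]

lemma sum_elim_smul_elim_ite (f : I → ℝ) (σ τ : ℝ) (P : I → F) (T : J → F) (b : Bool) :
    ∑ q, Sum.elim (fun i => τ * f i) (fun j => if j = (b, 1) then σ else 0) q • Sum.elim P T q =
      τ • ∑ i, f i • P i + σ • T (b, 1) := by
  rw [Fintype.sum_sum_type]
  simp only [Sum.elim_inl, Sum.elim_inr, mul_smul, ← Finset.smul_sum, ite_smul, zero_smul,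
    Finset.sum_ite_eq', Finset.mem_univ, if_true]

lemma sum_elim_zero_smul_elim (f : I → ℝ) (P : I → F) (T : J → F) :
    ∑ q, Sum.elim f 0 q • Sum.elim P T q = ∑ i, f i • P i := by
  rw [Fintype.sum_sum_type]
  simp only [Sum.elim_inl, Sum.elim_inr, Pi.zero_apply, zero_smul, Finset.sum_const_zero, add_zero]

end CoefficientSums

namespace Good

variable {δE δ r M A K η a s : ℝ} {E : I → H → V} {ψ : H → V}

lemma norm_sextuple_sub_le (hg : Good δE δ r M E ψ s) (hK : ∀ i, Bdd 4 K (amp η i))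
    (hK1 : 1 ≤ K) (ha0 : 0 ≤ a) (ha1 : a ≤ 1) (hA : 1 ≤ A) (hr : 4 ≤ r) (p : H) (k : Fin 6) :
    ‖(![(newSize a s)⁻¹ • XD (newMap a η A E ψ) p, (newSize a s)⁻¹ • YD (newMap a η A E ψ) p,
        ZD (newMap a η A E ψ) p, XD (XD (newMap a η A E ψ)) p, YD (YD (newMap a η A E ψ)) p,
        XD (YD (newMap a η A E ψ)) p] : Fin 6 → V) k -
      ∑ q, coeff η (a * s / newSize a s) (1 / newSize a s) p k q •
        Sum.elim (fun i => E i (dilate A⁻¹ p)) (fun j => frameT ψ s j (dilate A⁻¹ p)) q‖ ≤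
      1800 * (K * M) / A := by
  have hA0 : 0 < A := by linarith
  have hM := (hg.bddE_four hr default).nonneg (by norm_num)
  have hS := one_le_newSize a s
  have hω : 900 * (K * M) / A ≤ 1800 * (K * M) / A := by gcongr; norm_num
  have h1 : ∀ b, ‖(newSize a s)⁻¹ • WD b (newMap a η A E ψ) p -
      ((1 / newSize a s) • ∑ i, WD b (amp η i) p • E i (dilate A⁻¹ p) +
        (a * s / newSize a s) • frameT ψ s (b, 1) (dilate A⁻¹ p))‖ ≤ 1800 * (K * M) / A := by
    intro b
    have h := congrFun (hg.frameT_newMap (a := a) hK hA p) (b, 1)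
    simp only [frameT, newFrame] at h
    rw [h, frameT, add_sub_add_right_eq_sub, ← smul_sub, norm_smul,
      Real.norm_of_nonneg (by positivity)]
    refine (mul_le_of_le_one_left (norm_nonneg _) ?_).trans
      ((hg.norm_WD_newOsc_sub_le hK hA hr b p).trans hω)
    rw [div_le_one (by linarith)]
    exact hS
  have h2 := fun b c => hg.norm_WD_WD_newMap_sub_le hK hK1 ha0 ha1 hA hr b c p
  fin_cases k
  · exact (congrArg (fun x => ‖(newSize a s)⁻¹ • WD true (newMap a η A E ψ) p - x‖)
      (sum_elim_smul_elim_ite _ _ _ _ _ true)).trans_le (h1 true)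
  · exact (congrArg (fun x => ‖(newSize a s)⁻¹ • WD false (newMap a η A E ψ) p - x‖)
      (sum_elim_smul_elim_ite _ _ _ _ _ false)).trans_le (h1 false)
  · refine (congrArg (fun x => ‖ZD (newMap a η A E ψ) p - x‖)
      (sum_elim_zero_smul_elim _ _ _)).trans_le ?_
    have := norm_sub_le_of_le (h2 true false) (h2 false true)
    rw [ZD_eq (hg.contDiff_newMap hK)]
    simp only [sub_smul, Finset.sum_sub_distrib]
    rw [sub_sub_sub_comm] at this
    refine this.trans_eq ?_
    ring
  · exact (congrArg (fun x => ‖XD (XD (newMap a η A E ψ)) p - x‖)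
      (sum_elim_zero_smul_elim _ _ _)).trans_le ((h2 true true).trans hω)
  · exact (congrArg (fun x => ‖YD (YD (newMap a η A E ψ)) p - x‖)
      (sum_elim_zero_smul_elim _ _ _)).trans_le ((h2 false false).trans hω)
  · exact (congrArg (fun x => ‖XD (YD (newMap a η A E ψ)) p - x‖)
      (sum_elim_zero_smul_elim _ _ _)).trans_le ((h2 false true).trans hω)

lemma bdd_slow_E (hg : Good δE δ r M E ψ s) (hr : 0 ≤ r) (hδE : δE ≤ 1) (hM : 1 ≤ M)
    (hA : 8 * M ≤ A) (i : I) : VBdd (4 * r) 3 (fun p => E i (dilate A⁻¹ p)) := by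
  have := (hg.bddE i).slow hr hM (fun p => (hg.nearE p).norm_le hδE i) hA
  norm_num at this
  exact this

lemma bdd_slow_T (hg : Good δE δ r M E ψ s) (hr : 0 ≤ r) (hδ : δ ≤ 1) (hM : 1 ≤ M)
    (hA : 8 * M ≤ A) (j : J) : VBdd (4 * r) 3 (fun p => frameT ψ s j (dilate A⁻¹ p)) := by
  have := (hg.bddT j).slow hr hM (fun p => (hg.nearT p).norm_le hδ j) hA
  norm_num at this
  exact this

lemma bdd_newOsc (hg : Good δE δ r M E ψ s) (hr : 0 ≤ r) (hδE : δE ≤ 1) (hM : 1 ≤ M)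
    (hA : 8 * M ≤ A) (hK : ∀ i, Bdd (4 * r) K (amp η i)) :
    VBdd (4 * r) (30 * K) (newOsc η A E) := by
  have := VBdd.sum (r := 4 * r) Finset.univ fun i _ =>
    VBdd.smul (by positivity) (hK i) (hg.bdd_slow_E hr hδE hM hA i)
  refine this.le (by positivity) (le_of_eq ?_)
  simp
  ring

lemma bdd_WD_WD_newMap (hg : Good δE δ r M E ψ s) (hr : 4 ≤ r) (hδE : δE ≤ 1) (hM : 1 ≤ M)
    (hA : 8 * M ≤ A) (ha0 : 0 ≤ a) (ha1 : a ≤ 1) (hK : ∀ i, Bdd (4 * r) K (amp η i)) (b c : Bool) :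
    VBdd r (30 * K + 3) (WD c (WD b (newMap a η A E ψ))) := by
  have hA0 : 0 < A := by linarith
  have hA1 : 1 ≤ A := by linarith
  rw [hg.WD_WD_newMap (fun i => (hK i).mono (by norm_num) (by linarith) le_rfl) hA1]
  have h1 := (((hg.bdd_newOsc (by linarith) hδE hM hA hK).mono (s := 2 * (2 * r)) (by positivity)
    (by linarith) le_rfl).WD b (by linarith)).WD c (by linarith)
  have h2 := ((hg.bddWW b c).dilate hA0).mono (s := r) (by linarith)
    (le_mul_of_one_le_left (by linarith) hA1) le_rfl
  have h3 := h2.const_smul (by linarith) (c := a * A⁻¹) (N := A⁻¹) (by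
    rw [abs_of_nonneg (by positivity)]; exact mul_le_of_le_one_left (by positivity) ha1)
  refine (h1.add h3).le (by linarith) ?_
  have : A⁻¹ * M ≤ 1 := by rw [inv_mul_le_iff₀ hA0]; linarith
  linarith

lemma bdd_frameT_newMap (hg : Good δE δ r M E ψ s) (hr : 4 ≤ r) (hδE : δE ≤ 1) (hδ : δ ≤ 1)
    (hM : 1 ≤ M) (hA : 8 * M ≤ A) (ha0 : 0 ≤ a) (ha1 : a ≤ 1)
    (hK : ∀ i, Bdd (4 * r) K (amp η i)) (j : J) :
    VBdd r (30 * K + 3) (frameT (newMap a η A E ψ) (newSize a s) j) := by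
  obtain ⟨b, k⟩ := j
  have hw := abs_le_one_of_sq_add_sq (newSize_weights a s)
  fin_cases k
  · exact (hg.bdd_WD_WD_newMap hr hδE hM hA ha0 ha1 hK b b).neg (by linarith)
  · have e : frameT (newMap a η A E ψ) (newSize a s) (b, 1) = fun p =>
        (1 / newSize a s) • WD b (newOsc η A E) p +
          (a * s / newSize a s) • frameT ψ s (b, 1) (dilate A⁻¹ p) := by
      funext p
      exact congrFun (hg.frameT_newMap (a := a)
        (fun i => (hK i).mono (by norm_num) (by linarith) le_rfl) (by linarith) p) (b, 1)
    have h1 := ((hg.bdd_newOsc (by linarith) hδE hM hA hK).mono (s := 2 * r) (by positivity)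
      (by linarith) le_rfl).WD b (by linarith)
    have h2 := (hg.bdd_slow_T (by linarith) hδ hM hA (b, 1)).mono (s := r) (by linarith)
      (by linarith) le_rfl
    refine (congrArg (VBdd r (30 * K + 3)) e).mpr ?_
    refine ((h1.const_smul (by linarith) hw.2).add (h2.const_smul (by linarith) hw.1)).le
      (by linarith) (by linarith)

end Good

/-- The frame from which the new normal frame is obtained by projection. -/
def candidate (σ τ A : ℝ) (E : I → H → V) (T : J → H → V) (i : I) (p : H) : V :=
  idealFrame σ τ (fun b => waveCos b p) (fun b => waveSin b p) (fun i => E i (dilate A⁻¹ p))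
    (fun j => T j (dilate A⁻¹ p)) (Sum.inl i)

lemma bdd_candidate {r K σ τ A : ℝ} {E : I → H → V} {T : J → H → V} (hr : 0 ≤ r) (h1K : 1 ≤ K)
    (hK : ∀ i, Bdd r K (amp 1 i)) (hE : ∀ i, VBdd r 3 fun p => E i (dilate A⁻¹ p))
    (hT : ∀ j, VBdd r 3 fun p => T j (dilate A⁻¹ p)) (hσ : |σ| ≤ 1) (hτ : |τ| ≤ 1) (i : I) :
    VBdd r (30 * K + 3) (candidate σ τ A E T i) := by
  rcases i with i | ⟨b, k⟩
  · exact (hE (Sum.inl i)).le hr (by linarith)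
  · fin_cases k
    · exact (hT (b, 0)).le hr (by linarith)
    · have h1 := VBdd.smul hr (hK (Sum.inr (b, 0))) (hE (Sum.inr (b, 1)))
      have h2 := VBdd.smul hr (hK (Sum.inr (b, 1))) (hE (Sum.inr (b, 0)))
      have h3 := ((h1.add (h2.neg hr)).const_smul hr hσ).add
        (((hT (b, 1)).const_smul hr hτ).neg hr)
      have e : candidate σ τ A E T (Sum.inr (b, 1)) = fun p =>
          σ • (amp 1 (Sum.inr (b, 0)) p • E (Sum.inr (b, 1)) (dilate A⁻¹ p) +
            -(amp 1 (Sum.inr (b, 1)) p • E (Sum.inr (b, 0)) (dilate A⁻¹ p))) +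
          -(τ • T (b, 1) (dilate A⁻¹ p)) := by
        funext p
        simp only [candidate, idealFrame, perpVec, sub_eq_add_neg]
        rfl
      refine (congrArg (VBdd r (30 * K + 3)) e).mpr (h3.le hr (by linarith))

end Heisenberg

namespace Heisenberg

section Step

/-- The properties of one step of the construction. -/
structure IsStep (r K κ a A : ℝ) (φ ψ ψ' : H → V) : Prop where
  eq_add : ∀ p, ψ' p = φ p + a • slowMap A ψ p
  bdd : VBdd (4 * r) K φ
  inner_eq_zero : ∀ b p, ⟪WD b φ p, WD b (slowMap A ψ) p⟫ = 0
  half_le : ∀ b p, 1 / 2 ≤ ‖WD b φ p‖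
  wedge_pair : ∀ p, κ * (‖XD ψ' p‖ * ‖YD ψ' p‖) ≤ wedgeNorm ![XD ψ' p, YD ψ' p]
  wedge_sextuple : ∀ p, κ * (‖XD ψ' p‖ * ‖YD ψ' p‖) ≤
    wedgeNorm ![XD ψ' p, YD ψ' p, ZD ψ' p, XD (XD ψ') p, YD (YD ψ') p, XD (YD ψ') p]

lemma bdd_newFrame_projection {r N₀ : ℝ} (m : ℕ) (hr : 0 ≤ r) :
    ∃ N, ∀ (Q : I → H → V) (B : J → H → V), (∀ i, VBdd r N₀ (Q i)) → (∀ j, VBdd r N₀ (B j)) →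
      ∀ i, VBdd r N fun p => newton^[m] (fun i => adjProj (fun j => B j p) (Q i p)) i := by
  obtain ⟨N₁, h₁⟩ := VBdd.exists_adjProj J N₀
  obtain ⟨N₂, h₂⟩ := VBdd.exists_newton_iterate I N₁ m
  exact ⟨N₂, fun Q B hQ hB => h₂ r _ hr fun i => h₁ r B (Q i) hr hB (hQ i)⟩

set_option maxHeartbeats 400000 in
theorem exists_step (r M₀ : ℝ) (hr : 4 ≤ r) : ∃ δE δ M K κ A₀ : ℝ, 0 ≤ δE ∧ 0 ≤ δ ∧ 1 ≤ M ∧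
    M₀ ≤ M ∧ 0 < κ ∧ 1 ≤ A₀ ∧ ∀ A, A₀ ≤ A → ∀ a, 0 ≤ a → a ≤ 1 → ∀ E ψ s, Good δE δ r M E ψ s →
      ∃ φ E' ψ' s', Good δE δ r M E' ψ' s' ∧ IsStep r K κ a A φ ψ ψ' := by
  obtain ⟨δ', hδ', hproj⟩ := exists_nearON_adjProj I J (t := 1 / 20) (by norm_num)
  set δ := min (δ' / 20) (1 / 100) with hδdef
  have hδ0 : 0 < δ := lt_min (by linarith) (by norm_num)
  have hδ1 : δ ≤ δ' / 20 := min_le_left _ _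
  have hδ2 : δ ≤ 1 / 100 := min_le_right _ _
  obtain ⟨m, hm⟩ : ∃ m : ℕ, (1 / 20 : ℝ) / 2 ^ m ≤ δ / 18 := by
    obtain ⟨m, hm⟩ := exists_pow_lt_of_lt_one (by positivity : 0 < δ / 18) (by norm_num :
      (1 / 2 : ℝ) < 1)
    refine ⟨m, le_trans ?_ hm.le⟩
    rw [div_pow, one_pow]
    gcongr
    norm_num
  obtain ⟨K, h1K, hK⟩ := exists_bdd_amp (r := 4 * r) (by linarith)
  set η := δ / (336 * K) with hηdef
  have hη0 : 0 < η := by positivity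
  have hη1 : η ≤ 1 := by rw [hηdef, div_le_one (by positivity)]; linarith
  have hKη : 12 * K * η = δ / 28 := by rw [hηdef]; field_simp; norm_num
  obtain ⟨ν, hν, hcoeff⟩ := exists_coeff_nondegenerate hη0 hη1
  obtain ⟨N, hN⟩ := bdd_newFrame_projection (r := r) (N₀ := 30 * K + 3) m (by linarith)
  set M := max (max N M₀) (30 * K + 3) with hMdef
  have hM1 : 1 ≤ M := le_trans (by linarith) (le_max_right _ _)
  have hNM : N ≤ M := (le_max_left _ _).trans (le_max_left _ _)
  have hLM : 30 * K + 3 ≤ M := le_max_right _ _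
  set κ := min (1 / 16) ((ν / 4) ^ 6 / 4) with hκ
  refine ⟨δ / 18, δ, M, 30 * K, κ, 8 * M + 25200 * (K * M) / δ + 21600 * (K * M) / ν, by positivity,
    hδ0.le, hM1, (le_max_right _ _).trans (le_max_left _ _), lt_min (by norm_num) (by positivity),
    ?_, fun A hA a ha0 ha1 E ψ s hg => ?_⟩
  · have : 0 ≤ 25200 * (K * M) / δ := by positivity
    have : 0 ≤ 21600 * (K * M) / ν := by positivity
    linarith
  have hb1 : 0 ≤ 25200 * (K * M) / δ := by positivity
  have hb2 : 0 ≤ 21600 * (K * M) / ν := by positivity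
  have hA8 : 8 * M ≤ A := by linarith
  have hA1 : 1 ≤ A := by linarith
  have hA0 : 0 < A := by linarith
  have hω1 : 900 * (K * M) / A ≤ δ / 28 := by
    have : 25200 * (K * M) / δ ≤ A := by linarith
    rw [div_le_iff₀ hδ0] at this
    rw [div_le_div_iff₀ hA0 (by norm_num)]
    linarith
  have hω2 : 12 * (1800 * (K * M) / A) ≤ ν := by
    have : 21600 * (K * M) / ν ≤ A := by linarith
    rw [div_le_iff₀ hν] at this
    rw [mul_div_assoc', div_le_iff₀ hA0]
    linarith
  have hKη4 : ∀ i, Bdd (4 * r) K (amp η i) := hK η hη0.le hη1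
  have hK4 : ∀ i, Bdd 4 K (amp η i) := fun i => (hKη4 i).mono (by norm_num) (by linarith) le_rfl
  have hK14 : ∀ i, Bdd 4 K (amp 1 i) := fun i =>
    (hK 1 zero_le_one le_rfl i).mono (by norm_num) (by linarith) le_rfl
  have hδE1 : δ / 18 ≤ 1 := by linarith
  have hδ11 : δ ≤ 1 := by linarith
  set S := newSize a s with hS
  have hS1 : 1 ≤ S := one_le_newSize a s
  have hστ : (a * s / S) ^ 2 + (1 / S) ^ 2 = 1 := newSize_weights a s
  have hs := hg.one_le
  have hcs : ∀ p b, waveCos b p ^ 2 + waveSin b p ^ 2 = 1 := fun p b => waveCos_sq_add_waveSin_sq b p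
  set φ := newOsc η A E with hφ
  set ψ' := newMap a η A E ψ with hψ'
  have hP : ∀ p, NearON (δ / 18) fun i => E i (dilate A⁻¹ p) := fun p => hg.nearE _
  have hT : ∀ p, NearON δ fun j => frameT ψ s j (dilate A⁻¹ p) := fun p => hg.nearT _
  have hPT : ∀ p, NearON δ (Sum.elim (fun i => E i (dilate A⁻¹ p))
      fun j => frameT ψ s j (dilate A⁻¹ p)) := fun p =>
    NearON.sumElim hδ0.le ((hP p).mono (by linarith)) (hT p) fun i j => hg.orth i j _
  have h₁ : ∀ p b, ‖WD b φ p - perpVec (fun b => waveCos b p) (fun b => waveSin b p)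
      (fun i => E i (dilate A⁻¹ p)) b‖ ≤ δ / 14 := fun p b =>
    (hg.norm_WD_newOsc_sub_perpVec_le hδE1 hK4 hK14 hη0.le hA1 hr b p).trans (by linarith)
  have h₂ : ∀ p b, ‖-WD b (WD b ψ') p - radVec (fun b => waveCos b p) (fun b => waveSin b p)
      (fun i => E i (dilate A⁻¹ p)) b‖ ≤ δ / 14 := fun p b =>
    (hg.norm_neg_WD_WD_newMap_sub_radVec_le hδE1 hK4 hK14 h1K hη0.le ha0 ha1 hA1 hr b p).trans
      (by linarith)
  have hx : ∀ p b b', |⟪WD b φ p, s • frameT ψ s (b', 1) (dilate A⁻¹ p)⟫| ≤ δ / 14 :=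
    fun p b b' => by
      rw [← hg.WD_slowMap_eq hA1]
      exact (hg.abs_inner_WD_newOsc_le hδE1 hK4 hA1 hr b b' p).trans (by linarith)
  have hT' : ∀ p, NearON δ fun j => frameT ψ' S j p := fun p => by
    rw [hg.frameT_newMap hK4 hA1]
    exact nearON_newFrame (hP p) (hT p) (fun i j => hg.orth i j _) (by positivity) hδ11
      (by linarith) (hcs p) hστ (by positivity) (by positivity) (by ring) ha0 ha1 (h₁ p) (h₂ p)
      (hx p)
  set Q := candidate (a * s / S) (1 / S) A E (frameT ψ s) with hQ
  set E' : I → H → V := fun i p =>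
    newton^[m] (fun i => adjProj (fun j => frameT ψ' S j p) (Q i p)) i with hE'
  have hnear : ∀ p, NearON (1 / 20) fun i => adjProj (fun j => frameT ψ' S j p) (Q i p) :=
    fun p => by
      refine hproj (fun i => Q i p) (fun j => frameT ψ' S j p) ?_
      rw [hg.frameT_newMap hK4 hA1]
      exact (nearON_idealFrame_newFrame (hPT p) hδ0.le (by linarith) (by linarith) (hcs p) hστ
        (h₁ p) (h₂ p)).mono (by linarith)
  have hw := abs_le_one_of_sq_add_sq hστ
  refine ⟨φ, E', ψ', S, ⟨hS1, hg.contDiff_newMap hK4, ?_, ?_, ?_, ?_, ?_, hT'⟩,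
    fun p => rfl, hg.bdd_newOsc (by linarith) hδE1 hM1 hA8 hKη4,
    fun b p => hg.inner_WD_newOsc_self hK4 hA1 b p, fun b p => ?_, fun p => ?_, fun p => ?_⟩
  · refine fun i => (hN Q (frameT ψ' S) (fun i => ?_) (fun j => ?_) i).le (by linarith) hNM
    · exact bdd_candidate (by linarith) h1K
        (fun i => (hK 1 zero_le_one le_rfl i).mono (by linarith) (by linarith) le_rfl)
        (fun i => (hg.bdd_slow_E (by linarith) hδE1 hM1 hA8 i).mono (by linarith) (by linarith)
          le_rfl)
        (fun j => (hg.bdd_slow_T (by linarith) hδ11 hM1 hA8 j).mono (by linarith) (by linarith)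
          le_rfl) hw.1 hw.2 i
    · exact hg.bdd_frameT_newMap hr hδE1 hδ11 hM1 hA8 ha0 ha1 hKη4 j
  · exact fun j => (hg.bdd_frameT_newMap hr hδE1 hδ11 hM1 hA8 ha0 ha1 hKη4 j).le (by linarith) hLM
  · exact fun b c => (hg.bdd_WD_WD_newMap hr hδE1 hM1 hA8 ha0 ha1 hKη4 b c).le (by linarith) hLM
  · intro i j p
    exact inner_newton_iterate_eq_zero (Q := fun i => adjProj (fun j => frameT ψ' S j p) (Q i p))
      (v := frameT ψ' S j p) (fun i => inner_adjProj (fun j => frameT ψ' S j p) (Q i p) j) m i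
  · intro p
    refine ((hnear p).newton_iterate (by norm_num) ?_ m).mono hm
    simp
    norm_num
  · exact half_le_norm_of_nearON_polar (hP p) (by positivity) (by linarith) (hcs p) (h₁ p) b
  · have h := le_wedgeNorm_pair (S := S) (hT' p) hδ0.le (by linarith)
    have e : ∀ b, S • frameT ψ' S (b, 1) p = WD b ψ' p := fun b => by
      simp [frameT, smul_smul, show S * S⁻¹ = 1 from mul_inv_cancel₀ (by linarith)]
    rw [e, e] at h
    refine le_trans ?_ h
    exact mul_le_mul_of_nonneg_right (min_le_left _ _) (by positivity)
  · have h := pow_le_wedgeNorm_of_approx (hPT p) hδ0.le (by linarith) hν.le hω2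
      (hcoeff p _ _ hστ) (hg.norm_sextuple_sub_le hK4 h1K ha0 ha1 hA1 hr p)
    have e : ∀ b, S • S⁻¹ • WD b ψ' p = WD b ψ' p := fun b => by
      simp [smul_smul, show S * S⁻¹ = 1 from mul_inv_cancel₀ (by linarith)]
    have h2 := le_wedgeNorm_sextuple (S := S) h (by positivity)
      ((hT' p).norm_le hδ11 (true, 1)) ((hT' p).norm_le hδ11 (false, 1)) (congrArg norm (e true))
      (congrArg norm (e false))
    have e1 : S • S⁻¹ • XD ψ' p = XD ψ' p := e true
    have e2 : S • S⁻¹ • YD ψ' p = YD ψ' p := e false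
    rw [e1, e2] at h2
    refine le_trans ?_ h2
    exact mul_le_mul_of_nonneg_right (min_le_right _ _) (by positivity)

end Step

end Heisenberg

namespace Heisenberg

section Initial

/-- Distinct standard basis vectors of the target. -/
def baseVec (f : I ⊕ J → Fin 29) (k : I ⊕ J) : V := EuclideanSpace.single (f k) 1

lemma inner_baseVec {f : I ⊕ J → Fin 29} (hf : Function.Injective f) (k l : I ⊕ J) :
    ⟪baseVec f k, baseVec f l⟫ = if k = l then 1 else 0 := by
  simp [baseVec, EuclideanSpace.inner_single_left, hf.eq_iff]

lemma norm_baseVec (f : I ⊕ J → Fin 29) (k : I ⊕ J) : ‖baseVec f k‖ ≤ 1 := by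
  simp [baseVec]

/-- A product of two circles. -/
def circles (f : I ⊕ J → Fin 29) (p : H) : V :=
  ∑ b : Bool, (waveCos b p • baseVec f (.inr (b, 0)) + waveSin b p • baseVec f (.inr (b, 1)))

lemma contDiff_mul_vec {f : H → ℝ} (hf : ContDiff ℝ (⊤ : ℕ∞) f) (v : V) :
    ContDiff ℝ (⊤ : ℕ∞) fun p => f p • v := hf.smul contDiff_const

lemma contDiff_circles (f : I ⊕ J → Fin 29) : ContDiff ℝ (⊤ : ℕ∞) (circles f) := by
  refine ContDiff.sum fun b _ => ?_
  exact (contDiff_mul_vec (contDiff_waveCos b) _).add (contDiff_mul_vec (contDiff_waveSin b) _)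

lemma WD_mul_vec (c : Bool) {f : H → ℝ} (hf : ContDiff ℝ (⊤ : ℕ∞) f) (v : V) :
    WD c (fun p => f p • v) = fun p => WD c f p • v := by
  rw [WD_smul c hf contDiff_const]
  simp [WD_const]

lemma WD_circles (f : I ⊕ J → Fin 29) (c : Bool) : WD c (circles f) = fun p =>
    -waveSin c p • baseVec f (.inr (c, 0)) + waveCos c p • baseVec f (.inr (c, 1)) := by
  have h : ∀ b, WD c (fun p => waveCos b p • baseVec f (.inr (b, 0)) +
      waveSin b p • baseVec f (.inr (b, 1))) = fun p =>
      ((if c = b then -1 else 0) * waveSin b p) • baseVec f (.inr (b, 0)) +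
      ((if c = b then 1 else 0) * waveCos b p) • baseVec f (.inr (b, 1)) := by
    intro b
    rw [WD_add c (contDiff_mul_vec (contDiff_waveCos b) _)
      (contDiff_mul_vec (contDiff_waveSin b) _), WD_mul_vec c (contDiff_waveCos b),
      WD_mul_vec c (contDiff_waveSin b), WD_waveCos, WD_waveSin]
  have h2 := WD_sum Finset.univ c (u := fun b p => waveCos b p • baseVec f (.inr (b, 0)) +
      waveSin b p • baseVec f (.inr (b, 1))) fun b _ =>
      (contDiff_mul_vec (contDiff_waveCos b) _).add (contDiff_mul_vec (contDiff_waveSin b) _)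
  refine h2.trans ?_
  funext p
  simp only [h]
  cases c <;> simp

lemma WD_WD_circles (f : I ⊕ J → Fin 29) (b c : Bool) : WD c (WD b (circles f)) = fun p =>
    (if c = b then -1 else 0 : ℝ) •
      (waveCos b p • baseVec f (.inr (b, 0)) + waveSin b p • baseVec f (.inr (b, 1))) := by
  rw [WD_circles]
  have hs : ContDiff ℝ (⊤ : ℕ∞) fun p => -waveSin b p := (contDiff_waveSin b).neg
  rw [WD_add c (contDiff_mul_vec hs _) (contDiff_mul_vec (contDiff_waveCos b) _),
    WD_mul_vec c hs, WD_mul_vec c (contDiff_waveCos b), WD_waveCos]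
  have : WD c (fun p => -waveSin b p) = fun p => -WD c (waveSin b) p := by
    simpa using WD_const_smul c (-1) (contDiff_waveSin b)
  rw [this, WD_waveSin]
  funext p
  split_ifs <;> simp

lemma frameT_circles (f : I ⊕ J → Fin 29) (b : Bool) (p : H) :
    frameT (circles f) 1 (b, 0) p =
      waveCos b p • baseVec f (.inr (b, 0)) + waveSin b p • baseVec f (.inr (b, 1)) ∧
    frameT (circles f) 1 (b, 1) p =
      -waveSin b p • baseVec f (.inr (b, 0)) + waveCos b p • baseVec f (.inr (b, 1)) := by
  constructor
  · simp [frameT, WD_WD_circles, add_comm]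
  · simp [frameT, WD_circles]

lemma exists_good (r : ℝ) (hr : 0 ≤ r) : ∃ M₀, ∀ δE δ M, 0 ≤ δE → 0 ≤ δ → M₀ ≤ M →
    ∃ E ψ, Good δE δ r M E ψ 1 := by
  obtain ⟨K, h1K, hK⟩ := exists_bdd_amp hr
  obtain ⟨f, hf⟩ : ∃ f : I ⊕ J → Fin 29, Function.Injective f :=
    ⟨_, (Function.Embedding.nonempty_of_card_le
      (by decide : Fintype.card (I ⊕ J) ≤ Fintype.card (Fin 29))).some.injective⟩
  refine ⟨K * 1 + K * 1, fun δE δ M hE hδ hM => ⟨fun i _ => baseVec f (.inl i), circles f, ?_⟩⟩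
  have hc : ∀ b, Bdd r K (waveCos b) := fun b => hK 0 le_rfl zero_le_one (.inr (b, 0))
  have hs : ∀ b, Bdd r K (waveSin b) := fun b => hK 0 le_rfl zero_le_one (.inr (b, 1))
  have hs' : ∀ b, Bdd r K (fun p => -waveSin b p) := fun b => by
    simpa using (hs b).const_mul hr (-1)
  have hv : ∀ k, VBdd r 1 (fun _ => baseVec f k) := fun k => VBdd.const r (norm_baseVec f k)
  have h0 : ∀ b, VBdd r M (fun p => waveCos b p • baseVec f (.inr (b, 0)) +
      waveSin b p • baseVec f (.inr (b, 1))) := fun b =>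
    (((hv _).smul hr (hc b)).add ((hv _).smul hr (hs b))).le hr hM
  have h1 : ∀ b, VBdd r M (fun p => -waveSin b p • baseVec f (.inr (b, 0)) +
      waveCos b p • baseVec f (.inr (b, 1))) := fun b =>
    (((hv _).smul hr (hs' b)).add ((hv _).smul hr (hc b))).le hr hM
  have hJ : ∀ j : J, ∃ b, j = (b, 0) ∨ j = (b, 1) := by
    rintro ⟨b, k⟩
    fin_cases k <;> exact ⟨b, by simp⟩
  have hM1 : 1 ≤ M := by linarith
  refine ⟨le_rfl, contDiff_circles f, fun i => (hv _).le hr hM1, fun j => ?_, fun b c => ?_,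
    fun i j p => ?_, fun p i j => ?_, fun p j k => ?_⟩
  · obtain ⟨b, rfl | rfl⟩ := hJ j
    · exact (funext fun p => (frameT_circles f b p).1 : frameT (circles f) 1 (b, 0) = _) ▸ h0 b
    · exact (funext fun p => (frameT_circles f b p).2 : frameT (circles f) 1 (b, 1) = _) ▸ h1 b
  · rw [WD_WD_circles]
    simpa using (h0 b).const_smul hr (c := if c = b then -1 else 0) (N := 1)
      (by split_ifs <;> simp)
  · obtain ⟨b, rfl | rfl⟩ := hJ j
    · rw [(frameT_circles f b p).1]
      simp [inner_add_right, inner_smul_right, inner_baseVec hf]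
    · rw [(frameT_circles f b p).2]
      simp [inner_add_right, inner_smul_right, inner_baseVec hf]
  · simp [inner_baseVec hf, Matrix.one_apply, hE]
  · have key : ⟪frameT (circles f) 1 j p, frameT (circles f) 1 k p⟫ = (1 : Matrix J J ℝ) j k := by
      obtain ⟨b, rfl | rfl⟩ := hJ j <;> obtain ⟨c, rfl | rfl⟩ := hJ k <;>
      simp only [(frameT_circles f _ p).1, (frameT_circles f _ p).2, inner_add_right,
        inner_add_left, real_inner_smul_right, real_inner_smul_left, inner_baseVec hf,
        Matrix.one_apply] <;>
      by_cases h : b = c <;> simp [h] <;> nlinarith [waveCos_sq_add_waveSin_sq c p]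
    simpa [key] using hδ

end Initial

end Heisenberg

namespace Heisenberg

section Metric

lemma exists_applyFlows (p q : H) : ∃ l, applyFlows l p = q := by
  refine ⟨[(false, q.2.1), (true, q.1 - p.1 - (q.2.2 - p.2.2)), (false, -1),
    (true, q.2.2 - p.2.2), (false, 1 - p.2.1)], ?_⟩
  ext <;> simp [applyFlows, flow, flowX, flowY]

lemma ccDist_nonneg (p q : H) : 0 ≤ ccDist p q := by
  refine Real.sInf_nonneg ?_
  rintro s ⟨l, -, rfl⟩
  refine List.sum_nonneg fun x hx => ?_
  obtain ⟨wt, -, rfl⟩ := List.mem_map.1 hx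
  exact abs_nonneg _

lemma hasDerivAt_flow (b : Bool) (p : H) (t : ℝ) :
    HasDerivAt (fun t => flow b t p) (dir b (flow b t p)) t := by
  have h := hasDerivAt_id t
  cases b
  · have := (hasDerivAt_const t p.1).prodMk
      ((h.const_add p.2.1).prodMk (hasDerivAt_const t p.2.2))
    simpa [flow, flowY, dir] using this
  · have := (h.const_add p.1).prodMk
      ((hasDerivAt_const t p.2.1).prodMk ((h.mul_const p.2.1).const_add p.2.2))
    simpa [flow, flowX, dir] using this

variable {F : Type*} [NormedAddCommGroup F] [NormedSpace ℝ F] {u : H → F} {L : ℝ}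

lemma norm_flow_sub_le (hu : ContDiff ℝ (⊤ : ℕ∞) u) (hL : ∀ b p, ‖WD b u p‖ ≤ L) (b : Bool)
    (t : ℝ) (p : H) : ‖u (flow b t p) - u p‖ ≤ L * |t| := by
  have hd : ∀ t, HasDerivAt (fun t => u (flow b t p)) (WD b u (flow b t p)) t := fun t => by
    rw [WD_apply]
    exact (contDiff_differentiableAt hu _).hasFDerivAt.comp_hasDerivAt t (hasDerivAt_flow b p t)
  have := Convex.norm_image_sub_le_of_norm_hasDerivWithin_le (s := Set.univ)
    (fun t _ => (hd t).hasDerivWithinAt) (fun t _ => hL b (flow b t p)) convex_univ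
    (Set.mem_univ 0) (Set.mem_univ t)
  have h0 : flow b 0 p = p := by cases b <;> simp [flow, flowX, flowY]
  simpa [h0] using this

lemma norm_applyFlows_sub_le (hu : ContDiff ℝ (⊤ : ℕ∞) u) (hL : ∀ b p, ‖WD b u p‖ ≤ L) (p : H)
    (l : List (Bool × ℝ)) :
    ‖u (applyFlows l p) - u p‖ ≤ L * (l.map fun wt => |wt.2|).sum := by
  induction l with
  | nil => simp [applyFlows]
  | cons wt l ih =>
    have h := norm_flow_sub_le hu hL wt.1 wt.2 (applyFlows l p)
    have h3 := norm_sub_le_norm_sub_add_norm_sub (u (applyFlows (wt :: l) p))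
      (u (applyFlows l p)) (u p)
    simp only [applyFlows] at h3 ⊢
    rw [List.map_cons, List.sum_cons, mul_add]
    linarith

lemma norm_sub_le_mul_ccDist (hu : ContDiff ℝ (⊤ : ℕ∞) u) (hL0 : 0 ≤ L)
    (hL : ∀ b p, ‖WD b u p‖ ≤ L) (p q : H) : ‖u p - u q‖ ≤ L * ccDist p q := by
  rcases hL0.eq_or_lt with rfl | hpos
  · obtain ⟨l, rfl⟩ := exists_applyFlows p q
    have := norm_applyFlows_sub_le hu hL p l
    rw [norm_sub_rev]
    simpa using this
  · rw [← div_le_iff₀' hpos]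
    obtain ⟨l, hl⟩ := exists_applyFlows p q
    refine le_csInf ⟨_, l, hl, rfl⟩ ?_
    rintro s ⟨l, rfl, rfl⟩
    rw [div_le_iff₀' hpos, norm_sub_rev]
    exact norm_applyFlows_sub_le hu hL p l

lemma norm_sub_le_mul_rpow (hu : ContDiff ℝ (⊤ : ℕ∞) u) {B R α : ℝ} (hR : 0 < R) (hα : 0 < α)
    (hα1 : α ≤ 1) (hB : ∀ p, ‖u p‖ ≤ B) (hL : ∀ b p, ‖WD b u p‖ ≤ B / R) (p q : H) :
    ‖u p - u q‖ ≤ 2 * B * (R ^ α)⁻¹ * ccDist p q ^ α := by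
  have hB0 : 0 ≤ B := (norm_nonneg _).trans (hB p)
  have hd := ccDist_nonneg p q
  have e : (R ^ α)⁻¹ * ccDist p q ^ α = (ccDist p q / R) ^ α := by
    rw [Real.div_rpow hd hR.le, div_eq_mul_inv, mul_comm]
  rw [mul_assoc, e]
  rcases le_total (ccDist p q / R) 1 with h | h
  · have h1 := Real.rpow_le_rpow_of_exponent_ge' (div_nonneg hd hR.le) h hα.le hα1
    rw [Real.rpow_one] at h1
    have h2 := norm_sub_le_mul_ccDist hu (div_nonneg hB0 hR.le) hL p q
    have h3 : B / R * ccDist p q = B * (ccDist p q / R) := by ring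
    have h4 : 0 ≤ ccDist p q / R := div_nonneg hd hR.le
    nlinarith [mul_le_mul_of_nonneg_left h1 hB0]
  · have h1 := Real.one_le_rpow h hα.le
    have h2 := norm_sub_le (u p) (u q)
    nlinarith [hB p, hB q, mul_le_mul_of_nonneg_left h1 hB0]

end Metric

section Norms

lemma sqrt_sum_words_le {F : Type*} [NormedAddCommGroup F] (n : ℕ) {g : List Bool → F} {x : ℝ} (hx : 0 ≤ x)
    (h : ∀ l : List Bool, l.length = n → ‖g l‖ ≤ x) :
    Real.sqrt (∑ w : Fin n → Bool, ‖g (List.ofFn w)‖ ^ 2) ≤ 2 ^ n * x := by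
  refine Real.sqrt_le_iff.2 ⟨by positivity, ?_⟩
  calc ∑ w : Fin n → Bool, ‖g (List.ofFn w)‖ ^ 2 ≤ ∑ _w : Fin n → Bool, x ^ 2 :=
        Finset.sum_le_sum fun w _ => pow_le_pow_left₀ (norm_nonneg _) (h _ (by simp)) 2
    _ = 2 ^ n * x ^ 2 := by simp
    _ ≤ (2 ^ n * x) ^ 2 := by
        rw [mul_pow]
        exact mul_le_mul_of_nonneg_right (le_self_pow₀ (one_le_pow₀ (by norm_num)) (by norm_num))
          (sq_nonneg x)

variable {F : Type*} [NormedAddCommGroup F] [NormedSpace ℝ F] {f : H → F} {R B : ℝ}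

lemma CkRS_le {m k : ℕ} (hR : 0 < R) (hB : 0 ≤ B)
    (h : ∀ l : List Bool, m ≤ l.length → l.length ≤ m + k → ∀ p,
      ‖l.foldr WD f p‖ ≤ R * (R ^ l.length)⁻¹ * B) :
    CkRS m k R f ≤ ENNReal.ofReal ((k + 1) * 2 ^ (m + k) * (R * (R ^ m)⁻¹ * B)) := by
  have key : ∀ j ∈ Finset.range (k + 1),
      ENNReal.ofReal (R ^ j) * ⨆ p : H, ENNReal.ofReal (gradNorm (m + j) f p) ≤
        ENNReal.ofReal (2 ^ (m + k) * (R * (R ^ m)⁻¹ * B)) := by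
    intro j hj
    have hjk : j ≤ k := Nat.lt_succ_iff.1 (Finset.mem_range.1 hj)
    have h1 : ∀ p, gradNorm (m + j) f p ≤ 2 ^ (m + k) * (R * (R ^ (m + j))⁻¹ * B) := by
      intro p
      refine (sqrt_sum_words_le (m + j) (g := fun l => l.foldr WD f p)
        (x := R * (R ^ (m + j))⁻¹ * B) (by positivity) fun l hl => ?_).trans ?_
      · have := h l (by omega) (by omega) p
        rwa [hl] at this
      · exact mul_le_mul_of_nonneg_right (pow_le_pow_right₀ (by norm_num) (by omega))
          (by positivity)
    calc _ ≤ ENNReal.ofReal (R ^ j) *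
          ENNReal.ofReal (2 ^ (m + k) * (R * (R ^ (m + j))⁻¹ * B)) :=
          mul_le_mul_right (iSup_le fun p => ENNReal.ofReal_le_ofReal (h1 p)) _
      _ = _ := by
          rw [← ENNReal.ofReal_mul (by positivity), pow_add R]
          congr 1
          field_simp
  refine (Finset.sum_le_card_nsmul _ _ _ key).trans ?_
  rw [Finset.card_range, nsmul_eq_mul, ← ENNReal.ofReal_natCast,
    ← ENNReal.ofReal_mul (by positivity), Nat.cast_succ, mul_assoc ((k : ℝ) + 1)]

lemma gradHolderS_le {m : ℕ} {α : ℝ} (hf : ContDiff ℝ (⊤ : ℕ∞) f) (hR : 0 < R) (hB : 0 ≤ B)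
    (hα : 0 < α) (hα1 : α ≤ 1)
    (h : ∀ l : List Bool, m ≤ l.length → l.length ≤ m + 1 → ∀ p,
      ‖l.foldr WD f p‖ ≤ R * (R ^ l.length)⁻¹ * B) :
    gradHolderS m α f ≤ ENNReal.ofReal (2 ^ m * (2 * (R * (R ^ m)⁻¹ * B) * (R ^ α)⁻¹)) := by
  refine iSup_le fun p => iSup_le fun q => iSup_le fun _ => ?_
  refine ENNReal.div_le_of_le_mul ?_
  rw [← ENNReal.ofReal_mul (by positivity), mul_assoc]
  refine ENNReal.ofReal_le_ofReal ?_
  have hd := ccDist_nonneg p q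
  refine sqrt_sum_words_le m (g := fun l => l.foldr WD f p - l.foldr WD f q)
    (by positivity) fun l hl => ?_
  refine norm_sub_le_mul_rpow (contDiff_foldr_WD hf l) hR hα hα1 (fun p => ?_) (fun b p => ?_) p q
  · have := h l hl.ge (by omega) p
    rwa [hl] at this
  · have := h (b :: l) (by simp; omega) (by simp; omega) p
    rw [List.foldr_cons, List.length_cons, hl, pow_succ] at this
    refine this.trans_eq ?_
    field_simp

lemma CkAS_le {m k : ℕ} {α : ℝ} (hf : ContDiff ℝ (⊤ : ℕ∞) f) (hR : 0 < R) (hB : 0 ≤ B)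
    (hα : 0 < α) (hα1 : α ≤ 1)
    (h : ∀ l : List Bool, m ≤ l.length → l.length ≤ m + k + 1 → ∀ p,
      ‖l.foldr WD f p‖ ≤ R * (R ^ l.length)⁻¹ * B) :
    CkAS m k α R f ≤ ENNReal.ofReal ((k + 3) * 2 ^ (m + k) * (R * (R ^ m)⁻¹ * B)) := by
  have h1 := CkRS_le (m := m) (k := k) hR hB fun l h1 h2 => h l h1 (by omega)
  have h2 := gradHolderS_le (m := m + k) hf hR hB hα hα1 fun l h1 h2 => h l (by omega) (by omega)
  refine (add_le_add h1 (mul_le_mul_right h2 _)).trans_eq ?_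
  rw [← ENNReal.ofReal_mul (by positivity), ← ENNReal.ofReal_add (by positivity) (by positivity)]
  congr 1
  rw [Real.rpow_add hR, Real.rpow_natCast, pow_add R]
  have : R ^ α ≠ 0 := (Real.rpow_pos_of_pos hR α).ne'
  field_simp
  ring

end Norms

end Heisenberg

namespace Heisenberg

section Tower

/-- A sequence of oscillations `Φ k` together with their superpositions `Ψ k`, each at unit
scale. -/
structure IsTower (K κ a A : ℝ) (Φ Ψ : ℕ → H → V) : Prop where
  contDiff : ∀ k, ContDiff ℝ (⊤ : ℕ∞) (Ψ k)
  bdd : ∀ k, VBdd (2 ^ 20) K (Φ k)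
  bddWW : ∀ k b c, VBdd (2 ^ 20) K (WD c (WD b (Ψ k)))
  zero_eq : ∀ p, Ψ 0 p = Φ 0 p
  succ_eq : ∀ k p, Ψ (k + 1) p = Φ (k + 1) p + a • slowMap A (Ψ k) p
  inner_eq_zero : ∀ k b p, ⟪WD b (Φ (k + 1)) p, WD b (slowMap A (Ψ k)) p⟫ = 0
  half_le : ∀ k b p, 1 / 2 ≤ ‖WD b (Φ k) p‖
  wedge_pair : ∀ k p, κ * (‖XD (Ψ k) p‖ * ‖YD (Ψ k) p‖) ≤ wedgeNorm ![XD (Ψ k) p, YD (Ψ k) p]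
  wedge_sextuple : ∀ k p, κ * (‖XD (Ψ k) p‖ * ‖YD (Ψ k) p‖) ≤
    wedgeNorm ![XD (Ψ k) p, YD (Ψ k) p, ZD (Ψ k) p, XD (XD (Ψ k)) p, YD (YD (Ψ k)) p,
      XD (YD (Ψ k)) p]

theorem exists_isTower : ∃ K κ A₀ : ℝ, 0 ≤ K ∧ 0 < κ ∧ 1 ≤ A₀ ∧ ∀ A, A₀ ≤ A →
    ∀ a, 0 ≤ a → a ≤ 1 → ∃ Φ Ψ, IsTower K κ a A Φ Ψ := by
  obtain ⟨M₀, hM₀⟩ := exists_good (2 ^ 20) (by norm_num)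
  obtain ⟨δE, δ, M, K, κ, A₀, hδE, hδ, hM, hMM, hκ, hA₀, hstep⟩ :=
    exists_step (2 ^ 20) M₀ (by norm_num)
  obtain ⟨E₀, ψ₀, h₀⟩ := hM₀ δE δ M hδE hδ hMM
  refine ⟨max M K, κ, A₀, le_max_of_le_left (by linarith), hκ, hA₀, fun A hA a ha0 ha1 => ?_⟩
  let S := {x : (I → H → V) × (H → V) × ℝ // Good δE δ (2 ^ 20) M x.1 x.2.1 x.2.2}
  have hnext : ∀ a, 0 ≤ a → a ≤ 1 → ∀ x : S, ∃ φ, ∃ y : S,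
      IsStep (2 ^ 20) K κ a A φ x.1.2.1 y.1.2.1 := by
    rintro a ha0 ha1 ⟨⟨E, ψ, s⟩, hx⟩
    obtain ⟨φ, E', ψ', s', hg, hs⟩ := hstep A hA a ha0 ha1 E ψ s hx
    exact ⟨φ, ⟨⟨E', ψ', s'⟩, hg⟩, hs⟩
  obtain ⟨φ₀, y₀, hy₀⟩ := hnext 0 le_rfl zero_le_one ⟨⟨E₀, ψ₀, 1⟩, h₀⟩
  choose φ' y' hy' using hnext a ha0 ha1
  let y : ℕ → S := fun k => Nat.rec y₀ (fun _ x => y' x) k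
  let Φ : ℕ → H → V := fun k => Nat.casesOn k φ₀ fun k => φ' (y k)
  have hs : ∀ k, ∃ a ψ, IsStep (2 ^ 20) K κ a A (Φ k) ψ (y k).1.2.1 := by
    rintro (_ | k)
    · exact ⟨_, _, hy₀⟩
    · exact ⟨_, _, hy' (y k)⟩
  refine ⟨Φ, fun k => (y k).1.2.1, ⟨fun k => (y k).2.contDiff, fun k => ?_, fun k b c => ?_,
    fun p => ?_, fun k p => (hy' (y k)).eq_add p, fun k => (hy' (y k)).inner_eq_zero,
    fun k => ?_, fun k => ?_, fun k => ?_⟩⟩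
  · obtain ⟨_, _, h⟩ := hs k
    exact h.bdd.mono (by norm_num) (by norm_num) (le_max_right _ _)
  · exact ((y k).2.bddWW b c).le (by norm_num) (le_max_left _ _)
  · have h := hy₀.eq_add p
    rw [zero_smul, add_zero] at h
    exact h
  · obtain ⟨_, _, h⟩ := hs k
    exact h.half_le
  · obtain ⟨_, _, h⟩ := hs k
    exact h.wedge_pair
  · obtain ⟨_, _, h⟩ := hs k
    exact h.wedge_sextuple

end Tower

section Rescaling

lemma slowMap_slowMap (R A : ℝ) (u : H → V) : slowMap R (slowMap A u) = slowMap (R * A) u := by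
  funext p
  simp only [slowMap, dilate, smul_smul]
  congr 2
  ext <;> simp only [mul_inv] <;> ring

variable {R K : ℝ} {u : H → V}

lemma foldr_WD_slowMap (hu : ContDiff ℝ (⊤ : ℕ∞) u) (l : List Bool) (p : H) :
    l.foldr WD (slowMap R u) p = (R * (R ^ l.length)⁻¹) • l.foldr WD u (dilate R⁻¹ p) := by
  have h := foldr_WD_const_smul R (contDiff_slow hu R⁻¹) l
  rw [foldr_WD_dilate R⁻¹ hu l] at h
  refine (congrFun h p).trans ?_
  simp [smul_smul]

lemma VBdd.foldr_WD (l : List Bool) (n : ℕ) (hu : VBdd (2 ^ (n + l.length)) K u) :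
    VBdd (2 ^ n) K (l.foldr Heisenberg.WD u) := by
  induction l generalizing n with
  | nil => exact hu
  | cons b l ih =>
    refine VBdd.WD b (one_le_pow₀ (by norm_num)) ?_
    rw [← pow_succ']
    refine ih (n + 1) ?_
    rwa [add_assoc, add_comm 1 l.length]

lemma norm_foldr_WD_le {N : ℕ} (hu : VBdd (2 ^ N) K u) (l : List Bool) (hl : l.length ≤ N) (p : H) :
    ‖l.foldr WD u p‖ ≤ 29 * K := by
  refine (VBdd.foldr_WD l (N - l.length) ?_).norm_le (by positivity) p
  rwa [Nat.sub_add_cancel hl]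

lemma norm_foldr_WD_slowMap_le {N : ℕ} (hu : VBdd (2 ^ N) K u) (hR : 0 < R) (l : List Bool)
    (hl : l.length ≤ N) (p : H) :
    ‖l.foldr WD (slowMap R u) p‖ ≤ R * (R ^ l.length)⁻¹ * (29 * K) := by
  rw [foldr_WD_slowMap hu.contDiff, norm_smul, Real.norm_of_nonneg (by positivity)]
  exact mul_le_mul_of_nonneg_left (norm_foldr_WD_le hu l hl _) (by positivity)

lemma norm_foldr_WD_slowMap_le_of_hessian {N : ℕ} (hu : ContDiff ℝ (⊤ : ℕ∞) u)
    (hWW : ∀ b c, VBdd (2 ^ N) K (WD c (WD b u))) (hR : 0 < R) (l : List Bool)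
    (hl2 : 2 ≤ l.length) (hl : l.length ≤ N + 2) (p : H) :
    ‖l.foldr WD (slowMap R u) p‖ ≤ R * (R ^ l.length)⁻¹ * (29 * K) := by
  rw [foldr_WD_slowMap hu, norm_smul, Real.norm_of_nonneg (by positivity)]
  refine mul_le_mul_of_nonneg_left ?_ (by positivity)
  obtain ⟨c, b, hcb⟩ := List.length_eq_two.1
    (show (l.drop (l.length - 2)).length = 2 by rw [List.length_drop]; omega)
  rw [← List.take_append_drop (l.length - 2) l, hcb, List.foldr_append]
  exact norm_foldr_WD_le (hWW b c) _ (by rw [List.length_take]; omega) _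

end Rescaling

end Heisenberg

namespace Heisenberg

section Assembly

variable {K κ ε A : ℝ} {N₂ : ℤ} {Φ Ψ : ℕ → H → V}

/-- The oscillation at scale `A ^ n`. -/
def scaleMap (A : ℝ) (N₂ : ℤ) (Φ : ℕ → H → V) (n : ℤ) : H → V :=
  slowMap (A ^ n) (Φ (N₂ - n).toNat)

lemma phiGe_eq_add (hA : 0 < A) (φ : ℤ → H → V) {n : ℤ} (hn : n ≤ N₂) (p : H) :
    phiGe A ε N₂ φ n p = φ n p + A ^ (-ε) • phiGe A ε N₂ φ (n + 1) p := by
  have h : Finset.Icc n N₂ = insert n (Finset.Icc (n + 1) N₂) := by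
    ext m
    simp only [Finset.mem_Icc, Finset.mem_insert]
    omega
  rw [phiGe, h, Finset.sum_insert (by simp), phiGe, Finset.smul_sum]
  congr 1
  · simp
  · refine Finset.sum_congr rfl fun m _ => ?_
    rw [smul_smul, ← Real.rpow_add hA]
    congr 2
    push_cast
    ring

lemma sum_Ioc_eq (hA : 0 < A) (φ : ℤ → H → V) {n : ℤ} (p : H) :
    ∑ m ∈ Finset.Ioc n N₂, A ^ (-(ε * ((m : ℝ) - (n : ℝ)))) • φ m p =
      A ^ (-ε) • phiGe A ε N₂ φ (n + 1) p := by
  have h : Finset.Ioc n N₂ = Finset.Icc (n + 1) N₂ := by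
    ext m
    simp only [Finset.mem_Icc, Finset.mem_Ioc]
    omega
  rw [h, phiGe, Finset.smul_sum]
  refine Finset.sum_congr rfl fun m _ => ?_
  rw [smul_smul, ← Real.rpow_add hA]
  congr 2
  push_cast
  ring

lemma phiGe_scaleMap_sub (hA : 0 < A) (h : IsTower K κ (A ^ (-ε)) A Φ Ψ) (k : ℕ) :
    phiGe A ε N₂ (scaleMap A N₂ Φ) (N₂ - k) = slowMap (A ^ (N₂ - k)) (Ψ k) := by
  induction k with
  | zero =>
    funext p
    simp [phiGe, scaleMap, slowMap, h.zero_eq]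
  | succ k ih =>
    funext p
    have e : N₂ - ((k + 1 : ℕ) : ℤ) + 1 = N₂ - k := by push_cast; ring
    rw [phiGe_eq_add hA _ (by omega), e, ih]
    have e2 : A ^ (N₂ - k) = A ^ (N₂ - ((k + 1 : ℕ) : ℤ)) * A := by
      rw [← e, zpow_add_one₀ hA.ne']
    rw [e2, ← slowMap_slowMap]
    simp only [scaleMap, slowMap, sub_sub_cancel, Int.toNat_natCast, h.succ_eq, smul_add]
    rw [smul_comm]

lemma phiGe_scaleMap (hA : 0 < A) (h : IsTower K κ (A ^ (-ε)) A Φ Ψ) {n : ℤ} (hn : n ≤ N₂) :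
    phiGe A ε N₂ (scaleMap A N₂ Φ) n = slowMap (A ^ n) (Ψ (N₂ - n).toNat) := by
  have := phiGe_scaleMap_sub hA h (N₂ := N₂) (N₂ - n).toNat
  rwa [Int.toNat_of_nonneg (by omega), sub_sub_cancel] at this

lemma contDiff_scaleMap {a : ℝ} (h : IsTower K κ a A Φ Ψ) (n : ℤ) :
    ContDiff ℝ (⊤ : ℕ∞) (scaleMap A N₂ Φ n) := contDiff_slowMap (h.bdd _).contDiff _

lemma sum_inner_scaleMap_eq_zero (hA : 0 < A) (h : IsTower K κ (A ^ (-ε)) A Φ Ψ) {n : ℤ}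
    (b : Bool) (p : H) :
    ∑ m ∈ Finset.Ioc n N₂, A ^ (-(ε * ((m : ℝ) - (n : ℝ)))) *
      ⟪WD b (scaleMap A N₂ Φ n) p, WD b (scaleMap A N₂ Φ m) p⟫ = 0 := by
  rcases lt_or_ge n N₂ with hn | hn
  swap
  · simp [Finset.Ioc_eq_empty_of_le hn]
  have hc := fun m => contDiff_scaleMap (N₂ := N₂) h m
  have hsum : WD b (fun p => ∑ m ∈ Finset.Ioc n N₂, A ^ (-(ε * ((m : ℝ) - (n : ℝ)))) •
      scaleMap A N₂ Φ m p) = fun p => ∑ m ∈ Finset.Ioc n N₂,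
        A ^ (-(ε * ((m : ℝ) - (n : ℝ)))) • WD b (scaleMap A N₂ Φ m) p := by
    rw [WD_sum _ b fun m _ => (hc m).const_smul _]
    funext p
    exact Finset.sum_congr rfl fun m _ => congrFun (WD_const_smul b _ (hc m)) p
  have e : (fun p => ∑ m ∈ Finset.Ioc n N₂, A ^ (-(ε * ((m : ℝ) - (n : ℝ)))) •
      scaleMap A N₂ Φ m p) = fun p => A ^ (-ε) • slowMap (A ^ n)
        (slowMap A (Ψ (N₂ - (n + 1)).toNat)) p := by
    funext p
    rw [sum_Ioc_eq hA, phiGe_scaleMap hA h (by omega), slowMap_slowMap, zpow_add_one₀ hA.ne']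
  have hs := contDiff_slowMap (h.contDiff (N₂ - (n + 1)).toNat) A
  have hAn : A ^ n ≠ 0 := (zpow_pos hA n).ne'
  rw [e, WD_const_smul b _ (contDiff_slowMap hs _), WD_slowMap hs hAn] at hsum
  have hk : (N₂ - n).toNat = (N₂ - (n + 1)).toNat + 1 := by omega
  simp_rw [← real_inner_smul_right]
  rw [← inner_sum, ← congrFun hsum p, scaleMap, WD_slowMap (h.bdd _).contDiff hAn, hk,
    real_inner_smul_right, h.inner_eq_zero, mul_zero]

lemma half_le_norm_WD_scaleMap {a : ℝ} (hA : 0 < A) (h : IsTower K κ a A Φ Ψ) (n : ℤ) (b : Bool)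
    (p : H) : 1 / 2 ≤ ‖WD b (scaleMap A N₂ Φ n) p‖ := by
  rw [scaleMap, WD_slowMap (h.bdd _).contDiff (zpow_pos hA n).ne']
  exact h.half_le _ _ _

variable {R : ℝ} {u : H → V}

lemma wedge_pair_slowMap (hu : ContDiff ℝ (⊤ : ℕ∞) u) (hR : 0 < R)
    (h : ∀ p, κ * (‖XD u p‖ * ‖YD u p‖) ≤ wedgeNorm ![XD u p, YD u p]) (p : H) :
    κ * (‖XD (slowMap R u) p‖ * ‖YD (slowMap R u) p‖) ≤
      wedgeNorm ![XD (slowMap R u) p, YD (slowMap R u) p] := by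
  have hX : XD (slowMap R u) = _ := WD_slowMap hu hR.ne' true
  have hY : YD (slowMap R u) = _ := WD_slowMap hu hR.ne' false
  rw [hX, hY]
  exact h _

lemma wedge_sextuple_slowMap (hu : ContDiff ℝ (⊤ : ℕ∞) u) (hR : 0 < R)
    (h : ∀ p, κ * (‖XD u p‖ * ‖YD u p‖) ≤
      wedgeNorm ![XD u p, YD u p, ZD u p, XD (XD u) p, YD (YD u) p, XD (YD u) p]) (p : H) :
    κ * (R ^ 4)⁻¹ * (‖XD (slowMap R u) p‖ * ‖YD (slowMap R u) p‖) ≤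
      wedgeNorm ![XD (slowMap R u) p, YD (slowMap R u) p, ZD (slowMap R u) p,
        XD (XD (slowMap R u)) p, YD (YD (slowMap R u)) p, XD (YD (slowMap R u)) p] := by
  have hX : XD (slowMap R u) = _ := WD_slowMap hu hR.ne' true
  have hY : YD (slowMap R u) = _ := WD_slowMap hu hR.ne' false
  have hXX : XD (XD (slowMap R u)) = _ := WD_WD_slowMap hu hR.ne' true true
  have hYX : YD (XD (slowMap R u)) = _ := WD_WD_slowMap hu hR.ne' true false
  have hYY : YD (YD (slowMap R u)) = _ := WD_WD_slowMap hu hR.ne' false false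
  have hXY : XD (YD (slowMap R u)) = _ := WD_WD_slowMap hu hR.ne' false true
  have hZ : ZD (slowMap R u) p = R⁻¹ • ZD u (dilate R⁻¹ p) := by
    rw [ZD_eq (contDiff_slowMap hu R), ZD_eq hu]
    simp only [WD]
    rw [hYX, hXY, ← smul_sub]
    rfl
  have hs := wedgeNorm_smul ![1, 1, R⁻¹, R⁻¹, R⁻¹, R⁻¹] ![WD true u (dilate R⁻¹ p),
    WD false u (dilate R⁻¹ p), ZD u (dilate R⁻¹ p), WD true (WD true u) (dilate R⁻¹ p),
    WD false (WD false u) (dilate R⁻¹ p), WD true (WD false u) (dilate R⁻¹ p)]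
  have hv : ![XD (slowMap R u) p, YD (slowMap R u) p, ZD (slowMap R u) p,
      XD (XD (slowMap R u)) p, YD (YD (slowMap R u)) p, XD (YD (slowMap R u)) p] = fun i =>
      ![1, 1, R⁻¹, R⁻¹, R⁻¹, R⁻¹] i • ![WD true u (dilate R⁻¹ p),
      WD false u (dilate R⁻¹ p), ZD u (dilate R⁻¹ p), WD true (WD true u) (dilate R⁻¹ p),
      WD false (WD false u) (dilate R⁻¹ p), WD true (WD false u) (dilate R⁻¹ p)] i := by
    rw [hXX, hYY, hXY, hX, hY, hZ]
    funext i
    fin_cases i <;> simp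
  rw [hv, hs]
  have hp : |∏ i, (![1, 1, R⁻¹, R⁻¹, R⁻¹, R⁻¹] : Fin 6 → ℝ) i| = (R ^ 4)⁻¹ := by
    rw [abs_of_nonneg (Finset.prod_nonneg fun i _ => by fin_cases i <;> simp [hR.le])]
    simp [Fin.prod_univ_succ]
    field_simp
  rw [hp, hX, hY, mul_comm κ, mul_assoc]
  exact mul_le_mul_of_nonneg_left (h (dilate R⁻¹ p)) (by positivity)

lemma rpow_neg_le {C k : ℝ} (hκ : 0 < κ) (hC : 1 ≤ C) (hκC : κ⁻¹ ≤ C) (hk : 1 ≤ k) :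
    C ^ (-k) ≤ κ := by
  calc C ^ (-k) ≤ C ^ (-1 : ℝ) := Real.rpow_le_rpow_of_exponent_le hC (by linarith)
    _ = C⁻¹ := Real.rpow_neg_one C
    _ ≤ κ := inv_le_of_inv_le₀ hκ hκC

end Assembly

end Heisenberg

/-- **The iteration claim** (Claim 4.4 of the paper). -/
theorem statement4 :
    ∀ α : ℝ, 0 < α → α < 1 →
      ∃ C₀' : ℝ, 1 < C₀' ∧
        ∀ C₀ : ℝ, C₀' ≤ C₀ →
          ∃ A₀ : ℝ, 1 ≤ A₀ ∧
            ∀ A : ℝ, IsDyadic A → A₀ ≤ A →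
              ∀ ε : ℝ, 0 < ε → ε ≤ 1 / A →
                ∀ N₁ N₂ : ℤ, N₁ ≤ N₂ →
                  ∃ φ : ℤ → H → EuclideanSpace ℝ (Fin 29),
                    (∀ n : ℤ, ContDiff ℝ (⊤ : ℕ∞) (φ n)) ∧
                    -- (a) smoothness at scale `A^n`
                    (∀ n : ℤ, N₁ ≤ n → n ≤ N₂ →
                      CkR 20 (A ^ (n : ℝ)) (φ n) ≤ ENNReal.ofReal (C₀ * A ^ (n : ℝ))) ∧
                    CkAS 2 18 α (A ^ (N₁ : ℝ)) (Heisenberg.phiGe A ε N₂ φ N₁) ≤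
                      ENNReal.ofReal (C₀ * A ^ (-(N₁ : ℝ))) ∧
                    -- (b) orthogonality
                    (∀ n : ℤ, N₁ ≤ n → n ≤ N₂ → ∀ p : H,
                      (∑ n' ∈ Finset.Ioc n N₂,
                        A ^ (-(ε * ((n' : ℝ) - (n : ℝ)))) * ⟪XD (φ n) p, XD (φ n') p⟫) = 0 ∧
                      (∑ n' ∈ Finset.Ioc n N₂,
                        A ^ (-(ε * ((n' : ℝ) - (n : ℝ)))) * ⟪YD (φ n) p, YD (φ n') p⟫) = 0) ∧
                    -- (c) non-degeneracy
                    (∀ n : ℤ, N₁ ≤ n → n ≤ N₂ → ∀ p : H,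
                      (C₀⁻¹ ≤ ‖XD (φ n) p‖ ∧ C₀⁻¹ ≤ ‖YD (φ n) p‖) ∧
                      C₀ ^ (-(4 : ℝ)) * ‖XD (Heisenberg.phiGe A ε N₂ φ N₁) p‖ *
                          ‖YD (Heisenberg.phiGe A ε N₂ φ N₁) p‖ ≤
                        wedgeNorm ![XD (Heisenberg.phiGe A ε N₂ φ N₁) p,
                          YD (Heisenberg.phiGe A ε N₂ φ N₁) p] ∧
                      C₀ ^ (-(17 : ℝ)) * A ^ (-(4 * (n : ℝ))) *
                          ‖XD (Heisenberg.phiGe A ε N₂ φ n) p‖ *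
                          ‖YD (Heisenberg.phiGe A ε N₂ φ n) p‖ ≤
                        wedgeNorm ![XD (Heisenberg.phiGe A ε N₂ φ n) p,
                          YD (Heisenberg.phiGe A ε N₂ φ n) p,
                          ZD (Heisenberg.phiGe A ε N₂ φ n) p,
                          XD (XD (Heisenberg.phiGe A ε N₂ φ n)) p,
                          YD (YD (Heisenberg.phiGe A ε N₂ φ n)) p,
                          XD (YD (Heisenberg.phiGe A ε N₂ φ n)) p]) := by
  intro α hα hα1
  obtain ⟨K, κ, A₀, hK, hκ, hA₀, htower⟩ := exists_isTower
  have hκ' : 0 < κ⁻¹ := inv_pos.2 hκ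
  refine ⟨2 + κ⁻¹ + 21 * 2 ^ 20 * (29 * K), by nlinarith, fun C₀ hC => ⟨A₀, hA₀, ?_⟩⟩
  intro A _ hA ε hε _ N₁ N₂ hN
  have hA1 : 1 ≤ A := hA₀.trans hA
  have hA0 : 0 < A := by linarith
  obtain ⟨Φ, Ψ, h⟩ := htower A hA (A ^ (-ε)) (Real.rpow_nonneg hA0.le _)
    (Real.rpow_le_one_of_one_le_of_nonpos hA1 (by linarith))
  have hC2 : 2 ≤ C₀ := by nlinarith
  have hCκ : κ⁻¹ ≤ C₀ := by nlinarith
  have hCK : 21 * 2 ^ 20 * (29 * K) ≤ C₀ := by nlinarith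
  have hR : ∀ n : ℤ, 0 < A ^ n := fun n => zpow_pos hA0 n
  refine ⟨scaleMap A N₂ Φ, contDiff_scaleMap h, fun n _ _ => ?_, ?_, fun n _ _ p =>
    ⟨sum_inner_scaleMap_eq_zero hA0 h true p, sum_inner_scaleMap_eq_zero hA0 h false p⟩,
    fun n _ hn p => ⟨⟨?_, ?_⟩, ?_, ?_⟩⟩
  · rw [Real.rpow_intCast]
    refine (CkRS_le (hR n) (by positivity) fun l _ hl p =>
      norm_foldr_WD_slowMap_le (N := 20) (h.bdd _) (hR n) l (by omega) p).trans ?_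
    refine ENNReal.ofReal_le_ofReal ?_
    have := mul_le_mul_of_nonneg_right hCK (hR n).le
    norm_num at this ⊢
    linarith
  · rw [phiGe_scaleMap hA0 h hN, Real.rpow_neg hA0.le, Real.rpow_intCast]
    refine (CkAS_le (contDiff_slowMap (h.contDiff _) _) (hR N₁) (by positivity) hα hα1.le
      fun l hl2 hl p => norm_foldr_WD_slowMap_le_of_hessian (N := 20) (h.contDiff _)
        (h.bddWW _) (hR N₁) l hl2 (by omega) p).trans ?_
    refine ENNReal.ofReal_le_ofReal ?_
    have := mul_le_mul_of_nonneg_right hCK (inv_pos.2 (hR N₁)).le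
    have e : A ^ N₁ * ((A ^ N₁) ^ 2)⁻¹ = (A ^ N₁)⁻¹ := by
      have := (hR N₁).ne'
      field_simp
    rw [e]
    norm_num at this ⊢
    linarith
  · exact (inv_anti₀ (by norm_num) hC2).trans
      (by simpa [WD] using half_le_norm_WD_scaleMap (N₂ := N₂) hA0 h n true p)
  · exact (inv_anti₀ (by norm_num) hC2).trans
      (by simpa [WD] using half_le_norm_WD_scaleMap (N₂ := N₂) hA0 h n false p)
  · rw [phiGe_scaleMap hA0 h hN, mul_assoc]
    exact (mul_le_mul_of_nonneg_right (rpow_neg_le hκ (by linarith) hCκ (by norm_num))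
      (by positivity)).trans (wedge_pair_slowMap (h.contDiff _) (hR N₁) (h.wedge_pair _) p)
  · have e : A ^ (-(4 * (n : ℝ))) = ((A ^ n) ^ 4)⁻¹ := by
      rw [Real.rpow_neg hA0.le, mul_comm, Real.rpow_mul hA0.le, Real.rpow_intCast]
      norm_cast
    rw [phiGe_scaleMap hA0 h hn, mul_assoc _ ‖_‖, e]
    have hRn := hR n
    exact (mul_le_mul_of_nonneg_right (mul_le_mul_of_nonneg_right
      (rpow_neg_le hκ (by linarith) hCκ (by norm_num)) (by positivity)) (by positivity)).trans
      (wedge_sextuple_slowMap (h.contDiff _) (hR n) (h.wedge_sextuple _) p)
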